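/- arXiv:0808.2822 — 2 statements merged into one kernel-verified Lean document; each statement's English description precedes it below -/
import Mathlib

section
/- For every n ≥ 1 there exists a bijection ψ from the set of Dyck paths of type B_n onto NC(B_n) such that for every type B_n Dyck path w both area(w) = l_S(rev(ψ(w))) and maj(w) + maj_B(rev(ψ(w))) + imaj_B(rev(ψ(w))) = 2n². -/
open scoped Classical

namespace Stmt

/-- Number of north steps (`true`) among the first `k` steps of the path `w`. -/
def countN {m : ℕ} (w : Fin m → Bool) (k : ℕ) : ℕ :=
  (Finset.univ.filter (fun t : Fin m => (t : ℕ) < k ∧ w t = true)).card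

/-- Number of east steps (`false`) among the first `k` steps of the path `w`. -/
def countE {m : ℕ} (w : Fin m → Bool) (k : ℕ) : ℕ :=
  (Finset.univ.filter (fun t : Fin m => (t : ℕ) < k ∧ w t = false)).card

/-- A Dyck path of length `n`: `n` north and `n` east steps, every prefix has
at least as many north as east steps. -/
def IsDyckA (n : ℕ) (w : Fin (2 * n) → Bool) : Prop :=
  countN w (2 * n) = n ∧ ∀ k : ℕ, countE w k ≤ countN w k

/-- A Dyck path of type `B_n`: `2n` steps, every prefix has at least as many
north as east steps. -/
def IsDyckB (n : ℕ) (w : Fin (2 * n) → Bool) : Prop :=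
  ∀ k : ℕ, countE w k ≤ countN w k

/-- The unit cell `[i-1,i] × [j-1,j]` lies below the lattice path `w`:
at some time the path has `x`-coordinate `< i` and `y`-coordinate `≥ j`. -/
def CellBelow {m : ℕ} (w : Fin m → Bool) (i j : ℕ) : Prop :=
  ∃ k : ℕ, countE w k < i ∧ j ≤ countN w k

/-- Area of a (type `A`) Dyck path: number of cells `b_{i,j}` with `i < j`
lying below the path. -/
noncomputable def areaA {m : ℕ} (w : Fin m → Bool) : ℕ :=
  {p : ℕ × ℕ | 1 ≤ p.1 ∧ p.1 < p.2 ∧ CellBelow w p.1 p.2}.ncard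

/-- Area of a type `B_n` Dyck path: number of cells `b_{i,j}` with
`1 ≤ i < j ≤ 2n+1-i` lying below the path. -/
noncomputable def areaB (n : ℕ) (w : Fin (2 * n) → Bool) : ℕ :=
  {p : ℕ × ℕ | 1 ≤ p.1 ∧ p.1 < p.2 ∧ p.2 ≤ 2 * n + 1 - p.1 ∧
    CellBelow w p.1 p.2}.ncard

/-- Descent set of a path, 1-indexed: positions `i` with `w_i = E`, `w_{i+1} = N`. -/
def pathDes {m : ℕ} (w : Fin m → Bool) : Finset ℕ :=
  (Finset.Ioo 0 m).filter (fun i =>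
    ∃ h : i < m, w ⟨i - 1, Nat.lt_of_le_of_lt (Nat.sub_le i 1) h⟩ = false ∧ w ⟨i, h⟩ = true)

def desPath {m : ℕ} (w : Fin m → Bool) : ℕ := (pathDes w).card

/-- Major index of a Dyck path of length `n`: `maj(w) = ∑_{i ∈ Des(w)} (2n - i)`. -/
def majA (n : ℕ) (w : Fin (2 * n) → Bool) : ℕ :=
  ∑ i ∈ pathDes w, (2 * n - i)

/-- Number of east steps of a path. -/
def negPath {m : ℕ} (w : Fin m → Bool) : ℕ :=
  (Finset.univ.filter (fun t : Fin m => w t = false)).card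

/-- Type `B` major index: `maj(w) = 2 ⬝ (neg(w) + ∑_{i ∈ Des(w)} (2n - i))`. -/
def majB (n : ℕ) (w : Fin (2 * n) → Bool) : ℕ :=
  2 * (negPath w + ∑ i ∈ pathDes w, (2 * n - i))

/-- A signed permutation of rank `n`, encoded as a permutation of `ℤ` that is
odd (`σ(-x) = -σ(x)`) and fixes every point outside `{±1,…,±n}`. -/
def IsSignedPerm (n : ℕ) (σ : Equiv.Perm ℤ) : Prop :=
  (∀ x : ℤ, σ (-x) = -σ x) ∧ ∀ x : ℤ, ¬(1 ≤ |x| ∧ |x| ≤ (n : ℤ)) → σ x = x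

/-- `x` belongs to the ground set `{±1,…,±n}`. -/
def InB (n : ℕ) (x : ℤ) : Prop := 1 ≤ |x| ∧ |x| ≤ (n : ℤ)

/-- Position of `x` in the total order `-1 < -2 < ⋯ < -n < 1 < 2 < ⋯ < n`. -/
def bKey (n : ℕ) (x : ℤ) : ℤ := if x < 0 then -x else x + (n : ℤ)

/-- `σ` maps each element of every orbit to the cyclically next element of
that orbit with respect to the order `-1 < -2 < ⋯ < -n < 1 < ⋯ < n`. -/
def IncCyclesB (n : ℕ) (σ : Equiv.Perm ℤ) : Prop :=
  ∀ x : ℤ, InB n x →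
    ((∃ y, σ.SameCycle x y ∧ bKey n x < bKey n y) →
      bKey n x < bKey n (σ x) ∧
        ∀ y, σ.SameCycle x y → bKey n x < bKey n y → bKey n (σ x) ≤ bKey n y) ∧
    ((∀ y, σ.SameCycle x y → bKey n y ≤ bKey n x) →
      ∀ y, σ.SameCycle x y → bKey n (σ x) ≤ bKey n y)

/-- No two distinct orbits of `σ` cross, with respect to the order
`-1 < -2 < ⋯ < -n < 1 < ⋯ < n`. -/
def NoCrossingB (n : ℕ) (σ : Equiv.Perm ℤ) : Prop :=
  ¬ ∃ a b c d : ℤ, InB n a ∧ InB n b ∧ InB n c ∧ InB n d ∧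
      bKey n a < bKey n b ∧ bKey n b < bKey n c ∧ bKey n c < bKey n d ∧
      σ.SameCycle a c ∧ σ.SameCycle b d ∧ ¬σ.SameCycle a b

/-- At most one orbit `B` satisfies `B = -B`. -/
def AtMostOneSym (n : ℕ) (σ : Equiv.Perm ℤ) : Prop :=
  ∀ x y : ℤ, InB n x → InB n y → σ.SameCycle x (-x) → σ.SameCycle y (-y) →
    σ.SameCycle x y

/-- Non-crossing "partitions" of type `B_n`, as signed permutations whose orbits
form a non-crossing type `B_n` set partition, each element being mapped to the
cyclically next element of its orbit. -/
def IsNCB (n : ℕ) (σ : Equiv.Perm ℤ) : Prop :=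
  IsSignedPerm n σ ∧ IncCyclesB n σ ∧ NoCrossingB n σ ∧ AtMostOneSym n σ

/-- One-line notation `(σ(1),…,σ(n))` of a signed permutation. -/
def word (n : ℕ) (σ : Equiv.Perm ℤ) : Fin n → ℤ := fun i => σ ((i : ℤ) + 1)

/-- Positions of the negative entries of an integer word. -/
def negSetW {n : ℕ} (f : Fin n → ℤ) : Finset (Fin n) :=
  Finset.univ.filter (fun i => f i < 0)

/-- Number of inversions of an integer word. -/
def invW {n : ℕ} (f : Fin n → ℤ) : ℕ :=
  (Finset.univ.filter (fun p : Fin n × Fin n => p.1 < p.2 ∧ f p.2 < f p.1)).card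

/-- Coxeter length of a signed permutation with one-line notation `f`:
`l_S = inv(f) - ∑_{i ∈ Neg(f)} f i`. -/
def lSW {n : ℕ} (f : Fin n → ℤ) : ℤ :=
  (invW f : ℤ) - ∑ i ∈ negSetW f, f i

/-- Major index of an integer word: sum of the (1-indexed) descent positions. -/
def majW {n : ℕ} (f : Fin n → ℤ) : ℕ :=
  ∑ i ∈ Finset.univ.filter
      (fun i : Fin n => ∃ h : (i : ℕ) + 1 < n, f ⟨(i : ℕ) + 1, h⟩ < f i),
    ((i : ℕ) + 1)

/-- Type `B` major index of a signed permutation with one-line notation `f`: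
`maj_B = 2 ⬝ maj(f) + neg(f)`. -/
def majBW {n : ℕ} (f : Fin n → ℤ) : ℕ := 2 * majW f + (negSetW f).card

/-- One-line notation of the inverse of the signed permutation with one-line
notation `f` (the sum picks out the unique matching position). -/
def wInv {n : ℕ} (f : Fin n → ℤ) : Fin n → ℤ :=
  fun j => ∑ i : Fin n,
    if f i = (j : ℤ) + 1 then (i : ℤ) + 1
    else if f i = -((j : ℤ) + 1) then -((i : ℤ) + 1) else 0

/-- `imaj_B` of the signed permutation with one-line notation `f`. -/
def imajBW {n : ℕ} (f : Fin n → ℤ) : ℕ := majBW (wInv f)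

/-- One-line notation of `rev σ`: the subsequence of negative entries is
reversed in place (the sum picks the entry at the mirrored negative position). -/
def revW {n : ℕ} (f : Fin n → ℤ) : Fin n → ℤ :=
  fun i =>
    if 0 ≤ f i then f i
    else
      ∑ j : Fin n,
        if f j < 0 ∧
            (Finset.univ.filter (fun t : Fin n => f t < 0 ∧ t ≤ i)).card =
              (Finset.univ.filter (fun t : Fin n => f t < 0 ∧ j ≤ t)).card
          then f j else 0

section Orbits

variable {n : ℕ} {σ : Equiv.Perm ℤ}

theorem IsSignedPerm.sameCycle_neg (h : IsSignedPerm n σ) {x y : ℤ} :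
    σ.SameCycle (-x) (-y) ↔ σ.SameCycle x y := by
  have hc : Equiv.neg ℤ * σ * (Equiv.neg ℤ)⁻¹ = σ := by
    ext z
    have : (Equiv.neg ℤ)⁻¹ z = -z := rfl
    simp [Equiv.Perm.mul_apply, this, h.1]
  have := Equiv.Perm.sameCycle_conj (f := σ) (g := Equiv.neg ℤ) (x := x) (y := y)
  rw [hc] at this
  exact this.symm

theorem IsSignedPerm.sameCycle_neg' (h : IsSignedPerm n σ) {x y : ℤ} :
    σ.SameCycle (-x) y ↔ σ.SameCycle x (-y) := by
  rw [← h.sameCycle_neg (x := x) (y := -y), neg_neg]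

theorem IsSignedPerm.inB_of_sameCycle (h : IsSignedPerm n σ) {x y : ℤ} (hx : InB n x)
    (hxy : σ.SameCycle x y) : InB n y := by
  by_contra hy
  have hfix : σ y = y := h.2 y hy
  have : x = y := by
    obtain ⟨k, hk⟩ := hxy.symm
    rw [Equiv.Perm.zpow_apply_eq_self_of_apply_eq_self hfix] at hk
    exact hk.symm
  exact hy (this ▸ hx)

theorem inB_iff {x : ℤ} : InB n x ↔ (1 ≤ x ∧ x ≤ n) ∨ (1 ≤ -x ∧ -x ≤ n) := by
  unfold InB
  rcases abs_cases x with ⟨h, _⟩ | ⟨h, _⟩ <;> rw [h] <;> omega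

theorem IsNCB.apply_of_lt (h : IsNCB n σ) {x y : ℤ} (hx : 1 ≤ x) (hxn : x ≤ n)
    (hxy : σ.SameCycle x y) (hlt : x < y) : x < σ x ∧ σ x ≤ y := by
  have hxB : InB n x := inB_iff.2 (Or.inl ⟨hx, hxn⟩)
  have hyB := inB_iff.1 (h.1.inB_of_sameCycle hxB hxy)
  have hsB := inB_iff.1 (h.1.inB_of_sameCycle hxB (Equiv.Perm.SameCycle.refl σ x).apply_right)
  have hk : bKey n x < bKey n y := by unfold bKey; split_ifs <;> omega
  obtain ⟨h1, h2⟩ := (h.2.1 x hxB).1 ⟨y, hxy, hk⟩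
  have h3 := h2 y hxy hk
  unfold bKey at h1 h3
  split_ifs at h1 h3 <;> omega

theorem IsNCB.bKey_apply_le (h : IsNCB n σ) {x : ℤ} (hx : 1 ≤ x) (hxn : x ≤ n)
    (hmax : ∀ y, σ.SameCycle x y → y ≤ x) {y : ℤ} (hxy : σ.SameCycle x y) :
    bKey n (σ x) ≤ bKey n y := by
  have hxB : InB n x := inB_iff.2 (Or.inl ⟨hx, hxn⟩)
  refine (h.2.1 x hxB).2 (fun z hz => ?_) y hxy
  have hzB := inB_iff.1 (h.1.inB_of_sameCycle hxB hz)
  have := hmax z hz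
  unfold bKey; split_ifs <;> omega

theorem IsNCB.apply_of_neg (h : IsNCB n σ) {x z : ℤ} (hx : 1 ≤ x) (hxn : x ≤ n)
    (hmax : ∀ y, σ.SameCycle x y → y ≤ x) (hxz : σ.SameCycle x z) (hz : z < 0) :
    σ x < 0 ∧ z ≤ σ x := by
  have hxB : InB n x := inB_iff.2 (Or.inl ⟨hx, hxn⟩)
  have hzB := inB_iff.1 (h.1.inB_of_sameCycle hxB hxz)
  have hsB := inB_iff.1 (h.1.inB_of_sameCycle hxB (Equiv.Perm.SameCycle.refl σ x).apply_right)
  have := h.bKey_apply_le hx hxn hmax hxz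
  unfold bKey at this
  split_ifs at this <;> omega

theorem IsNCB.apply_of_pos (h : IsNCB n σ) {x : ℤ} (hx : 1 ≤ x) (hxn : x ≤ n)
    (hmax : ∀ y, σ.SameCycle x y → y ≤ x) (hpos : ∀ y, σ.SameCycle x y → 0 < y) :
    0 < σ x ∧ ∀ y, σ.SameCycle x y → σ x ≤ y := by
  have hs := hpos _ (Equiv.Perm.SameCycle.refl σ x).apply_right
  refine ⟨hs, fun y hy => ?_⟩
  have h1 := h.bKey_apply_le hx hxn hmax hy
  have h2 := hpos y hy
  unfold bKey at h1
  split_ifs at h1 <;> omega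

theorem IsNCB.apply_neg_iff (h : IsNCB n σ) {x : ℤ} (hx : 1 ≤ x) (hxn : x ≤ n) :
    σ x < 0 ↔ (∀ y, σ.SameCycle x y → y ≤ x) ∧ ∃ z < 0, σ.SameCycle x z := by
  constructor
  · intro hs
    refine ⟨fun y hy => ?_, σ x, hs, (Equiv.Perm.SameCycle.refl σ x).apply_right⟩
    by_contra hlt
    have := h.apply_of_lt hx hxn hy (not_le.1 hlt)
    omega
  · rintro ⟨hmax, z, hz, hxz⟩
    exact (h.apply_of_neg hx hxn hmax hxz hz).1

theorem IsNCB.nc (h : IsNCB n σ) {a b c d : ℤ} (ha : 1 ≤ a) (hab : a < b) (hbc : b < c)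
    (hcd : c < d) (hd : d ≤ n) (hac : σ.SameCycle a c) (hbd : σ.SameCycle b d) :
    σ.SameCycle a b := by
  by_contra hn
  refine h.2.2.1 ⟨a, b, c, d, ?_, ?_, ?_, ?_, ?_, ?_, ?_, hac, hbd, hn⟩
  all_goals first
    | (apply inB_iff.2; omega)
    | (unfold bKey; split_ifs <;> omega)

theorem IsNCB.outer (h : IsNCB n σ) {z a b c : ℤ} (hz : z < 0) (ha : 1 ≤ a) (hab : a < b)
    (hbc : b < c) (hc : c ≤ n) (hac : σ.SameCycle a c) (hbz : σ.SameCycle b z) :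
    σ.SameCycle a b := by
  by_contra hn
  have hB : InB n b := inB_iff.2 (by omega)
  have hzB := inB_iff.1 (h.1.inB_of_sameCycle hB hbz)
  refine h.2.2.1 ⟨z, a, b, c, ?_, ?_, ?_, ?_, ?_, ?_, ?_, hbz.symm, hac,
    fun hza => hn (hbz.trans hza).symm⟩
  all_goals first
    | (apply inB_iff.2; omega)
    | (unfold bKey; split_ifs <;> omega)

/-- The straddling orbits are nested: their positive parts and their negative parts are
in opposite orders. -/
theorem IsNCB.straddle (h : IsNCB n σ) {a b c d : ℤ} (ha : 1 ≤ a) (hab : a < b) (hb : b ≤ n)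
    (hc : 1 ≤ c) (hcd : c < d) (hd : d ≤ n) (hac : σ.SameCycle (-a) c)
    (hbd : σ.SameCycle (-b) d) : σ.SameCycle c d := by
  by_contra hn
  refine h.2.2.1 ⟨-a, -b, c, d, ?_, ?_, ?_, ?_, ?_, ?_, ?_, hac, hbd,
    fun hab' => hn (hac.symm.trans (hab'.trans hbd))⟩
  all_goals first
    | (apply inB_iff.2; omega)
    | (unfold bKey; split_ifs <;> omega)

/-- Positions `x` of negative entries come in pairs `x, x'` such that `-x'` lies in the orbit
of `x`. -/
theorem IsNCB.exists_partner (h : IsNCB n σ) {x : ℤ} (hx : 1 ≤ x) (hxn : x ≤ n)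
    (hs : σ x < 0) :
    ∃ x' : ℤ, 1 ≤ x' ∧ x' ≤ n ∧ σ x' < 0 ∧ σ.SameCycle x (-x') := by
  classical
  have hxB : InB n x := inB_iff.2 (Or.inl ⟨hx, hxn⟩)
  obtain ⟨hmax, z, hz, hxz⟩ := (h.apply_neg_iff hx hxn).1 hs
  have hzB := inB_iff.1 (h.1.inB_of_sameCycle hxB hxz)
  let s := (Finset.Icc (1 : ℤ) n).filter (fun y => σ.SameCycle x (-y))
  have hne : s.Nonempty := ⟨-z, by simp only [s, Finset.mem_filter, Finset.mem_Icc, neg_neg]; exact ⟨by omega, hxz⟩⟩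
  obtain ⟨m, hm, hmmax⟩ := s.exists_max_image id hne
  simp only [s, Finset.mem_filter, Finset.mem_Icc, id] at hm hmmax
  refine ⟨m, hm.1.1, hm.1.2, (h.apply_neg_iff hm.1.1 hm.1.2).2 ⟨fun y hy => ?_, -x, by omega, ?_⟩,
    hm.2⟩
  · by_contra hlt
    have hyB := inB_iff.1 (h.1.inB_of_sameCycle (inB_iff.2 (Or.inl hm.1)) hy)
    exact hlt (hmmax y ⟨by omega, hm.2.trans (h.1.sameCycle_neg.2 hy)⟩)
  · exact (h.1.sameCycle_neg'.1 hm.2.symm)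

end Orbits

theorem card_ge_injOn {n : ℕ} (p : Fin n → Prop) [DecidablePred p] {i j : Fin n} (hi : p i) (hj : p j)
    (h : (Finset.univ.filter (fun t : Fin n => p t ∧ i ≤ t)).card =
      (Finset.univ.filter (fun t : Fin n => p t ∧ j ≤ t)).card) : i = j := by
  wlog hij : i ≤ j generalizing i j
  · exact (this hj hi h.symm (le_of_not_ge hij)).symm
  have hsub : Finset.univ.filter (fun t : Fin n => p t ∧ j ≤ t) ⊆
      Finset.univ.filter (fun t : Fin n => p t ∧ i ≤ t) := by
    intro t
    simp only [Finset.mem_filter, Finset.mem_univ, true_and]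
    exact fun ht => ⟨ht.1, hij.trans ht.2⟩
  have heq := Finset.eq_of_subset_of_card_le hsub h.le
  have : i ∈ Finset.univ.filter (fun t : Fin n => p t ∧ j ≤ t) := by
    rw [heq]; simp [hi]
  simp only [Finset.mem_filter, Finset.mem_univ, true_and] at this
  exact le_antisymm hij this.2

theorem revW_eq_of_card_eq {n : ℕ} {f : Fin n → ℤ} {i j : Fin n} (hi : f i < 0) (hj : f j < 0)
    (h : (Finset.univ.filter (fun t : Fin n => f t < 0 ∧ t ≤ i)).card =
      (Finset.univ.filter (fun t : Fin n => f t < 0 ∧ j ≤ t)).card) : revW f i = f j := by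
  unfold revW
  rw [if_neg (not_le.2 hi), Finset.sum_eq_single j]
  · rw [if_pos ⟨hj, h⟩]
  · intro k _ hk
    rw [if_neg]
    rintro ⟨hk', hc⟩
    exact hk (card_ge_injOn (fun t => f t < 0) hk' hj (hc.symm.trans h))
  · simp

theorem revW_of_nonneg {n : ℕ} {f : Fin n → ℤ} {i : Fin n} (hi : 0 ≤ f i) : revW f i = f i := by
  unfold revW
  rw [if_pos hi]

theorem exists_fin {n : ℕ} {x : ℤ} (hx : 1 ≤ x) (hxn : x ≤ n) : ∃ i : Fin n, (i : ℤ) + 1 = x :=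
  ⟨⟨(x - 1).toNat, by omega⟩, by simp; omega⟩

theorem IsNCB.exists_mirror {n : ℕ} {σ : Equiv.Perm ℤ} (h : IsNCB n σ) (j : Fin n)
    (hj : word n σ j < 0) :
    ∃ i, word n σ i < 0 ∧ σ.SameCycle ((j : ℤ) + 1) (-((i : ℤ) + 1)) ∧
      (Finset.univ.filter (fun t : Fin n => word n σ t < 0 ∧ t ≤ i)).card =
        (Finset.univ.filter (fun t : Fin n => word n σ t < 0 ∧ j ≤ t)).card := by
  have hex : ∀ t : Fin n, word n σ t < 0 →
      ∃ i, word n σ i < 0 ∧ σ.SameCycle ((t : ℤ) + 1) (-((i : ℤ) + 1)) := by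
    intro t ht
    obtain ⟨x', h1, h2, h3, h4⟩ := h.exists_partner (x := (t : ℤ) + 1) (by omega) (by omega) ht
    obtain ⟨i, rfl⟩ := exists_fin h1 h2
    exact ⟨i, h3, h4⟩
  have hmax : ∀ t : Fin n, word n σ t < 0 → ∀ y, σ.SameCycle ((t : ℤ) + 1) y → y ≤ (t : ℤ) + 1 :=
    fun t ht => ((h.apply_neg_iff (by omega) (by omega)).1 ht).1
  have huniq : ∀ s t : Fin n, word n σ s < 0 → word n σ t < 0 →
      σ.SameCycle ((s : ℤ) + 1) ((t : ℤ) + 1) → s = t := by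
    intro s t hs ht hst
    have h1 := hmax s hs _ hst
    have h2 := hmax t ht _ hst.symm
    ext; omega
  have hanti : ∀ s t s' t' : Fin n, word n σ s < 0 → word n σ t < 0 → word n σ s' < 0 →
      word n σ t' < 0 → σ.SameCycle ((s : ℤ) + 1) (-((s' : ℤ) + 1)) →
      σ.SameCycle ((t : ℤ) + 1) (-((t' : ℤ) + 1)) → s ≤ t → t' ≤ s' := by
    intro s t s' t' hs ht hs' ht' hss htt hst
    by_contra hlt
    rcases hst.lt_or_eq with hst | rfl
    · have := huniq s t hs ht (h.straddle (a := (s' : ℤ) + 1) (b := (t' : ℤ) + 1)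
        (by omega) (by omega) (by omega) (by omega) (by omega) (by omega) hss.symm htt.symm)
      omega
    · have := huniq s' t' hs' ht' (h.1.sameCycle_neg.1 (hss.symm.trans htt))
      omega
  obtain ⟨i, hi, hji⟩ := hex j hj
  refine ⟨i, hi, hji, ?_⟩
  choose! m hm using hex
  refine Finset.card_bij (fun t _ => m t) ?_ ?_ ?_
  · intro t ht
    simp only [Finset.mem_filter, Finset.mem_univ, true_and] at ht ⊢
    exact ⟨(hm t ht.1).1, hanti t i (m t) j ht.1 hi (hm t ht.1).1 hj (hm t ht.1).2
      (by rw [← h.1.sameCycle_neg, neg_neg]; exact hji.symm) ht.2⟩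
  · intro s hs t ht hst
    simp only [Finset.mem_filter, Finset.mem_univ, true_and] at hs ht
    have h1 := (hm s hs.1).2
    have h2 := (hm t ht.1).2
    rw [hst] at h1
    exact huniq s t hs.1 ht.1 (h1.trans h2.symm)
  · intro t ht
    simp only [Finset.mem_filter, Finset.mem_univ, true_and] at ht
    have hmt := hm t ht.1
    have hmt' : σ.SameCycle ((m t : ℤ) + 1) (-((t : ℤ) + 1)) := by
      rw [← h.1.sameCycle_neg, neg_neg]; exact hmt.2.symm
    refine ⟨m t, ?_, ?_⟩
    · simp only [Finset.mem_filter, Finset.mem_univ, true_and]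
      exact ⟨hmt.1, hanti j t i (m t) hj ht.1 hi hmt.1 hji hmt.2 ht.2⟩
    · have hmm := hm (m t) hmt.1
      exact huniq _ _ hmm.1 ht.1 (h.1.sameCycle_neg.1 (hmm.2.symm.trans hmt'))

theorem IsNCB.exists_revW_eq {n : ℕ} {σ : Equiv.Perm ℤ} (h : IsNCB n σ) (i : Fin n)
    (hi : word n σ i < 0) :
    ∃ j, word n σ j < 0 ∧ σ.SameCycle ((i : ℤ) + 1) (-((j : ℤ) + 1)) ∧
      revW (word n σ) i = word n σ j := by
  obtain ⟨j, hj, hij, -⟩ := h.exists_mirror i hi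
  obtain ⟨k, hk, hjk, hc⟩ := h.exists_mirror j hj
  have hik : σ.SameCycle ((i : ℤ) + 1) ((k : ℤ) + 1) := by
    rw [← h.1.sameCycle_neg]
    exact (h.1.sameCycle_neg'.2 hij).trans hjk
  have h1 := ((h.apply_neg_iff (by omega) (by omega)).1 hi).1 _ hik
  have h2 := ((h.apply_neg_iff (by omega) (by omega)).1 hk).1 _ hik.symm
  have : k = i := by ext; omega
  subst this
  exact ⟨j, hj, hij, revW_eq_of_card_eq hk hj hc⟩

theorem IsNCB.revW_neg_iff {n : ℕ} {σ : Equiv.Perm ℤ} (h : IsNCB n σ) (i : Fin n) :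
    revW (word n σ) i < 0 ↔ word n σ i < 0 := by
  by_cases hi : word n σ i < 0
  · obtain ⟨j, hj, -, hr⟩ := h.exists_revW_eq i hi
    rw [hr]; exact iff_of_true hj hi
  · rw [revW_of_nonneg (not_lt.1 hi)]

/-- A type `B` non-crossing partition is determined by the reversal of its word. -/
theorem IsNCB.eq_of_revW_eq {n : ℕ} {σ τ : Equiv.Perm ℤ} (hσ : IsNCB n σ) (hτ : IsNCB n τ)
    (h : revW (word n σ) = revW (word n τ)) : σ = τ := by
  have hneg : ∀ i, word n σ i < 0 ↔ word n τ i < 0 := by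
    intro i
    rw [← hσ.revW_neg_iff, h, hτ.revW_neg_iff]
  have hword : ∀ i, word n σ i = word n τ i := by
    intro i
    by_cases hi : word n σ i < 0
    · obtain ⟨j, hj, -, hc⟩ := hσ.exists_mirror i hi
      have hc' := hc
      simp only [hneg] at hc'
      rw [← revW_eq_of_card_eq hj hi hc, h]
      exact revW_eq_of_card_eq ((hneg j).1 hj) ((hneg i).1 hi) hc'
    · have h1 := revW_of_nonneg (not_lt.1 hi)
      rw [hneg] at hi
      have h2 := revW_of_nonneg (not_lt.1 hi)
      rw [← h1, h, h2]
  have hpos : ∀ x : ℤ, 1 ≤ x → x ≤ n → σ x = τ x := by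
    intro x hx hxn
    obtain ⟨i, rfl⟩ := exists_fin hx hxn
    exact hword i
  ext x
  by_cases hx : InB n x
  · rcases inB_iff.1 hx with ⟨h1, h2⟩ | ⟨h1, h2⟩
    · exact hpos x h1 h2
    · have := hpos (-x) h1 h2
      rw [hσ.1.1, hτ.1.1] at this
      omega
  · rw [hσ.1.2 x hx, hτ.1.2 x hx]

/-- The reversal `f` of the word of a type `B` non-crossing partition with orbit relation `R`:
a non-maximal positive element of an orbit is sent to the next element, and a maximal one to
the least positive element, with a minus sign if the orbit contains negative elements. -/
structure RevData (n : ℕ) (R : ℤ → ℤ → Prop) (f : Fin n → ℤ) : Prop where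
  refl : ∀ x, R x x
  symm : ∀ {x y}, R x y → R y x
  trans : ∀ {x y z}, R x y → R y z → R x z
  bdd : ∀ {x y : ℤ}, 1 ≤ x → x ≤ n → R x y → y ≤ n ∧ y ≠ 0
  nc : ∀ {a b c d : ℤ}, 1 ≤ a → a < b → b < c → c < d → d ≤ n → R a c → R b d → R a b
  outer : ∀ {z a b c : ℤ}, z < 0 → 1 ≤ a → a < b → b < c → c ≤ n → R a c → R b z → R a b
  up : ∀ (i : Fin n) (y : ℤ), R ((i : ℤ) + 1) y → (i : ℤ) + 1 < y →
    (i : ℤ) + 1 < f i ∧ R ((i : ℤ) + 1) (f i) ∧ f i ≤ y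
  neg : ∀ i : Fin n, (∀ y, R ((i : ℤ) + 1) y → y ≤ (i : ℤ) + 1) →
    ∀ z < 0, R ((i : ℤ) + 1) z →
      f i < 0 ∧ R ((i : ℤ) + 1) (-f i) ∧ ∀ y, R ((i : ℤ) + 1) y → 0 < y → -f i ≤ y
  pos : ∀ i : Fin n, (∀ y, R ((i : ℤ) + 1) y → y ≤ (i : ℤ) + 1) →
    (∀ y, R ((i : ℤ) + 1) y → 0 < y) →
      0 < f i ∧ R ((i : ℤ) + 1) (f i) ∧ ∀ y, R ((i : ℤ) + 1) y → f i ≤ y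

theorem IsNCB.revData {n : ℕ} {σ : Equiv.Perm ℤ} (h : IsNCB n σ) :
    RevData n σ.SameCycle (revW (word n σ)) where
  refl := Equiv.Perm.SameCycle.refl σ
  symm := Equiv.Perm.SameCycle.symm
  trans := Equiv.Perm.SameCycle.trans
  bdd hx hxn hxy := by
    have := inB_iff.1 (h.1.inB_of_sameCycle (inB_iff.2 (Or.inl ⟨hx, hxn⟩)) hxy)
    omega
  nc := h.nc
  outer := h.outer
  up i y hy hlt := by
    have h1 := h.apply_of_lt (by omega) (by omega) hy hlt
    have : 0 ≤ word n σ i := by unfold word; omega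
    rw [revW_of_nonneg this]
    exact ⟨h1.1, (Equiv.Perm.SameCycle.refl σ _).apply_right, h1.2⟩
  neg i hmax z hz hiz := by
    have hi : word n σ i < 0 := (h.apply_of_neg (by omega) (by omega) hmax hiz hz).1
    obtain ⟨j, hj, hij, hr⟩ := h.exists_revW_eq i hi
    rw [hr]
    have hjmax := ((h.apply_neg_iff (by omega) (by omega)).1 hj).1
    refine ⟨hj, hij.trans ?_, fun y hy hy0 => ?_⟩
    · rw [h.1.sameCycle_neg]
      exact (Equiv.Perm.SameCycle.refl σ _).apply_right
    · have hjy : σ.SameCycle ((j : ℤ) + 1) (-y) := by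
        rw [← h.1.sameCycle_neg, neg_neg]
        exact hij.symm.trans hy
      have := (h.apply_of_neg (by omega) (by omega) hjmax hjy (by omega)).2
      change -(σ _) ≤ y
      omega
  pos i hmax hpos := by
    have h1 := h.apply_of_pos (by omega) (by omega) hmax hpos
    have : 0 ≤ word n σ i := h1.1.le
    rw [revW_of_nonneg this]
    exact ⟨h1.1, (Equiv.Perm.SameCycle.refl σ _).apply_right, h1.2⟩

/-- `x` is not the largest element of its class. -/
def Opens (R : ℤ → ℤ → Prop) (x : ℤ) : Prop := ∃ y, x < y ∧ R x y

/-- `x` is not the smallest element of its class. -/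
def Closes (R : ℤ → ℤ → Prop) (x : ℤ) : Prop := ∃ y, y < x ∧ R x y

namespace RevData

variable {n : ℕ} {R : ℤ → ℤ → Prop} {f : Fin n → ℤ}

theorem cases (h : RevData n R f) (i : Fin n) :
    ((i : ℤ) + 1 < f i ∧ f i ≤ n ∧ R ((i : ℤ) + 1) (f i) ∧
      ∀ y, R ((i : ℤ) + 1) y → (i : ℤ) + 1 < y → f i ≤ y) ∨
    (f i < 0 ∧ -f i ≤ (i : ℤ) + 1 ∧ R ((i : ℤ) + 1) (-f i) ∧
      (∀ y, R ((i : ℤ) + 1) y → y ≤ (i : ℤ) + 1) ∧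
      (∀ y, R ((i : ℤ) + 1) y → 0 < y → -f i ≤ y) ∧ ∃ z < 0, R ((i : ℤ) + 1) z) ∨
    (0 < f i ∧ f i ≤ (i : ℤ) + 1 ∧ R ((i : ℤ) + 1) (f i) ∧
      (∀ y, R ((i : ℤ) + 1) y → y ≤ (i : ℤ) + 1) ∧ ∀ y, R ((i : ℤ) + 1) y → f i ≤ y) := by
  by_cases hmax : ∀ y, R ((i : ℤ) + 1) y → y ≤ (i : ℤ) + 1
  · by_cases hpos : ∀ y, R ((i : ℤ) + 1) y → 0 < y
    · obtain ⟨h1, h2, h3⟩ := h.pos i hmax hpos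
      exact Or.inr (Or.inr ⟨h1, hmax _ h2, h2, hmax, h3⟩)
    · push Not at hpos
      obtain ⟨z, hz, hz0⟩ := hpos
      have := (h.bdd (by omega) (by omega) hz).2
      obtain ⟨h1, h2, h3⟩ := h.neg i hmax z (by omega) hz
      exact Or.inr (Or.inl ⟨h1, hmax _ h2, h2, hmax, h3, z, by omega, hz⟩)
  · push Not at hmax
    obtain ⟨y, hy, hlt⟩ := hmax
    obtain ⟨h1, h2, -⟩ := h.up i y hy hlt
    exact Or.inl ⟨h1, (h.bdd (by omega) (by omega) h2).1, h2,
      fun y hy hlt => (h.up i y hy hlt).2.2⟩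

theorem opens_iff (h : RevData n R f) (i : Fin n) :
    Opens R ((i : ℤ) + 1) ↔ (i : ℤ) + 1 < f i := by
  constructor
  · rintro ⟨y, hlt, hy⟩
    exact (h.up i y hy hlt).1
  · intro hlt
    rcases h.cases i with hc | hc | hc
    · exact ⟨f i, hlt, hc.2.2.1⟩
    · omega
    · omega

theorem abs_bounds (h : RevData n R f) (i : Fin n) : 1 ≤ |f i| ∧ |f i| ≤ n := by
  rcases h.cases i with hc | hc | hc
  · rw [abs_of_pos (by omega)]; omega
  · rw [abs_of_neg (by omega)]; omega
  · rw [abs_of_pos (by omega)]; omega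

theorem closes_abs_iff (h : RevData n R f) (i : Fin n) :
    Closes R |f i| ↔ (i : ℤ) + 1 < f i ∨ f i < 0 := by
  rcases h.cases i with ⟨h1, h2, h3, h4⟩ | ⟨h1, h2, h3, h4, h5, z, hz, h6⟩ | ⟨h1, h2, h3, h4, h5⟩
  · rw [abs_of_pos (by omega)]
    exact iff_of_true ⟨_, h1, h.symm h3⟩ (Or.inl h1)
  · rw [abs_of_neg (by omega)]
    exact iff_of_true ⟨z, by omega, h.trans (h.symm h3) h6⟩ (Or.inr h1)
  · rw [abs_of_pos (by omega)]
    refine iff_of_false ?_ (by omega)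
    rintro ⟨y, hy, hr⟩
    have := h5 y (h.trans h3 hr)
    omega

theorem abs_injective (h : RevData n R f) {i j : Fin n} (hij : |f i| = |f j|) : i = j := by
  wlog hlt : i ≤ j generalizing i j
  · exact (this hij.symm (le_of_not_ge hlt)).symm
  rcases hlt.lt_or_eq with hlt | rfl
  swap
  · rfl
  exfalso
  rcases h.cases i with ⟨h1, h2, h3, h4⟩ | ⟨h1, h2, h3, h4, h5, z, hz, h6⟩ | ⟨h1, h2, h3, h4, h5⟩ <;>
  rcases h.cases j with ⟨k1, k2, k3, k4⟩ | ⟨k1, k2, k3, k4, k5, w, hw, k6⟩ | ⟨k1, k2, k3, k4, k5⟩ <;>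
  first
    | rw [abs_of_pos (by omega), abs_of_pos (by omega)] at hij
    | rw [abs_of_pos (by omega), abs_of_neg (by omega)] at hij
    | rw [abs_of_neg (by omega), abs_of_pos (by omega)] at hij
    | rw [abs_of_neg (by omega), abs_of_neg (by omega)] at hij
  all_goals
    rw [← hij] at k3
    have hr := h.trans h3 (h.symm k3)
    have hr' := h.symm hr
    first
      | (have := h4 _ hr (by omega); omega)
      | (have := h4 _ hr; omega)
      | (have := k5 _ hr' (by omega); omega)
      | (have := k5 _ hr'; omega)

theorem exists_perm (h : RevData n R f) :
    ∃ τ : Equiv.Perm (Fin n), ∀ i, ((τ i : Fin n) : ℤ) + 1 = |f i| := by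
  have hex : ∀ i, ∃ j : Fin n, (j : ℤ) + 1 = |f i| := fun i =>
    exists_fin (h.abs_bounds i).1 (h.abs_bounds i).2
  choose t ht using hex
  have hinj : Function.Injective t := by
    intro i j hij
    apply h.abs_injective
    rw [← ht, ← ht, hij]
  exact ⟨Equiv.ofBijective t (Finite.injective_iff_bijective.1 hinj), ht⟩

theorem adjacent (h : RevData n R f) {x : ℤ} (hx : 1 ≤ x) (hxn : x + 1 ≤ n) (ho : Opens R x)
    (hc : Closes R (x + 1)) : R x (x + 1) := by
  obtain ⟨y, hy, hxy⟩ := ho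
  obtain ⟨z, hz, hxz⟩ := hc
  have hyn := (h.bdd hx (by omega) hxy).1
  have hz0 := (h.bdd (by omega) hxn hxz).2
  by_cases hy' : y = x + 1
  · exact hy' ▸ hxy
  by_cases hz' : z = x
  · exact h.symm (hz' ▸ hxz)
  by_cases hzn : z < 0
  · exact h.outer hzn hx (by omega) (by omega) hyn hxy hxz
  · have := h.nc (a := z) (b := x) (c := x + 1) (d := y) (by omega) (by omega) (by omega) (by omega)
      hyn (h.symm hxz) hxy
    exact h.symm (h.trans hxz this)

theorem asc_iff (h : RevData n R f) {i j : Fin n} (hij : (j : ℤ) = i + 1) :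
    f i < f j ↔ (¬ Opens R ((i : ℤ) + 1) ∧ ¬ Closes R ((j : ℤ) + 1)) ∨
      (Opens R ((j : ℤ) + 1) ∧ Closes R ((j : ℤ) + 1)) := by
  have hne : i ≠ j := by rintro rfl; omega
  have hadj : Opens R ((i : ℤ) + 1) → Closes R ((j : ℤ) + 1) → R ((i : ℤ) + 1) ((j : ℤ) + 1) := by
    rw [hij]
    exact h.adjacent (by omega) (by omega)
  rw [h.opens_iff i] at hadj ⊢
  rw [h.opens_iff j]
  have hab : f i ≠ f j := fun he => hne (h.abs_injective (by rw [he]))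
  rcases h.cases i with ⟨h1, h2, h3, h4⟩ | ⟨h1, h2, h3, h4, h5, z, hz, h6⟩ | ⟨h1, h2, h3, h4, h5⟩ <;>
  rcases h.cases j with ⟨k1, k2, k3, k4⟩ | ⟨k1, k2, k3, k4, k5, w, hw, k6⟩ | ⟨k1, k2, k3, k4, k5⟩
  · by_cases hc : Closes R ((j : ℤ) + 1)
    · have := h4 _ (hadj h1 hc) (by omega)
      grind
    · simp only [hc, and_false, or_false, not_false_eq_true, and_true]
      refine iff_of_false (fun hlt => hc ?_) (by omega)
      by_cases he : f i = (j : ℤ) + 1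
      · exact ⟨(i : ℤ) + 1, by omega, h.symm (he ▸ h3)⟩
      · exact ⟨(i : ℤ) + 1, by omega, h.symm (h.nc (by omega) (by omega) (by omega) hlt k2 h3 k3)⟩
  · omega
  · omega
  · by_cases hc : Closes R ((j : ℤ) + 1) <;> grind
  · have hc : Closes R ((j : ℤ) + 1) := ⟨w, by omega, k6⟩
    refine iff_of_false (fun hlt => ?_) (by grind)
    have := h.outer hz (a := -f j) (b := (i : ℤ) + 1) (c := (j : ℤ) + 1) (by omega) (by omega)
      (by omega) (by omega) (h.symm k3) h6
    have := h4 _ (h.symm (h.trans k3 this))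
    omega
  · by_cases hc : Closes R ((j : ℤ) + 1)
    · refine iff_of_false (fun hlt => ?_) (by grind)
      obtain ⟨y, hy, hr⟩ := hc
      have := k5 y hr
      by_cases he : f j = (i : ℤ) + 1
      · have := h4 _ (h.symm (he ▸ k3))
        omega
      have := h.outer hz (a := f j) (b := (i : ℤ) + 1) (c := (j : ℤ) + 1) (by omega) (by omega)
        (by omega) (by omega) (h.symm k3) h6
      have := h4 _ (h.symm (h.trans k3 this))
      omega
    · grind
  · by_cases hc : Closes R ((j : ℤ) + 1) <;> grind
  · have hc : Closes R ((j : ℤ) + 1) := ⟨w, by omega, k6⟩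
    grind
  · by_cases hc : Closes R ((j : ℤ) + 1)
    · refine iff_of_false (fun hlt => ?_) (by grind)
      obtain ⟨y, hy, hr⟩ := hc
      have := k5 y hr
      by_cases he : f j = (i : ℤ) + 1
      · have := h4 _ (h.symm (he ▸ k3))
        omega
      have := h.nc (a := f i) (b := f j) (c := (i : ℤ) + 1) (d := (j : ℤ) + 1) (by omega)
        (by omega) (by omega) (by omega) (by omega) (h.symm h3) (h.symm k3)
      have := h4 _ (h.trans h3 (h.trans this (h.symm k3)))
      omega
    · have : f j = (j : ℤ) + 1 := by
        by_contra he
        exact hc ⟨f j, by omega, k3⟩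
      grind

end RevData

namespace RevData

variable {n : ℕ} {R : ℤ → ℤ → Prop} {f : Fin n → ℤ}

theorem inv_asc_iff (h : RevData n R f) {p q : Fin n} {x : ℤ} (hp : |f p| = x)
    (hq : |f q| = x + 1) :
    (if 0 < f p then (p : ℤ) + 1 else -((p : ℤ) + 1)) <
        (if 0 < f q then (q : ℤ) + 1 else -((q : ℤ) + 1)) ↔
      (¬ Opens R x ∧ ¬ Closes R (x + 1)) ∨ (Opens R x ∧ Closes R x) := by
  have hne : p ≠ q := by rintro rfl; omega
  have hcx := h.closes_abs_iff p
  have hcx1 := h.closes_abs_iff q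
  have hxb := h.abs_bounds p
  have hxb1 := h.abs_bounds q
  rw [hp] at hcx hxb
  rw [hq] at hcx1 hxb1
  have hadj := h.adjacent hxb.1 hxb1.2
  rcases h.cases p with ⟨h1, h2, h3, h4⟩ | ⟨h1, h2, h3, h4, h5, z, hz, h6⟩ | ⟨h1, h2, h3, h4, h5⟩ <;>
  rcases h.cases q with ⟨k1, k2, k3, k4⟩ | ⟨k1, k2, k3, k4, k5, w, hw, k6⟩ | ⟨k1, k2, k3, k4, k5⟩
  · rw [abs_of_pos (by omega)] at hp hq
    rw [if_pos (by omega), if_pos (by omega)]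
    rw [hp] at h3
    rw [hq] at k3
    have c1 : Closes R x := hcx.2 (Or.inl (by omega))
    have c2 : Closes R (x + 1) := hcx1.2 (Or.inl (by omega))
    by_cases ho : Opens R x
    · have hr := h.trans k3 (h.symm (hadj ho c2))
      have : x ≤ (q : ℤ) + 1 := by
        by_contra hc
        have := k4 x hr (by omega)
        omega
      grind
    · have : ¬ (p : ℤ) + 1 < (q : ℤ) + 1 := by
        intro hlt
        have hqx : (q : ℤ) + 1 ≠ x := by
          intro he
          exact ho ⟨x + 1, by omega, he ▸ k3⟩
        have := h4 _ (h.nc (by omega) hlt (by omega) (by omega) (by omega) h3 k3) hlt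
        omega
      grind
  · rw [abs_of_pos (by omega)] at hp
    rw [abs_of_neg (by omega)] at hq
    rw [if_pos (by omega), if_neg (by omega)]
    rw [hq] at k3
    have c1 : Closes R x := hcx.2 (Or.inl (by omega))
    have c2 : Closes R (x + 1) := hcx1.2 (Or.inr (by omega))
    have ho : ¬ Opens R x := by
      intro ho
      have := k5 x (h.trans k3 (h.symm (hadj ho c2))) (by omega)
      omega
    grind
  · rw [abs_of_pos (by omega)] at hp hq
    rw [if_pos (by omega), if_pos (by omega)]
    have c1 : Closes R x := hcx.2 (Or.inl (by omega))
    have c2 : ¬ Closes R (x + 1) := by rw [hcx1]; omega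
    grind
  · rw [abs_of_neg (by omega)] at hp
    rw [abs_of_pos (by omega)] at hq
    rw [if_neg (by omega), if_pos (by omega)]
    rw [hp] at h3
    rw [hq] at k3
    have c1 : Closes R x := hcx.2 (Or.inr (by omega))
    have ho : Opens R x := by
      by_cases he : x = (p : ℤ) + 1
      · have hqp : (q : ℤ) ≠ p := fun he => hne (Fin.ext (by omega))
        have := h.outer hz (a := (q : ℤ) + 1) (b := x) (c := x + 1) (by omega) (by omega)
          (by omega) (by omega) k3 (he ▸ h6)
        have := k4 _ this (by omega)
        omega
      · exact ⟨(p : ℤ) + 1, by omega, h.symm h3⟩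
    grind
  · rw [abs_of_neg (by omega)] at hp hq
    rw [if_neg (by omega), if_neg (by omega)]
    rw [hp] at h3
    rw [hq] at k3
    have c1 : Closes R x := hcx.2 (Or.inr (by omega))
    have c2 : Closes R (x + 1) := hcx1.2 (Or.inr (by omega))
    have hrx : ¬ R x (x + 1) := by
      intro hr
      have := k5 x (h.trans k3 (h.symm hr)) (by omega)
      omega
    have : ¬ (q : ℤ) + 1 < (p : ℤ) + 1 := fun hlt =>
      hrx (h.outer hw (by omega) (by omega) (by omega) (by omega) (h.symm h3)
        (h.trans (h.symm k3) k6))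
    grind
  · rw [abs_of_neg (by omega)] at hp
    rw [abs_of_pos (by omega)] at hq
    rw [if_neg (by omega), if_pos (by omega)]
    have c1 : Closes R x := hcx.2 (Or.inr (by omega))
    have c2 : ¬ Closes R (x + 1) := by rw [hcx1]; omega
    grind
  · rw [abs_of_pos (by omega)] at hp hq
    rw [if_pos (by omega), if_pos (by omega)]
    have c1 : ¬ Closes R x := by rw [hcx]; omega
    have c2 : Closes R (x + 1) := hcx1.2 (Or.inl (by omega))
    grind
  · rw [abs_of_pos (by omega)] at hp
    rw [abs_of_neg (by omega)] at hq
    rw [if_pos (by omega), if_neg (by omega)]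
    have c1 : ¬ Closes R x := by rw [hcx]; omega
    have c2 : Closes R (x + 1) := hcx1.2 (Or.inr (by omega))
    grind
  · rw [abs_of_pos (by omega)] at hp hq
    rw [if_pos (by omega), if_pos (by omega)]
    rw [hp] at h3
    rw [hq] at k3
    have c1 : ¬ Closes R x := by rw [hcx]; omega
    have c2 : ¬ Closes R (x + 1) := by rw [hcx1]; omega
    have hrx : ¬ R x (x + 1) := fun hr => c2 ⟨x, by omega, h.symm hr⟩
    by_cases he : x = (p : ℤ) + 1
    · have ho : ¬ Opens R x := by
        rintro ⟨y, hy, hr⟩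
        have := h4 y (h.trans h3 hr)
        omega
      have hqp : (q : ℤ) ≠ p := fun he => hne (Fin.ext (by omega))
      grind
    · have ho : Opens R x := ⟨(p : ℤ) + 1, by omega, h.symm h3⟩
      have : ¬ (p : ℤ) + 1 < (q : ℤ) + 1 := by
        intro hlt
        by_cases he' : x + 1 = (p : ℤ) + 1
        · exact hrx (he' ▸ h.symm h3)
        · exact hrx (h.nc (by omega) (by omega) (by omega) hlt (by omega) (h.symm h3) (h.symm k3))
      grind

end RevData

theorem card_fin_between {n : ℕ} {a b : ℤ} (ha : 0 ≤ a) (hab : a ≤ b) (hb : b ≤ n) :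
    ((Finset.univ.filter (fun p : Fin n => a ≤ (p : ℤ) ∧ (p : ℤ) < b)).card : ℤ) =
      b - a := by
  lift a to ℕ using ha
  lift b to ℕ using by omega
  have : (Finset.univ.filter
      (fun p : Fin n => (a : ℤ) ≤ (p : ℤ) ∧ (p : ℤ) < b)).card = (Finset.Ico a b).card := by
    rw [← Finset.card_map Fin.valEmbedding]
    congr 1
    ext x
    simp only [Finset.mem_map, Finset.mem_filter, Finset.mem_univ, true_and, Finset.mem_Ico,
      Fin.valEmbedding_apply, Nat.cast_le, Nat.cast_lt]
    constructor
    · rintro ⟨p, hp, rfl⟩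
      exact hp
    · intro hx
      exact ⟨⟨x, by omega⟩, hx, rfl⟩
  rw [this, Nat.card_Ico]
  omega

theorem majW_eq_sum {n : ℕ} (f : Fin n → ℤ) (d : ℕ → ℤ)
    (hd : ∀ i (h : i + 1 < n), d i = if f ⟨i + 1, h⟩ < f ⟨i, by omega⟩ then 1 else 0) :
    (majW f : ℤ) = ∑ i ∈ Finset.range (n - 1), ((i : ℤ) + 1) * d i := by
  have h1 : (majW f : ℤ) =
      ∑ i : Fin n, if (i : ℕ) + 1 < n then ((i : ℕ) + 1 : ℤ) * d i else 0 := by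
    rw [majW, Finset.sum_filter]
    push_cast
    refine Finset.sum_congr rfl fun i _ => ?_
    by_cases h : (i : ℕ) + 1 < n
    · rw [if_pos h, hd i h]
      simp [h]
    · simp [h]
  rw [h1, Fin.sum_univ_eq_sum_range (fun i => if i + 1 < n then ((i : ℕ) + 1 : ℤ) * d i else 0)]
  cases n with
  | zero => rfl
  | succ m =>
    rw [Finset.sum_range_succ, if_neg (by omega), add_zero]
    exact Finset.sum_congr rfl fun i hi => if_pos (by have := Finset.mem_range.1 hi; omega)

theorem invW_eq_sum {n : ℕ} (f : Fin n → ℤ) :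
    (invW f : ℤ) =
      ∑ q, ((Finset.univ.filter (fun p : Fin n => p < q ∧ f q < f p)).card : ℤ) := by
  simp only [invW, Finset.card_filter, Nat.cast_sum]
  rw [Fintype.sum_prod_type_right]

theorem wInv_apply {n : ℕ} {f : Fin n → ℤ} (hf : ∀ i j, |f i| = |f j| → i = j) {i j : Fin n}
    (hij : ((j : ℤ) + 1) = |f i|) :
    wInv f j = if 0 < f i then (i : ℤ) + 1 else -((i : ℤ) + 1) := by
  rw [wInv, Finset.sum_eq_single i]
  · rcases lt_or_ge 0 (f i) with h | h
    · rw [abs_of_pos h] at hij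
      rw [if_pos hij.symm, if_pos h]
    · rw [abs_of_nonpos h] at hij
      rw [if_neg (by omega), if_pos (by omega), if_neg (by omega)]
  · intro k _ hk
    have : |f k| ≠ (j : ℤ) + 1 := fun he => hk (hf _ _ (by rw [he, hij]))
    have h1 : f k ≠ (j : ℤ) + 1 := by
      intro he
      rw [he, abs_of_nonneg (by omega)] at this
      exact this rfl
    have h2 : f k ≠ -((j : ℤ) + 1) := by
      intro he
      rw [he, abs_of_nonpos (by omega)] at this
      omega
    rw [if_neg h1, if_neg h2]
  · simp

/-- Indicator of `Opens R` at the `i`-th positive element, counted from `0`. -/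
noncomputable def openBit (R : ℤ → ℤ → Prop) (i : ℕ) : ℤ := if Opens R ((i : ℤ) + 1) then 1 else 0

/-- Indicator of `Closes R` at the `i`-th positive element, counted from `0`. -/
noncomputable def closeBit (R : ℤ → ℤ → Prop) (i : ℕ) : ℤ :=
  if Closes R ((i : ℤ) + 1) then 1 else 0

namespace RevData

variable {n : ℕ} {R : ℤ → ℤ → Prop} {f : Fin n → ℤ}

theorem majW_eq (h : RevData n R f) :
    (majW f : ℤ) = ∑ i ∈ Finset.range (n - 1), ((i : ℤ) + 1) *
      (1 - (1 - openBit R i) * (1 - closeBit R (i + 1)) -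
        openBit R (i + 1) * closeBit R (i + 1)) := by
  refine majW_eq_sum f _ fun i hi => ?_
  have key := h.asc_iff (i := ⟨i, by omega⟩) (j := ⟨i + 1, hi⟩) (by simp)
  have hne : f ⟨i, by omega⟩ ≠ f ⟨i + 1, hi⟩ := fun he => by
    have := h.abs_injective (congrArg abs he)
    simp at this
  simp only [openBit, closeBit] at key ⊢
  grind

theorem majW_wInv_eq (h : RevData n R f) :
    (majW (wInv f) : ℤ) = ∑ i ∈ Finset.range (n - 1), ((i : ℤ) + 1) *
      (1 - (1 - openBit R i) * (1 - closeBit R (i + 1)) - openBit R i * closeBit R i) := by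
  obtain ⟨τ, hτ⟩ := h.exists_perm
  refine majW_eq_sum _ _ fun i hi => ?_
  obtain ⟨p, hp⟩ := τ.surjective ⟨i, by omega⟩
  obtain ⟨q, hq⟩ := τ.surjective ⟨i + 1, hi⟩
  have hp' := hτ p
  have hq' := hτ q
  rw [hp] at hp'
  rw [hq] at hq'
  rw [wInv_apply (fun _ _ => h.abs_injective) hp',
    wInv_apply (fun _ _ => h.abs_injective) hq']
  have key := h.inv_asc_iff (p := p) (q := q) hp'.symm (by rw [← hq']; push_cast; ring)
  have hne : (p : ℤ) ≠ q := by
    intro he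
    have : p = q := Fin.ext (by omega)
    rw [this, hq] at hp
    simp at hp
  simp only [openBit, closeBit] at key ⊢
  push_cast at key ⊢
  grind

theorem card_negSetW_wInv (h : RevData n R f) :
    (negSetW (wInv f)).card = (negSetW f).card := by
  obtain ⟨τ, hτ⟩ := h.exists_perm
  refine (Finset.card_equiv τ fun i => ?_).symm
  simp only [negSetW, Finset.mem_filter, Finset.mem_univ, true_and]
  rw [wInv_apply (fun _ _ => h.abs_injective) (hτ i)]
  have := h.abs_bounds i
  have : f i ≠ 0 := by
    intro h0
    simp [h0] at this
  grind

theorem closeBit_eq (h : RevData n R f) {i : Fin n} {j : ℕ} (hj : (j : ℤ) + 1 = |f i|) :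
    closeBit R j = openBit R i + if f i < 0 then 1 else 0 := by
  rw [closeBit, openBit, hj, h.closes_abs_iff, h.opens_iff]
  grind

theorem sum_closeBit (h : RevData n R f) :
    ∑ i ∈ Finset.range n, closeBit R i =
      ∑ i ∈ Finset.range n, openBit R i + (negSetW f).card := by
  obtain ⟨τ, hτ⟩ := h.exists_perm
  rw [← Fin.sum_univ_eq_sum_range, ← Fin.sum_univ_eq_sum_range, ← Equiv.sum_comp τ,
    Finset.sum_congr rfl fun i _ => h.closeBit_eq (hτ i), Finset.sum_add_distrib]
  simp [negSetW]

end RevData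

namespace RevData

variable {n : ℕ} {R : ℤ → ℤ → Prop} {f : Fin n → ℤ}

/-- An entry to the left of `q` that is larger than `f q` exceeds `q` itself, unless `q` is the
largest element of its class. -/
theorem inversion_iff_of_up (h : RevData n R f) {p q : Fin n} (hpq : p < q)
    (hq : (q : ℤ) + 1 < f q) : f q < f p ↔ (q : ℤ) + 1 < f p := by
  have hpq' : (p : ℤ) < q := by exact_mod_cast hpq
  refine ⟨fun hlt => by omega, fun hlt => ?_⟩
  by_contra hc
  have hne : f p ≠ f q := fun he => hpq.ne (h.abs_injective (congrArg abs he))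
  rcases h.cases p with ⟨h1, h2, h3, h4⟩ | hp | hp <;> [skip; omega; omega]
  rcases h.cases q with ⟨k1, k2, k3, k4⟩ | hp | hp <;> [skip; omega; omega]
  have := h4 _ (h.nc (by omega) (by omega) hlt (by omega) (by omega) h3 k3) (by omega)
  omega

theorem inversion_iff_of_pos (h : RevData n R f) {p q : Fin n} (hpq : p < q) (hq0 : 0 < f q)
    (hq : f q ≤ (q : ℤ) + 1) :
    (f q < f p ↔ f q ≤ (p : ℤ) + 1 ∨ (q : ℤ) + 1 < f p) ∧
      ¬ (f q ≤ (p : ℤ) + 1 ∧ (q : ℤ) + 1 < f p) := by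
  have hpq' : (p : ℤ) < q := by exact_mod_cast hpq
  have hne : f p ≠ f q := fun he => hpq.ne (h.abs_injective (congrArg abs he))
  rcases h.cases q with hp | hp | ⟨k1, k2, k3, k4, k5⟩
  · omega
  · omega
  by_cases hfp : f q = (p : ℤ) + 1
  · have hr : R ((p : ℤ) + 1) ((q : ℤ) + 1) := hfp ▸ h.symm k3
    have := h.up p _ hr (by omega)
    omega
  rcases h.cases p with ⟨h1, h2, h3, h4⟩ | ⟨h1, h2, h3, h4, h5, z, hz, h6⟩ | ⟨h1, h2, h3, h4, h5⟩
  · constructor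
    · constructor
      · intro hlt
        by_contra hc
        push Not at hc
        have : R ((p : ℤ) + 1) (f q) := by
          by_cases he : f p = (q : ℤ) + 1
          · exact h.trans (he ▸ h3) k3
          · exact h.nc (by omega) (by omega) hlt (by omega) (by omega) h3 (h.symm k3)
        have := k5 _ (h.trans k3 (h.symm this))
        omega
      · omega
    · rintro ⟨h7, h8⟩
      have := h.nc (by omega) (by omega) (by omega) h8 (by omega) (h.symm k3) h3
      have := h4 _ (h.trans (h.symm this) (h.symm k3)) (by omega)
      omega
  · refine ⟨iff_of_false (by omega) ?_, by omega⟩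
    rintro (h7 | h7)
    · have := h.outer hz (by omega) (by omega) (by omega) (by omega) (h.symm k3) h6
        (b := (p : ℤ) + 1)
      have := h4 _ (h.trans (h.symm this) (h.symm k3))
      omega
    · omega
  · refine ⟨?_, by omega⟩
    constructor
    · omega
    · intro h7
      by_contra hc
      have hr := h.nc (by omega) (by omega) (by omega) (by omega) (by omega) (h.symm h3)
        (h.symm k3) (a := f p) (b := f q) (c := (p : ℤ) + 1)
      have := h4 _ (h.trans h3 (h.trans hr (h.symm k3)))
      omega

theorem inversion_of_neg (h : RevData n R f) {p q : Fin n} (hpq : p < q) (hq : f q < 0) :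
    f q < f p ∧ f p ≤ (q : ℤ) + 1 := by
  have hpq' : (p : ℤ) < q := by exact_mod_cast hpq
  have hne : f p ≠ f q := fun he => hpq.ne (h.abs_injective (congrArg abs he))
  rcases h.cases q with hp | ⟨k1, k2, k3, k4, k5, z, hz, k6⟩ | hp <;> [omega; skip; omega]
  rcases h.cases p with ⟨h1, h2, h3, h4⟩ | ⟨h1, h2, h3, h4, h5, w, hw, h6⟩ | ⟨h1, h2, h3, h4, h5⟩
  · refine ⟨by omega, ?_⟩
    by_contra hc
    have := h.outer hz (by omega) (by omega) (by omega) (by omega) h3 k6 (b := (q : ℤ) + 1)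
    have := h4 _ this
    omega
  · refine ⟨?_, by omega⟩
    by_contra hc
    have := h.outer hw (by omega) (by omega) (by omega) (by omega) (h.symm k3)
      (h.trans (h.symm h3) h6) (b := -f p)
    have := h4 _ (h.trans h3 (h.trans (h.symm this) (h.symm k3)))
    omega
  · omega

theorem sum_card_over (h : RevData n R f) :
    ∑ q : Fin n, ((Finset.univ.filter (fun p : Fin n => p < q ∧ (q : ℤ) + 1 < f p)).card : ℤ) =
      ∑ p : Fin n, openBit R p * (f p - (p : ℤ) - 2) := by
  simp only [Finset.card_filter, Nat.cast_sum]
  rw [Finset.sum_comm]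
  refine Finset.sum_congr rfl fun p _ => ?_
  have hb := h.abs_bounds p
  rw [openBit, h.opens_iff]
  by_cases hp : (p : ℤ) + 1 < f p
  · rw [abs_of_pos (by omega)] at hb
    rw [if_pos hp, one_mul, ← Nat.cast_sum, ← Finset.card_filter,
      show f p - (p : ℤ) - 2 = (f p - 1) - ((p : ℤ) + 1) by ring,
      ← card_fin_between (n := n) (by omega) (by omega) (by omega)]
    congr 2
    ext q
    simp only [Finset.mem_filter, Finset.mem_univ, true_and, Fin.lt_def]
    omega
  · rw [if_neg hp, zero_mul]
    refine Finset.sum_eq_zero fun q _ => ?_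
    rw [if_neg]
    · rfl
    · rintro ⟨h1, h2⟩
      have : (p : ℤ) < q := by exact_mod_cast h1
      omega

theorem card_inversions (h : RevData n R f) (q : Fin n) :
    ((Finset.univ.filter (fun p : Fin n => p < q ∧ f q < f p)).card : ℤ) +
        (if f q < 0 then -f q else 0) =
      (Finset.univ.filter (fun p : Fin n => p < q ∧ (q : ℤ) + 1 < f p)).card +
        ((q : ℤ) + 1 - |f q|) +
        (openBit R q + if f q < 0 then 1 else 0) * (2 * |f q| - 1) +
        openBit R q * (-|f q| - (q : ℤ)) := by
  rw [openBit, h.opens_iff]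
  have hb := h.abs_bounds q
  rcases h.cases q with hq | hq | hq
  · rw [if_neg (by omega), if_pos (by omega), if_neg (by omega), abs_of_pos (by omega)]
    rw [Finset.filter_congr fun p _ => and_congr_right fun hpq => h.inversion_iff_of_up hpq hq.1]
    ring
  · rw [if_pos (by omega), if_neg (by omega), if_pos (by omega), abs_of_neg (by omega)]
    rw [Finset.filter_congr (q := fun p : Fin n => (0 : ℤ) ≤ p ∧ (p : ℤ) < q),
      card_fin_between le_rfl (by omega) (by omega),
      Finset.filter_eq_empty_iff.2]
    · simp
      ring
    · rintro p - ⟨h1, h2⟩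
      have := (h.inversion_of_neg h1 hq.1).2
      omega
    · intro p _
      constructor
      · rintro ⟨h1, -⟩
        have := Fin.lt_def.1 h1
        omega
      · intro h1
        have : p < q := Fin.lt_def.2 (by omega)
        exact ⟨this, (h.inversion_of_neg this hq.1).1⟩
  · rw [if_neg (by omega), if_neg (by omega), if_neg (by omega)]
    rw [abs_of_pos hq.1] at hb ⊢
    have : Finset.univ.filter (fun p : Fin n => p < q ∧ f q < f p) =
        (Finset.univ.filter (fun p : Fin n => p < q ∧ (q : ℤ) + 1 < f p)).disjUnion
          (Finset.univ.filter (fun p : Fin n => f q - 1 ≤ (p : ℤ) ∧ (p : ℤ) < q)) (by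
            rw [Finset.disjoint_filter]
            rintro p - ⟨h1, h2⟩ h3
            exact (h.inversion_iff_of_pos h1 hq.1 hq.2.1).2 ⟨by omega, h2⟩) := by
      ext p
      simp only [Finset.mem_disjUnion, Finset.mem_filter, Finset.mem_univ, true_and]
      by_cases hpq : p < q
      · have := (h.inversion_iff_of_pos hpq hq.1 hq.2.1).1
        have := Fin.lt_def.1 hpq
        simp only [hpq, true_and]
        omega
      · have := fun he => hpq (Fin.lt_def.2 he)
        simp only [hpq, false_and, false_or, false_iff]
        omega
    rw [this, Finset.card_disjUnion]
    push_cast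
    rw [card_fin_between (by omega) (by omega) (by omega)]
    ring

theorem lSW_eq (h : RevData n R f) :
    lSW f = ∑ i ∈ Finset.range n, closeBit R i * (2 * i + 1) -
      ∑ i ∈ Finset.range n, openBit R i * (2 * ((i : ℤ) + 1)) := by
  obtain ⟨τ, hτ⟩ := h.exists_perm
  have hperm : ∑ q : Fin n, |f q| = ∑ q : Fin n, ((q : ℤ) + 1) := by
    rw [← Equiv.sum_comp τ (fun q : Fin n => (q : ℤ) + 1)]
    exact Finset.sum_congr rfl fun q _ => (hτ q).symm
  have hclose : ∑ i ∈ Finset.range n, closeBit R i * (2 * i + 1) =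
      ∑ q : Fin n, (openBit R q + if f q < 0 then 1 else 0) * (2 * |f q| - 1) := by
    rw [← Fin.sum_univ_eq_sum_range (fun i => closeBit R i * (2 * i + 1)), ← Equiv.sum_comp τ]
    refine Finset.sum_congr rfl fun q _ => ?_
    rw [h.closeBit_eq (hτ q), ← hτ q]
    ring
  have hl : lSW f = ∑ q : Fin n,
      (((Finset.univ.filter (fun p : Fin n => p < q ∧ f q < f p)).card : ℤ) +
        (if f q < 0 then -f q else 0)) := by
    rw [lSW, invW_eq_sum, negSetW, Finset.sum_filter, Finset.sum_add_distrib, sub_eq_add_neg,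
      ← Finset.sum_neg_distrib]
    congr 1
    refine Finset.sum_congr rfl fun q _ => ?_
    split_ifs <;> simp
  rw [hl, Finset.sum_congr rfl fun q _ => h.card_inversions q]
  simp only [Finset.sum_add_distrib]
  rw [h.sum_card_over, Finset.sum_sub_distrib, Finset.sum_add_distrib, hperm, hclose,
    ← Fin.sum_univ_eq_sum_range (fun i => openBit R i * (2 * ((i : ℤ) + 1)))]
  have : ∀ q : Fin n, openBit R q * (f q - (q : ℤ) - 2) =
      openBit R q * (|f q| - (q : ℤ) - 2) := by
    intro q
    rw [openBit, h.opens_iff]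
    split_ifs with hq
    · rw [abs_of_pos (by omega)]
    · simp
  have hopen : ∑ q : Fin n, openBit R q * (|f q| - (q : ℤ) - 2) +
      ∑ q : Fin n, openBit R q * (-|f q| - (q : ℤ)) =
        -∑ q : Fin n, openBit R q * (2 * ((q : ℤ) + 1)) := by
    rw [← Finset.sum_add_distrib, ← Finset.sum_neg_distrib]
    exact Finset.sum_congr rfl fun q _ => by ring
  rw [Finset.sum_congr rfl fun q _ => this q, Finset.sum_add_distrib]
  linarith

end RevData

theorem RevData.maj_add (n : ℕ) (R : ℤ → ℤ → Prop) (f : Fin (n + 1) → ℤ)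
    (h : RevData (n + 1) R f) :
    (majW f : ℤ) + majW (wInv f) +
        ∑ i ∈ Finset.range (n + 1), openBit R i * closeBit R i * (2 * i + 1) +
        ∑ i ∈ Finset.range n, (1 - closeBit R (i + 1)) * (1 - openBit R i) * (2 * ((i : ℤ) + 1)) =
      n * (n + 1) := by
  have hlast : openBit R n = 0 := by
    rw [openBit, if_neg]
    rintro ⟨y, hy, hr⟩
    have := h.bdd (by omega) (by push_cast; omega) hr
    push_cast at this
    omega
  have hsplit : ∑ i ∈ Finset.range (n + 1), openBit R i * closeBit R i * (2 * i + 1) =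
      ∑ i ∈ Finset.range n, openBit R i * closeBit R i * ((i : ℤ) + 1) +
        ∑ i ∈ Finset.range n, openBit R (i + 1) * closeBit R (i + 1) * ((i : ℤ) + 1) := by
    have h1 := Finset.sum_range_succ (fun i : ℕ => openBit R i * closeBit R i * ((i : ℤ) + 1)) n
    have h2 := Finset.sum_range_succ' (fun i : ℕ => openBit R i * closeBit R i * (i : ℤ)) n
    simp only [hlast, zero_mul, add_zero, Nat.cast_zero, mul_zero, Nat.cast_add, Nat.cast_one]
      at h1 h2
    rw [← h1, ← h2, ← Finset.sum_add_distrib]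
    exact Finset.sum_congr rfl fun i _ => by ring
  have hgauss : ∑ i ∈ Finset.range n, ((i : ℤ) + 1) * 2 = n * (n + 1) := by
    clear hsplit hlast h
    induction n with
    | zero => simp
    | succ k ih =>
      rw [Finset.sum_range_succ, ih]
      · push_cast
        ring
      · exact fun _ => 0
  rw [h.majW_eq, h.majW_wInv_eq, hsplit, ← hgauss, Nat.add_sub_cancel]
  simp only [← Finset.sum_add_distrib]
  exact Finset.sum_congr rfl fun i _ => by ring

section Paths

variable {m : ℕ} (w : Fin m → Bool)

theorem countE_eq_sum {e : ℕ → ℤ} (he : ∀ t : Fin m, e t = if w t = false then 1 else 0) {k : ℕ}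
    (hk : k ≤ m) : (countE w k : ℤ) = ∑ s ∈ Finset.range k, e s := by
  have h1 : (countE w k : ℤ) = ∑ t : Fin m, if (t : ℕ) < k then e t else 0 := by
    rw [countE, Finset.card_filter]
    push_cast
    refine Finset.sum_congr rfl fun t _ => ?_
    rw [he t]
    by_cases h : (t : ℕ) < k <;> simp [h]
  rw [h1, Fin.sum_univ_eq_sum_range (fun t => if t < k then e t else 0), ← Finset.sum_filter]
  congr 1
  ext s
  simp only [Finset.mem_filter, Finset.mem_range]
  omega

theorem countE_add_countN {k : ℕ} (hk : k ≤ m) : countE w k + countN w k = k := by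
  rw [countE, countN, ← Finset.card_union_of_disjoint, ← Finset.filter_or]
  · have := card_fin_between (n := m) (a := 0) (b := k) le_rfl (by omega) (by exact_mod_cast hk)
    rw [sub_zero] at this
    rw [← Nat.cast_inj (R := ℤ), ← this]
    congr 2
    ext t
    rcases hh : w t <;> simp [hh]
  · rw [Finset.disjoint_filter]
    rintro t - ⟨-, h1⟩ ⟨-, h2⟩
    rw [h1] at h2
    exact absurd h2 (by decide)

theorem countE_mono : Monotone (countE w) := fun a b hab =>
  Finset.card_le_card fun t ht => by
    simp only [Finset.mem_filter, Finset.mem_univ, true_and] at ht ⊢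
    exact ⟨by omega, ht.2⟩

theorem countN_mono : Monotone (countN w) := fun a b hab =>
  Finset.card_le_card fun t ht => by
    simp only [Finset.mem_filter, Finset.mem_univ, true_and] at ht ⊢
    exact ⟨by omega, ht.2⟩

theorem cellBelow_iff {i j : ℕ} (hi : 1 ≤ i) (hij : i + j ≤ m + 1) :
    CellBelow w i j ↔ countE w (i + j - 1) < i := by
  have hsum := countE_add_countN w (k := i + j - 1) (by omega)
  constructor
  · rintro ⟨k, h1, h2⟩
    rcases le_total k (i + j - 1) with hk | hk
    · have := countN_mono w hk
      omega
    · exact (countE_mono w hk).trans_lt h1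
  · exact fun h => ⟨i + j - 1, h, by omega⟩

theorem areaB_eq_sum {n : ℕ} {w : Fin (2 * n) → Bool} (hw : IsDyckB n w) :
    (areaB n w : ℤ) = ∑ t ∈ Finset.range (2 * n + 1), ((t / 2 : ℕ) - (countE w t : ℤ)) := by
  have hle : ∀ t ∈ Finset.range (2 * n + 1), countE w t ≤ t / 2 := by
    intro t ht
    have := countE_add_countN w (k := t) (by have := Finset.mem_range.1 ht; omega)
    have := hw t
    omega
  have hset : {p : ℕ × ℕ | 1 ≤ p.1 ∧ p.1 < p.2 ∧ p.2 ≤ 2 * n + 1 - p.1 ∧ CellBelow w p.1 p.2} =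
      ((Finset.range (2 * n + 1)).sigma fun t => Finset.Ioc (countE w t) (t / 2)).image
        (fun s => (s.2, s.1 + 1 - s.2)) := by
    ext ⟨i, j⟩
    simp only [Set.mem_ofPred_eq, Finset.coe_image, Set.mem_image, Finset.mem_coe,
      Finset.mem_sigma, Finset.mem_range, Finset.mem_Ioc, Prod.mk.injEq, Sigma.exists]
    constructor
    · rintro ⟨h1, h2, h3, h4⟩
      rw [cellBelow_iff w h1 (by omega)] at h4
      exact ⟨i + j - 1, i, by omega, rfl, by omega⟩
    · rintro ⟨t, i, ⟨h1, h2⟩, rfl, rfl⟩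
      refine ⟨by omega, by omega, by omega, ?_⟩
      rw [cellBelow_iff w (by omega) (by omega), show i + (t + 1 - i) - 1 = t by omega]
      exact h2.1
  rw [areaB, hset, Set.ncard_coe_finset, Finset.card_image_of_injOn, Finset.card_sigma]
  · rw [Nat.cast_sum]
    refine Finset.sum_congr rfl fun t ht => ?_
    rw [Nat.card_Ioc, Nat.cast_sub (hle t ht)]
  · rintro ⟨t, i⟩ h1 ⟨t', i'⟩ h2 he
    simp only [Finset.coe_sigma, Set.mem_sigma_iff, Finset.mem_coe, Finset.mem_Ioc,
      Prod.mk.injEq] at h1 h2 he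
    obtain ⟨rfl, he⟩ := he
    have : t = t' := by omega
    subst this
    rfl

theorem negPath_eq_countE : negPath w = countE w m := by
  simp [negPath, countE]

theorem sum_pathDes {e : ℕ → ℤ} (he : ∀ t : Fin m, e t = if w t = false then 1 else 0)
    (g : ℕ → ℤ) :
    ∑ i ∈ pathDes w, g i = ∑ i ∈ Finset.range (m - 1), e i * (1 - e (i + 1)) * g (i + 1) := by
  have h1 : ∀ i ∈ Finset.range (m - 1), e i * (1 - e (i + 1)) * g (i + 1) =
      if i + 1 ∈ pathDes w then g (i + 1) else 0 := by
    intro i hi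
    have hi' := Finset.mem_range.1 hi
    have e1 := he ⟨i, by omega⟩
    have e2 := he ⟨i + 1, by omega⟩
    simp only at e1 e2
    have : i + 1 ∈ pathDes w ↔ w ⟨i, by omega⟩ = false ∧ w ⟨i + 1, by omega⟩ = true := by
      simp only [pathDes, Finset.mem_filter, Finset.mem_Ioo, Nat.add_sub_cancel]
      exact ⟨fun h => h.2.2, fun h => ⟨by omega, by omega, h⟩⟩
    rw [e1, e2]
    cases h1 : w ⟨i, by omega⟩ <;> cases h2 : w ⟨i + 1, by omega⟩ <;> simp [this, h1, h2]
  rw [Finset.sum_congr rfl h1, ← Finset.sum_filter]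
  refine (Finset.sum_nbij (· + 1) ?_ ?_ ?_ ?_).symm
  · intro i hi
    exact (Finset.mem_filter.1 hi).2
  · intro i _ j _ hij
    simpa using hij
  · intro i hi
    have h2 := (Finset.mem_filter.1 (Finset.mem_coe.1 hi)).1
    rw [Finset.mem_Ioo] at h2
    refine ⟨i - 1, ?_, by simp only; omega⟩
    rw [Finset.mem_coe, Finset.mem_filter, Finset.mem_range, Nat.sub_add_cancel (by omega)]
    exact ⟨by omega, hi⟩
  · exact fun _ _ => rfl

end Paths

theorem sum_range_two_mul (F : ℕ → ℤ) (n : ℕ) :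
    ∑ t ∈ Finset.range (2 * n), F t =
      ∑ k ∈ Finset.range n, (F (2 * k) + F (2 * k + 1)) := by
  induction n with
  | zero => rfl
  | succ n ih =>
    rw [Nat.mul_succ, Finset.sum_range_succ, Finset.sum_range_succ, ih, Finset.sum_range_succ]
    ring

theorem sum_prefix_sums (e : ℕ → ℤ) (N : ℕ) :
    ∑ t ∈ Finset.range (N + 1), ∑ s ∈ Finset.range t, e s =
      ∑ s ∈ Finset.range N, e s * (N - s) := by
  induction N with
  | zero => simp
  | succ N ih =>
    rw [Finset.sum_range_succ, ih, Finset.sum_range_succ, Finset.sum_range_succ, ← add_assoc,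
      ← Finset.sum_add_distrib]
    congr 1
    · exact Finset.sum_congr rfl fun s _ => by push_cast; ring
    · push_cast
      ring

/-- The lattice path recording, from the largest positive element down to `1`, which elements
open and which close. -/
noncomputable def pathOf (n : ℕ) (R : ℤ → ℤ → Prop) : Fin (2 * n) → Bool := fun t =>
  if (t : ℕ) % 2 = 0 then decide (¬ Opens R ((n : ℤ) - (t / 2 : ℕ)))
  else decide (Closes R ((n : ℤ) - (t / 2 : ℕ)))

/-- Indicator of the east steps of `pathOf n R`. -/
noncomputable def eastBit (n : ℕ) (R : ℤ → ℤ → Prop) (t : ℕ) : ℤ :=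
  if t % 2 = 0 then openBit R (n - 1 - t / 2) else 1 - closeBit R (n - 1 - t / 2)

theorem eastBit_eq (n : ℕ) (R : ℤ → ℤ → Prop) (t : Fin (2 * n)) :
    eastBit n R t = if pathOf n R t = false then 1 else 0 := by
  have h : ((n - 1 - t / 2 : ℕ) : ℤ) + 1 = (n : ℤ) - (t / 2 : ℕ) := by
    have := t.2
    omega
  rw [eastBit, pathOf, openBit, closeBit, h]
  split_ifs with h1 h2 h3 h4 h5 h6 <;> simp_all

theorem eastBit_even (n : ℕ) (R : ℤ → ℤ → Prop) (k : ℕ) :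
    eastBit n R (2 * k) = openBit R (n - 1 - k) := by
  rw [eastBit, if_pos (by omega), show 2 * k / 2 = k by omega]

theorem eastBit_odd (n : ℕ) (R : ℤ → ℤ → Prop) (k : ℕ) :
    eastBit n R (2 * k + 1) = 1 - closeBit R (n - 1 - k) := by
  rw [eastBit, if_neg (by omega), show (2 * k + 1) / 2 = k by omega]

theorem negPath_pathOf (n : ℕ) (R : ℤ → ℤ → Prop) :
    (negPath (pathOf n R) : ℤ) =
      ∑ i ∈ Finset.range n, openBit R i + n - ∑ i ∈ Finset.range n, closeBit R i := by
  rw [negPath_eq_countE, countE_eq_sum _ (eastBit_eq n R) le_rfl, sum_range_two_mul,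
    ← Finset.sum_range_reflect]
  rw [show (n : ℤ) = ∑ i ∈ Finset.range n, (1 : ℤ) by simp, ← Finset.sum_add_distrib,
    ← Finset.sum_sub_distrib]
  refine Finset.sum_congr rfl fun i hi => ?_
  have := Finset.mem_range.1 hi
  rw [eastBit_even, eastBit_odd, show n - 1 - (n - 1 - i) = i by omega]
  ring

theorem areaB_pathOf {n : ℕ} {R : ℤ → ℤ → Prop} (hw : IsDyckB n (pathOf n R)) :
    (areaB n (pathOf n R) : ℤ) = ∑ i ∈ Finset.range n, closeBit R i * (2 * i + 1) -
      ∑ i ∈ Finset.range n, openBit R i * (2 * ((i : ℤ) + 1)) := by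
  have h1 : ∑ t ∈ Finset.range (2 * n + 1), ((t / 2 : ℕ) : ℤ) =
      ∑ i ∈ Finset.range n, (2 * (i : ℤ) + 1) := by
    rw [Finset.sum_range_succ', sum_range_two_mul]
    simp only [Nat.zero_div, Nat.cast_zero, add_zero]
    refine Finset.sum_congr rfl fun i _ => ?_
    rw [show (2 * i + 1) / 2 = i by omega, show (2 * i + 1 + 1) / 2 = i + 1 by omega]
    push_cast
    ring
  have h2 : ∑ t ∈ Finset.range (2 * n + 1), (countE (pathOf n R) t : ℤ) =
      ∑ t ∈ Finset.range (2 * n + 1), ∑ s ∈ Finset.range t, eastBit n R s :=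
    Finset.sum_congr rfl fun t ht => countE_eq_sum _ (eastBit_eq n R)
      (by have := Finset.mem_range.1 ht; omega)
  rw [areaB_eq_sum hw, Finset.sum_sub_distrib, h2, sum_prefix_sums, sum_range_two_mul,
    ← Finset.sum_range_reflect (fun k => _ + _), h1, ← Finset.sum_sub_distrib,
    ← Finset.sum_sub_distrib]
  refine Finset.sum_congr rfl fun i hi => ?_
  have := Finset.mem_range.1 hi
  rw [eastBit_even, eastBit_odd, show n - 1 - (n - 1 - i) = i by omega]
  have : ((n - 1 - i : ℕ) : ℤ) = n - 1 - i := by omega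
  push_cast [this]
  ring

theorem sum_pathDes_pathOf (n : ℕ) (R : ℤ → ℤ → Prop) :
    ((∑ i ∈ pathDes (pathOf (n + 1) R), (2 * (n + 1) - i) : ℕ) : ℤ) =
      ∑ i ∈ Finset.range (n + 1), openBit R i * closeBit R i * (2 * i + 1) +
        ∑ i ∈ Finset.range n,
          (1 - closeBit R (i + 1)) * (1 - openBit R i) * (2 * ((i : ℤ) + 1)) := by
  push_cast
  rw [sum_pathDes _ (eastBit_eq (n + 1) R) (fun i => ((2 * (n + 1) - i : ℕ) : ℤ)),
    show 2 * (n + 1) - 1 = 2 * n + 1 by omega, Finset.sum_range_succ, sum_range_two_mul,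
    Finset.sum_add_distrib, add_right_comm, 
    ← Finset.sum_range_succ (fun k => eastBit (n + 1) R (2 * k) *
      (1 - eastBit (n + 1) R (2 * k + 1)) * ((2 * (n + 1) - (2 * k + 1) : ℕ) : ℤ)),
    ← Finset.sum_range_reflect, ← Finset.sum_range_reflect (n := n)]
  congr 1
  · refine Finset.sum_congr rfl fun i hi => ?_
    have := Finset.mem_range.1 hi
    rw [eastBit_even, eastBit_odd, show n + 1 - 1 - (n + 1 - 1 - i) = i by omega,
      show 2 * (n + 1) - (2 * (n + 1 - 1 - i) + 1) = 2 * i + 1 by omega]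
    push_cast
    ring
  · refine Finset.sum_congr rfl fun i hi => ?_
    have := Finset.mem_range.1 hi
    rw [show 2 * (n - 1 - i) + 1 + 1 = 2 * (n - i) by omega, eastBit_even, eastBit_odd,
      show n + 1 - 1 - (n - 1 - i) = i + 1 by omega, show n + 1 - 1 - (n - i) = i by omega,
      show 2 * (n + 1) - 2 * (n - i) = 2 * (i + 1) by omega]
    push_cast
    ring

theorem RevData.maj_identity {n : ℕ} (hn : 1 ≤ n) {R : ℤ → ℤ → Prop} {f : Fin n → ℤ}
    (h : RevData n R f) :
    majB n (pathOf n R) + majBW f + imajBW f = 2 * n ^ 2 := by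
  obtain ⟨n, rfl⟩ : ∃ k, n = k + 1 := ⟨n - 1, by omega⟩
  have h1 := negPath_pathOf (n + 1) R
  have h2 := h.sum_closeBit
  have h3 := sum_pathDes_pathOf n R
  have h4 := RevData.maj_add n R f h
  rw [imajBW, majBW, majBW, h.card_negSetW_wInv, majB, ← Nat.cast_inj (R := ℤ)]
  rw [Nat.cast_add, Nat.cast_add, Nat.cast_mul, Nat.cast_add, h3]
  push_cast at h1 ⊢
  linarith

theorem isDyckB_iff {n : ℕ} {w : Fin (2 * n) → Bool} :
    IsDyckB n w ↔ ∀ k ≤ 2 * n, 2 * countE w k ≤ k := by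
  constructor
  · intro h k hk
    have := h k
    have := countE_add_countN w hk
    omega
  · intro h k
    rcases le_total k (2 * n) with hk | hk
    · have := h k hk
      have := countE_add_countN w hk
      omega
    · have h1 : countE w k = countE w (2 * n) := by
        unfold countE
        congr 1
        ext t
        have := t.2
        simp only [Finset.mem_filter, Finset.mem_univ, true_and]
        exact and_congr_left fun _ => by omega
      have := h (2 * n) le_rfl
      have := countE_add_countN w (le_refl (2 * n))
      have := countN_mono w hk
      omega

theorem countE_pathOf_two_mul (n : ℕ) (R : ℤ → ℤ → Prop) {a : ℕ} (ha : a ≤ n) :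
    (countE (pathOf n R) (2 * a) : ℤ) =
      ∑ i ∈ Finset.Ico (n - a) n, openBit R i + a - ∑ i ∈ Finset.Ico (n - a) n, closeBit R i := by
  rw [countE_eq_sum _ (eastBit_eq n R) (by omega)]
  induction a with
  | zero => simp
  | succ a ih =>
    rw [show 2 * (a + 1) = 2 * a + 1 + 1 by ring, Finset.sum_range_succ, Finset.sum_range_succ,
      ih (by omega), eastBit_even, eastBit_odd,
      Finset.sum_eq_sum_Ico_succ_bot (show n - (a + 1) < n by omega),
      Finset.sum_eq_sum_Ico_succ_bot (show n - (a + 1) < n by omega),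
      show n - (a + 1) + 1 = n - a by omega, show n - 1 - a = n - (a + 1) by omega]
    push_cast
    ring

theorem pathOf_injective {n : ℕ} {R R' : ℤ → ℤ → Prop} (h : pathOf n R = pathOf n R') {x : ℤ}
    (hx : 1 ≤ x) (hxn : x ≤ n) : (Opens R x ↔ Opens R' x) ∧ (Closes R x ↔ Closes R' x) := by
  obtain ⟨k, rfl⟩ : ∃ k : ℕ, x = n - k := ⟨(n - x).toNat, by omega⟩
  have h1 := congrFun h ⟨2 * k, by omega⟩
  have h2 := congrFun h ⟨2 * k + 1, by omega⟩
  simp only [pathOf] at h1 h2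
  rw [if_pos (by omega), if_pos (by omega), decide_eq_decide, show 2 * k / 2 = k by omega] at h1
  rw [if_neg (by omega), if_neg (by omega), decide_eq_decide,
    show (2 * k + 1) / 2 = k by omega] at h2
  exact ⟨not_iff_not.1 h1, h2⟩

namespace RevData

variable {n : ℕ} {R R' : ℤ → ℤ → Prop} {f f' : Fin n → ℤ}

theorem sum_openBit_le (h : RevData n R f) (b : ℕ) :
    ∑ i ∈ Finset.Ico b n, openBit R i ≤ ∑ i ∈ Finset.Ico (b + 1) n, closeBit R i := by
  obtain ⟨τ, hτ⟩ := h.exists_perm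
  have key : ∀ (b : ℕ) (F : ℕ → ℤ), ∑ i ∈ Finset.Ico b n, F i =
      ∑ i : Fin n, if b ≤ (i : ℕ) then F i else 0 := by
    intro b F
    rw [Fin.sum_univ_eq_sum_range (fun i => if b ≤ i then F i else 0), ← Finset.sum_filter]
    congr 1
    ext i
    simp only [Finset.mem_Ico, Finset.mem_filter, Finset.mem_range]
    omega
  rw [key, key, ← Equiv.sum_comp τ (fun i : Fin n => if b + 1 ≤ (i : ℕ) then closeBit R i else 0)]
  refine Finset.sum_le_sum fun i _ => ?_
  rw [h.closeBit_eq (hτ i), openBit, h.opens_iff]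
  have := hτ i
  by_cases hi : (i : ℤ) + 1 < f i
  · rw [abs_of_pos (by omega)] at this
    rw [if_pos hi]
    split_ifs <;> omega
  · rw [if_neg hi]
    split_ifs <;> omega

theorem isDyckB (h : RevData n R f) : IsDyckB n (pathOf n R) := by
  rw [isDyckB_iff]
  intro k hk
  obtain ⟨a, rfl | rfl⟩ := Nat.even_or_odd' k
  · have h1 := countE_pathOf_two_mul n R (a := a) (by omega)
    have h2 := h.sum_openBit_le (n - a)
    have h3 : ∑ i ∈ Finset.Ico (n - a + 1) n, closeBit R i ≤
        ∑ i ∈ Finset.Ico (n - a) n, closeBit R i := by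
      refine Finset.sum_le_sum_of_subset_of_nonneg
        (Finset.Ico_subset_Ico (by omega) le_rfl) fun i _ _ => ?_
      rw [closeBit]
      split_ifs <;> simp
    omega
  · have h1 := countE_pathOf_two_mul n R (a := a) (by omega)
    have h2 := h.sum_openBit_le (n - (a + 1))
    have h3 := countE_eq_sum _ (eastBit_eq n R) (k := 2 * a + 1) (by omega)
    rw [Finset.sum_range_succ, ← countE_eq_sum _ (eastBit_eq n R) (by omega), eastBit_even,
      show n - 1 - a = n - (a + 1) by omega] at h3
    rw [Finset.sum_eq_sum_Ico_succ_bot (show n - (a + 1) < n by omega),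
      show n - (a + 1) + 1 = n - a by omega] at h2
    omega

theorem exists_abs_eq (h : RevData n R f) {x : ℤ} (hx : 1 ≤ x) (hxn : x ≤ n) :
    ∃ p, |f p| = x := by
  obtain ⟨τ, hτ⟩ := h.exists_perm
  obtain ⟨j, rfl⟩ := exists_fin hx hxn
  obtain ⟨p, rfl⟩ := τ.surjective j
  exact ⟨p, (hτ p).symm⟩

/-- A closing element below an arc is the right end of a shorter arc. -/
theorem exists_arc_under (h : RevData n R f) {i : Fin n} {y : ℤ} (hiy : (i : ℤ) + 1 < y)
    (hyf : y < f i) (hy : Closes R y) : ∃ p, i < p ∧ (p : ℤ) + 1 < f p ∧ f p = y := by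
  rcases h.cases i with ⟨h1, h2, h3, h4⟩ | hi | hi <;> [skip; omega; omega]
  obtain ⟨p, hp⟩ := h.exists_abs_eq (x := y) (by omega) (by omega)
  have hc := h.closes_abs_iff p
  rw [hp, iff_true_left hy] at hc
  rcases h.cases p with ⟨k1, k2, k3, k4⟩ | ⟨k1, k2, k3, k4, k5, z, hz, k6⟩ | hp' <;>
    [skip; skip; omega]
  · rw [abs_of_pos (by omega)] at hp
    refine ⟨p, ?_, k1, hp⟩
    rcases lt_trichotomy p i with hlt | rfl | hlt
    · have := Fin.lt_def.1 hlt
      have := k4 _ (h.nc (by omega) (by omega) (by omega) (by omega) (by omega) k3 h3) (by omega)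
      omega
    · omega
    · exact hlt
  · rw [abs_of_neg k1] at hp
    have := h4 _ (h.outer hz (by omega) hiy hyf (by omega) h3
      (h.trans (h.symm (hp ▸ k3)) k6)) hiy
    omega

theorem eq_of_opens (h : RevData n R f) (h' : RevData n R' f')
    (ho : ∀ x : ℤ, 1 ≤ x → x ≤ n → (Opens R x ↔ Opens R' x))
    (hc : ∀ x : ℤ, 1 ≤ x → x ≤ n → (Closes R x ↔ Closes R' x)) (i : Fin n)
    (hi : (i : ℤ) + 1 < f i) : f' i = f i := by
  induction hd : (f i - i).toNat using Nat.strong_induction_on generalizing i with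
  | _ d ih =>
    have hi' : (i : ℤ) + 1 < f' i := by
      rwa [← h'.opens_iff, ← ho _ (by omega) (by omega), h.opens_iff]
    have hcl : ∀ {R : ℤ → ℤ → Prop} {f : Fin n → ℤ}, RevData n R f → (i : ℤ) + 1 < f i →
        Closes R (f i) := fun h hi => by
      have := (h.closes_abs_iff i).2 (Or.inl hi)
      rwa [abs_of_pos (by omega)] at this
    have hb := h.abs_bounds i
    have hb' := h'.abs_bounds i
    rw [abs_of_pos (by omega)] at hb hb'
    rcases lt_trichotomy (f' i) (f i) with hlt | heq | hlt
    · obtain ⟨p, hip, hp, hpe⟩ := h.exists_arc_under hi' hlt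
        ((hc _ hb'.1 hb'.2).2 (hcl h' hi'))
      have := Fin.lt_def.1 hip
      have := ih _ (by omega) p hp rfl
      exact absurd (h'.abs_injective (by rw [this, hpe])) hip.ne'
    · exact heq
    · obtain ⟨p, hip, hp, hpe⟩ := h'.exists_arc_under hi hlt ((hc _ hb.1 hb.2).1 (hcl h hi))
      have hip' := Fin.lt_def.1 hip
      have hp' : (p : ℤ) + 1 < f p := by
        rwa [← h.opens_iff, ho _ (by omega) (by omega), h'.opens_iff]
      rcases h.cases i with ⟨h1, h2, h3, h4⟩ | hx | hx <;> [skip; omega; omega]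
      rcases h.cases p with ⟨k1, k2, k3, k4⟩ | hx | hx <;> [skip; omega; omega]
      have hne : f p ≠ f i := fun he => hip.ne' (h.abs_injective (by rw [he]))
      have hlt' : f p < f i := by
        by_contra hcon
        have := h4 _ (h.nc (by omega) (by omega) (by omega) (by omega) k2 h3 k3) (by omega)
        omega
      have := ih _ (by omega) p hp' rfl
      omega

/-- The smallest positive element of each class, and whether the class contains negative
elements, are determined by the opening and closing elements. -/
theorem exists_min (h : RevData n R f) (h' : RevData n R' f')
    (ho : ∀ x : ℤ, 1 ≤ x → x ≤ n → (Opens R x ↔ Opens R' x))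
    (hc : ∀ x : ℤ, 1 ≤ x → x ≤ n → (Closes R x ↔ Closes R' x)) (i : Fin n) :
    ∃ m, 0 < m ∧ R ((i : ℤ) + 1) m ∧ (∀ y, R ((i : ℤ) + 1) y → 0 < y → m ≤ y) ∧
      R' ((i : ℤ) + 1) m ∧ (∀ y, R' ((i : ℤ) + 1) y → 0 < y → m ≤ y) ∧
      ((∃ z < 0, R ((i : ℤ) + 1) z) ↔ ∃ z < 0, R' ((i : ℤ) + 1) z) := by
  induction hd : (i : ℕ) using Nat.strong_induction_on generalizing i with
  | _ d ih =>
    subst hd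
    have hc' := hc ((i : ℤ) + 1) (by omega) (by omega)
    by_cases hcl : Closes R ((i : ℤ) + 1)
    · obtain ⟨p, hp⟩ := h.exists_abs_eq (x := (i : ℤ) + 1) (by omega) (by omega)
      have hpc := h.closes_abs_iff p
      rw [hp, iff_true_left hcl] at hpc
      by_cases hp0 : f p < 0
      · obtain ⟨p', hp'⟩ := h'.exists_abs_eq (x := (i : ℤ) + 1) (by omega) (by omega)
        have hpc' := h'.closes_abs_iff p'
        rw [hp', iff_true_left (hc'.1 hcl)] at hpc'
        have hp0' : f' p' < 0 := by
          refine hpc'.resolve_left fun hlt => ?_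
          have := h'.eq_of_opens h (fun x hx hxn => (ho x hx hxn).symm)
            (fun x hx hxn => (hc x hx hxn).symm) p' hlt
          have := h.abs_injective (i := p) (j := p') (by rw [this, hp, hp'])
          subst this
          omega
        rw [abs_of_neg hp0] at hp
        rw [abs_of_neg hp0'] at hp'
        rcases h.cases p with hx | ⟨k1, k2, k3, k4, k5, z, hz, k6⟩ | hx <;> [omega; skip; omega]
        rcases h'.cases p' with hx | ⟨l1, l2, l3, l4, l5, z', hz', l6⟩ | hx <;>
          [omega; skip; omega]
        rw [hp] at k3 k5
        rw [hp'] at l3 l5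
        exact ⟨(i : ℤ) + 1, by omega, h.refl _, fun y hy => k5 y (h.trans k3 hy), h'.refl _,
          fun y hy => l5 y (h'.trans l3 hy), iff_of_true ⟨z, hz, h.trans (h.symm k3) k6⟩
            ⟨z', hz', h'.trans (h'.symm l3) l6⟩⟩
      · have hpi := hpc.resolve_right hp0
        have hpe := h.eq_of_opens h' ho hc p (by omega)
        rw [abs_of_pos (by omega)] at hp
        have hr : R ((p : ℤ) + 1) ((i : ℤ) + 1) := by
          rcases h.cases p with hx | hx | hx <;> [exact hp ▸ hx.2.2.1; omega; omega]
        have hr' : R' ((p : ℤ) + 1) ((i : ℤ) + 1) := by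
          rcases h'.cases p with hx | hx | hx <;>
            [exact (hpe.trans hp) ▸ hx.2.2.1; omega; omega]
        obtain ⟨m, hm, h1, h2, h3, h4, h5⟩ := ih p (by omega) p rfl
        have he : ∀ y, R ((i : ℤ) + 1) y ↔ R ((p : ℤ) + 1) y := fun y =>
          ⟨h.trans hr, h.trans (h.symm hr)⟩
        have he' : ∀ y, R' ((i : ℤ) + 1) y ↔ R' ((p : ℤ) + 1) y := fun y =>
          ⟨h'.trans hr', h'.trans (h'.symm hr')⟩
        simp only [he, he']
        exact ⟨m, hm, h1, h2, h3, h4, h5⟩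
    · have hcl' := mt hc'.2 hcl
      have hm : ∀ y, R ((i : ℤ) + 1) y → (i : ℤ) + 1 ≤ y := fun y hy =>
        not_lt.1 fun hlt => hcl ⟨y, hlt, hy⟩
      have hm' : ∀ y, R' ((i : ℤ) + 1) y → (i : ℤ) + 1 ≤ y := fun y hy =>
        not_lt.1 fun hlt => hcl' ⟨y, hlt, hy⟩
      refine ⟨(i : ℤ) + 1, by omega, h.refl _, fun y hy _ => hm y hy, h'.refl _,
        fun y hy _ => hm' y hy, iff_of_false ?_ ?_⟩
      · rintro ⟨z, hz, hr⟩
        have := hm z hr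
        omega
      · rintro ⟨z, hz, hr⟩
        have := hm' z hr
        omega

theorem eq_of_opens_closes (h : RevData n R f) (h' : RevData n R' f')
    (ho : ∀ x : ℤ, 1 ≤ x → x ≤ n → (Opens R x ↔ Opens R' x))
    (hc : ∀ x : ℤ, 1 ≤ x → x ≤ n → (Closes R x ↔ Closes R' x)) : f = f' := by
  funext i
  by_cases hi : (i : ℤ) + 1 < f i
  · exact (h.eq_of_opens h' ho hc i hi).symm
  have hi' : ¬ (i : ℤ) + 1 < f' i := by
    rwa [← h'.opens_iff, ← ho _ (by omega) (by omega), h.opens_iff]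
  obtain ⟨m, hm, h1, h2, h3, h4, h5⟩ := h.exists_min h' ho hc i
  have key : ∀ {R : ℤ → ℤ → Prop} {f : Fin n → ℤ}, RevData n R f → ¬ (i : ℤ) + 1 < f i →
      R ((i : ℤ) + 1) m → (∀ y, R ((i : ℤ) + 1) y → 0 < y → m ≤ y) →
        f i = if ∃ z < 0, R ((i : ℤ) + 1) z then -m else m := by
    intro R f h hi h1 h2
    rcases h.cases i with hx | ⟨k1, k2, k3, k4, k5, k6⟩ | ⟨k1, k2, k3, k4, k5⟩
    · omega
    · rw [if_pos k6]
      have := k5 m h1 hm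
      have := h2 _ k3 (by omega)
      omega
    · rw [if_neg]
      · have := k5 m h1
        have := h2 _ k3 k1
        omega
      · rintro ⟨z, hz, hr⟩
        have := k5 z hr
        omega
  rw [key h hi h1 h2, key h' hi' h3 h4]
  simp only [h5]

end RevData

/-- Number of steps needed to go from `x` to `y` along the cyclic order given by `bKey n`; a full
turn is counted when `x = y`. -/
noncomputable def cycDist (n : ℕ) (x y : ℤ) : ℤ :=
  if bKey n x < bKey n y then bKey n y - bKey n x else bKey n y - bKey n x + 2 * n

theorem bKey_bounds {n : ℕ} {x : ℤ} (hx : InB n x) : 1 ≤ bKey n x ∧ bKey n x ≤ 2 * n := by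
  rw [inB_iff] at hx
  rw [bKey]
  split_ifs <;> omega

theorem bKey_inj {n : ℕ} {x y : ℤ} (hx : InB n x) (hy : InB n y) (h : bKey n x = bKey n y) :
    x = y := by
  rw [inB_iff] at hx hy
  rw [bKey, bKey] at h
  split_ifs at h <;> omega

theorem inB_neg {n : ℕ} {x : ℤ} : InB n (-x) ↔ InB n x := by
  rw [InB, InB, abs_neg]

theorem cycDist_neg_neg {n : ℕ} {x y : ℤ} (hx : InB n x) (hy : InB n y) :
    cycDist n (-x) (-y) = cycDist n x y := by
  rw [inB_iff] at hx hy
  simp only [cycDist, bKey]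
  split_ifs <;> omega

theorem cycDist_bounds {n : ℕ} {x y : ℤ} (hx : InB n x) (hy : InB n y) :
    1 ≤ cycDist n x y ∧ cycDist n x y ≤ 2 * n := by
  have := bKey_bounds hx
  have := bKey_bounds hy
  rw [cycDist]
  split_ifs <;> omega

theorem cycDist_right_inj {n : ℕ} {x y z : ℤ} (hx : InB n x) (hy : InB n y) (hz : InB n z)
    (h : cycDist n x y = cycDist n x z) : y = z := by
  have := bKey_bounds hx
  have := bKey_bounds hy
  have := bKey_bounds hz
  refine bKey_inj hy hz ?_
  rw [cycDist, cycDist] at h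
  split_ifs at h <;> omega

theorem exists_signedPerm {n : ℕ} {W : ℤ → ℤ → Prop} (hrefl : ∀ x, W x x)
    (hsymm : ∀ {x y}, W x y → W y x) (htrans : ∀ {x y z}, W x y → W y z → W x z)
    (hneg : ∀ {x y}, W x y → W (-x) (-y)) (hB : ∀ {x y}, W x y → InB n x → InB n y) :
    ∃ σ : Equiv.Perm ℤ, IsSignedPerm n σ ∧ IncCyclesB n σ ∧
      ∀ x y, InB n x → (σ.SameCycle x y ↔ W x y) := by
  have hfin : {x | InB n x}.Finite := (Set.finite_Icc (-(n : ℤ)) n).subset fun x hx => by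
    have := inB_iff.1 hx
    exact ⟨by omega, by omega⟩
  have hex : ∀ x, ∃ z, (¬ InB n x → z = x) ∧ (InB n x → W x z ∧
      ∀ y, W x y → cycDist n x z ≤ cycDist n x y) := by
    intro x
    by_cases hx : InB n x
    · obtain ⟨y, hy, hmin⟩ := Set.exists_min_image {y | W x y} (cycDist n x)
        (hfin.subset fun y hy => hB hy hx) ⟨x, hrefl x⟩
      exact ⟨y, fun h => absurd hx h, fun _ => ⟨hy, hmin⟩⟩
    · exact ⟨x, fun _ => rfl, fun h => absurd h hx⟩
  choose nx hout hin using hex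
  have hW : ∀ x, W x (nx x) := by
    intro x
    by_cases hx : InB n x
    · exact (hin x hx).1
    · rw [hout x hx]
      exact hrefl x
  have hnB : ∀ x, InB n (nx x) ↔ InB n x := fun x => ⟨hB (hsymm (hW x)), hB (hW x)⟩
  have hmid : ∀ {x y}, InB n x → W x y → x ≠ y → nx x ≠ y →
      cycDist n (nx x) y < cycDist n x y := by
    intro x y hx hxy hne hne'
    have h1 := (hin x hx).2 y hxy
    have h2 := (hnB x).2 hx
    have h3 := hB hxy hx
    have h4 : bKey n x ≠ bKey n y := fun h => hne (bKey_inj hx h3 h)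
    have h5 : bKey n (nx x) ≠ bKey n y := fun h => hne' (bKey_inj h2 h3 h)
    have := bKey_bounds hx
    have := bKey_bounds h2
    have := bKey_bounds h3
    simp only [cycDist] at h1 ⊢
    split_ifs at h1 ⊢ <;> omega
  have hinj : Function.Injective nx := by
    intro x y hxy
    by_cases hx : InB n x
    · have hy : InB n y := by rwa [← hnB, ← hxy, hnB]
      have hw : W x y := htrans (hW x) (hxy ▸ hsymm (hW y))
      have h1 := (hin x hx).2 y hw
      have h2 := (hin y hy).2 x (hsymm hw)
      rw [hxy] at h1
      have h3 := (hnB y).2 hy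
      have := bKey_bounds hx
      have := bKey_bounds hy
      have := bKey_bounds h3
      by_contra hne
      have h4 : bKey n x ≠ bKey n y := fun h => hne (bKey_inj hx hy h)
      simp only [cycDist] at h1 h2
      split_ifs at h1 h2 <;> omega
    · have hy : ¬ InB n y := by rwa [← hnB, ← hxy, hnB]
      rw [← hout x hx, ← hout y hy, hxy]
  have hsurj : Function.Surjective nx := by
    intro y
    by_cases hy : InB n y
    · have := hfin.to_subtype
      have hsurj := Finite.surjective_of_injective (α := {x | InB n x})
        (f := fun x => ⟨nx x, (hnB x).2 x.2⟩) fun x z hxz => Subtype.ext (hinj (by simpa using hxz))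
      obtain ⟨x, hx⟩ := hsurj ⟨y, hy⟩
      exact ⟨x, congrArg Subtype.val hx⟩
    · exact ⟨y, hout y hy⟩
  let σ : Equiv.Perm ℤ := Equiv.ofBijective nx ⟨hinj, hsurj⟩
  have hσ : ∀ x, σ x = nx x := fun _ => rfl
  have hsc : ∀ x y, InB n x → (σ.SameCycle x y ↔ W x y) := by
    intro x y hx
    constructor
    · rintro ⟨k, rfl⟩
      induction k using Int.induction_on with
      | zero => exact hrefl x
      | succ k ih =>
        rw [add_comm, zpow_add, zpow_one, Equiv.Perm.mul_apply, hσ]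
        exact htrans ih (hW _)
      | pred k ih =>
        rw [sub_eq_add_neg, add_comm, zpow_add, zpow_neg_one, Equiv.Perm.mul_apply]
        refine htrans ih (hsymm ?_)
        convert hW _
        exact (σ.apply_symm_apply _).symm
    · intro hxy
      induction hd : (cycDist n x y).toNat using Nat.strong_induction_on generalizing x with
      | _ d ih =>
        by_cases hne : x = y
        · rw [hne]
        by_cases hne' : nx x = y
        · rw [← hne', ← hσ]
          exact Equiv.Perm.sameCycle_apply_right.2 (.refl _ _)
        have := hmid hx hxy hne hne'
        have := cycDist_bounds ((hnB x).2 hx) (hB hxy hx)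
        rw [← Equiv.Perm.sameCycle_apply_left, hσ]
        exact ih _ (by omega) _ ((hnB x).2 hx) (htrans (hsymm (hW x)) hxy) rfl
  refine ⟨σ, ⟨fun x => ?_, fun x hx => hout x hx⟩, fun x hx => ?_, hsc⟩
  · rw [hσ, hσ]
    by_cases hx : InB n x
    · have hx' := inB_neg.2 hx
      have h1 := hin _ hx'
      have h2 := hin _ hx
      have h3 := h1.2 _ (hneg h2.1)
      have h4 := h2.2 (-nx (-x)) (by simpa using hneg h1.1)
      rw [← cycDist_neg_neg (y := -nx (-x)) hx (by rwa [inB_neg, hnB, inB_neg]), neg_neg] at h4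
      have h5 := (hnB x).2 hx
      refine cycDist_right_inj hx' ((hnB _).2 hx') (inB_neg.2 h5) (le_antisymm h3 ?_)
      rwa [cycDist_neg_neg hx h5]
    · rw [hout x hx, hout _ (mt inB_neg.1 hx)]
  · have hb := bKey_bounds hx
    have hb' := bKey_bounds ((hnB x).2 hx)
    rw [hσ]
    refine ⟨?_, fun hmax y hy => ?_⟩
    · rintro ⟨y, hy, hlt⟩
      rw [hsc x y hx] at hy
      have hyb := bKey_bounds (hB hy hx)
      have h1 := (hin x hx).2 y hy
      have hlt' : bKey n x < bKey n (nx x) := by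
        simp only [cycDist] at h1
        split_ifs at h1 <;> omega
      refine ⟨hlt', fun z hz hxz => ?_⟩
      have h1 := (hin x hx).2 z ((hsc x z hx).1 hz)
      rw [cycDist, cycDist, if_pos hlt', if_pos hxz] at h1
      omega
    · have h1 := (hin x hx).2 y ((hsc x y hx).1 hy)
      have h2 := hmax y hy
      have h3 := hmax _ ((hsc x _ hx).2 (hW x))
      rw [cycDist, cycDist, if_neg (by omega), if_neg (by omega)] at h1
      omega

section partition

variable {n : ℕ} {G : ℤ → ℤ}

/-- If a function with unit steps descends from above `v` to `v` or below, then it attains `v` for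
a first time. -/
theorem exists_first_hit {G : ℤ → ℤ} {a b v : ℤ} (hab : a ≤ b)
    (hstep : ∀ t, a ≤ t → t < b → G (t + 1) = G t + 1 ∨ G (t + 1) = G t - 1)
    (ha : v < G a) (hb : G b ≤ v) :
    ∃ t, a < t ∧ t ≤ b ∧ G t = v ∧ ∀ s, a ≤ s → s < t → v < G s := by
  obtain ⟨t, ⟨h1, h2⟩, h3⟩ := Int.exists_least_of_bdd (P := fun t => a ≤ t ∧ G t ≤ v)
    ⟨a, fun t ht => ht.1⟩ ⟨b, hab, hb⟩
  have hne : t ≠ a := by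
    rintro rfl
    omega
  have h4 : ∀ s, a ≤ s → s < t → v < G s := fun s hs hst => by
    by_contra hlt
    have := h3 s ⟨hs, by omega⟩
    omega
  have h5 := hstep (t - 1) (by omega) (by have := h3 b ⟨hab, hb⟩; omega)
  have h6 := h4 (t - 1) (by omega) (by omega)
  rw [sub_add_cancel] at h5
  exact ⟨t, by omega, h3 b ⟨hab, hb⟩, by omega, h4⟩

/-- The mirror image of `exists_first_hit`. -/
theorem exists_last_hit {G : ℤ → ℤ} {a b v : ℤ} (hab : a ≤ b)
    (hstep : ∀ t, a ≤ t → t < b → G (t + 1) = G t + 1 ∨ G (t + 1) = G t - 1)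
    (ha : G a ≤ v) (hb : v < G b) :
    ∃ t, a ≤ t ∧ t < b ∧ G t = v ∧ ∀ s, t < s → s ≤ b → v < G s := by
  obtain ⟨t, h1, h2, h3, h4⟩ := exists_first_hit (G := fun t => G (-t)) (a := -b) (b := -a) (v := v)
    (by omega) (fun t h1 h2 => by
      have := hstep (-(t + 1)) (by omega) (by omega)
      rw [show -(t + 1) + 1 = -t by ring] at this
      omega) (by simpa using hb) (by simpa using ha)
  exact ⟨-t, by omega, by omega, h3, fun s hs hsb => by simpa using h4 (-s) (by omega) (by omega)⟩

/-- A height function on `[0, 2n]` with unit steps, ending at height `0`. -/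
structure IsHeight (n : ℕ) (G : ℤ → ℤ) : Prop where
  step : ∀ t : ℤ, 0 ≤ t → t < 2 * n → G (t + 1) = G t + 1 ∨ G (t + 1) = G t - 1
  nonneg : ∀ t : ℤ, 0 ≤ t → t ≤ 2 * n → 0 ≤ G t
  parity : ∀ t : ℤ, 0 ≤ t → t ≤ 2 * n → G t % 2 = t % 2
  last : G (2 * n) = 0

/-- The midpoints of `x` and `y` are at the same height, and the graph of `G` does not go below
between them. -/
def Level (G : ℤ → ℤ) (x y : ℤ) : Prop :=
  G (2 * x - 1) = G (2 * y - 1) ∧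
    (∀ t, 2 * x - 1 ≤ t → t ≤ 2 * y - 1 → G (2 * x - 1) ≤ G t) ∧
    ∀ t, 2 * y - 1 ≤ t → t ≤ 2 * x - 1 → G (2 * x - 1) ≤ G t

/-- The midpoint of `x` is a weak record minimum of `G`. -/
def IsRecord (G : ℤ → ℤ) (x : ℤ) : Prop := ∀ t, 0 ≤ t → t ≤ 2 * x - 1 → G (2 * x - 1) ≤ G t

/-- The equivalence relation on signed elements given by a height function: elements of equal sign
are related when they are level, elements of opposite signs when they are records of complementary
heights. -/
def SignedLevel (n : ℕ) (G : ℤ → ℤ) (x y : ℤ) : Prop :=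
  x = y ∨ InB n x ∧ InB n y ∧
    ((x < 0 ↔ y < 0) ∧ Level G |x| |y| ∨
      ¬ (x < 0 ↔ y < 0) ∧ IsRecord G |x| ∧ IsRecord G |y| ∧
        G (2 * |x| - 1) + G (2 * |y| - 1) = G 0)

theorem Level.symm {x y : ℤ} (h : Level G x y) : Level G y x :=
  ⟨h.1.symm, fun t h1 h2 => h.1 ▸ h.2.2 t h1 h2, fun t h1 h2 => h.1 ▸ h.2.1 t h1 h2⟩

theorem Level.trans {x y z : ℤ} (h : Level G x y) (h' : Level G y z) : Level G x z := by
  refine ⟨h.1.trans h'.1, fun t h1 h2 => ?_, fun t h1 h2 => ?_⟩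
  · rcases le_total t (2 * y - 1) with h3 | h3
    · exact h.2.1 t h1 h3
    · exact h.1.le.trans (h'.2.1 t h3 h2)
  · rcases le_total t (2 * y - 1) with h3 | h3
    · exact h.1.le.trans (h'.2.2 t h1 h3)
    · exact h.2.2 t h3 h2

theorem Level.isRecord {x y : ℤ} (h : Level G x y) (hx : IsRecord G x) : IsRecord G y := by
  intro t h1 h2
  rw [← h.1]
  rcases le_total t (2 * x - 1) with h3 | h3
  · exact hx t h1 h3
  · exact h.2.1 t h3 h2

theorem IsRecord.level {x y : ℤ} (hx : 1 ≤ x) (hy : 1 ≤ y) (h : IsRecord G x) (h' : IsRecord G y)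
    (heq : G (2 * x - 1) = G (2 * y - 1)) : Level G x y :=
  ⟨heq, fun t h1 h2 => heq.le.trans (h' t (by omega) h2), fun t h1 h2 => h t (by omega) h2⟩

theorem IsRecord.le {x y : ℤ} (hx : 1 ≤ x) (hxy : x ≤ y) (h : IsRecord G y) :
    G (2 * y - 1) ≤ G (2 * x - 1) :=
  h _ (by omega) (by omega)

theorem Level.le {x y z : ℤ} (h : Level G x z) (hxy : x ≤ y) (hyz : y ≤ z) :
    G (2 * x - 1) ≤ G (2 * y - 1) :=
  h.2.1 _ (by omega) (by omega)

theorem Level.left {x y z : ℤ} (h : Level G x z) (hxy : x ≤ y) (hyz : y ≤ z)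
    (heq : G (2 * x - 1) = G (2 * y - 1)) : Level G x y :=
  ⟨heq, fun t h1 h2 => h.2.1 t h1 (by omega), fun t h1 h2 => by
    rw [show t = 2 * x - 1 by omega]⟩

theorem SignedLevel.symm {x y : ℤ} (h : SignedLevel n G x y) : SignedLevel n G y x := by
  rcases h with rfl | ⟨hx, hy, ⟨hs, h⟩ | ⟨hs, h1, h2, h3⟩⟩
  · exact Or.inl rfl
  · exact Or.inr ⟨hy, hx, Or.inl ⟨hs.symm, h.symm⟩⟩
  · exact Or.inr ⟨hy, hx, Or.inr ⟨fun h => hs h.symm, h2, h1, by rwa [add_comm]⟩⟩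

theorem SignedLevel.trans {x y z : ℤ} (h : SignedLevel n G x y) (h' : SignedLevel n G y z) :
    SignedLevel n G x z := by
  rcases h with rfl | ⟨hx, hy, h⟩
  · exact h'
  rcases h' with rfl | ⟨-, hz, h'⟩
  · exact Or.inr ⟨hx, hy, h⟩
  refine Or.inr ⟨hx, hz, ?_⟩
  rcases h with ⟨hs, h⟩ | ⟨hs, h1, h2, h3⟩ <;> rcases h' with ⟨hs', h'⟩ | ⟨hs', h1', h2', h3'⟩
  · exact Or.inl ⟨hs.trans hs', h.trans h'⟩
  · exact Or.inr ⟨by tauto, h.symm.isRecord h1', h2', by rw [h.1, h3']⟩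
  · exact Or.inr ⟨by tauto, h1, h'.isRecord h2, by rw [← h'.1, h3]⟩
  · exact Or.inl ⟨by tauto, h1.level hx.1 hz.1 h2' (by omega)⟩

theorem SignedLevel.neg {x y : ℤ} (h : SignedLevel n G x y) : SignedLevel n G (-x) (-y) := by
  rcases h with rfl | ⟨hx, hy, h⟩
  · exact Or.inl rfl
  have hx0 : x ≠ 0 := abs_pos.1 hx.1
  have hy0 : y ≠ 0 := abs_pos.1 hy.1
  refine Or.inr ⟨inB_neg.2 hx, inB_neg.2 hy, ?_⟩
  rwa [abs_neg, abs_neg, show (-x < 0 ↔ -y < 0) ↔ (x < 0 ↔ y < 0) by omega]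

theorem SignedLevel.inB {x y : ℤ} (h : SignedLevel n G x y) (hx : InB n x) : InB n y := by
  rcases h with rfl | ⟨-, hy, -⟩
  · exact hx
  · exact hy

theorem SignedLevel.sym {x y : ℤ} (hx : InB n x) (hy : InB n y) (h : SignedLevel n G x (-x))
    (h' : SignedLevel n G y (-y)) : SignedLevel n G x y := by
  have key : ∀ {x}, InB n x → SignedLevel n G x (-x) → IsRecord G |x| ∧
      2 * G (2 * |x| - 1) = G 0 := by
    intro x hx h
    have hx0 : x ≠ 0 := abs_pos.1 hx.1
    rcases h with h | ⟨-, -, ⟨hs, -⟩ | ⟨-, h1, -, h3⟩⟩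
    · omega
    · omega
    · rw [abs_neg] at h3
      exact ⟨h1, by omega⟩
  obtain ⟨h1, h2⟩ := key hx h
  obtain ⟨h3, h4⟩ := key hy h'
  by_cases hs : x < 0 ↔ y < 0
  · exact Or.inr ⟨hx, hy, Or.inl ⟨hs, h1.level hx.1 hy.1 h3 (by omega)⟩⟩
  · exact Or.inr ⟨hx, hy, Or.inr ⟨hs, h1, h3, by omega⟩⟩

theorem SignedLevel.nc {a b c d : ℤ} (ha : InB n a) (hb : InB n b) (hc : InB n c) (hd : InB n d)
    (hab : bKey n a < bKey n b) (hbc : bKey n b < bKey n c) (hcd : bKey n c < bKey n d)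
    (hac : SignedLevel n G a c) (hbd : SignedLevel n G b d) : SignedLevel n G a b := by
  rcases hac with rfl | ⟨-, -, hac⟩
  · omega
  rcases hbd with rfl | ⟨-, -, hbd⟩
  · omega
  have ha' := inB_iff.1 ha
  have hb' := inB_iff.1 hb
  have hc' := inB_iff.1 hc
  have hd' := inB_iff.1 hd
  have habs : ∀ {x y}, InB n x → InB n y → bKey n x < bKey n y →
      (x < 0 ∨ ¬ y < 0) ∧ ((x < 0 ↔ y < 0) → |x| < |y|) := by
    intro x y hx hy h
    rw [inB_iff] at hx hy
    rw [bKey, bKey] at h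
    rcases abs_cases x with hx' | hx' <;> rcases abs_cases y with hy' | hy' <;>
      split_ifs at h <;> omega
  obtain ⟨sab, lab⟩ := habs ha hb hab
  obtain ⟨sbc, lbc⟩ := habs hb hc hbc
  obtain ⟨scd, lcd⟩ := habs hc hd hcd
  refine Or.inr ⟨ha, hb, ?_⟩
  rcases hac with ⟨hs, h⟩ | ⟨hs, h1, h2, h3⟩ <;> rcases hbd with ⟨hs', h'⟩ | ⟨hs', h1', h2', h3'⟩
  · have lab' := lab (by omega)
    have lbc' := lbc (by omega)
    have lcd' := lcd (by omega)
    have := h.le lab'.le lbc'.le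
    have := h'.le lbc'.le lcd'.le
    exact Or.inl ⟨by omega, h.left lab'.le lbc'.le (by have := h.1; omega)⟩
  · have lab' := lab (by omega)
    have lbc' := lbc (by omega)
    have := h.le lab'.le lbc'.le
    have := h1'.le ha.1 lab'.le
    exact Or.inl ⟨by omega, h.left lab'.le lbc'.le (by omega)⟩
  · have lbc' := lbc (by omega)
    have lcd' := lcd (by omega)
    have h4 := h'.le lbc'.le lcd'.le
    have h5 := h2.le hb.1 lbc'.le
    exact Or.inr ⟨by omega, h1, (h'.left lbc'.le lcd'.le (by omega)).symm.isRecord h2, by omega⟩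
  · have lab' := lab (by omega)
    have lcd' := lcd (by omega)
    have := h1'.le ha.1 lab'.le
    have := h2'.le hc.1 lcd'.le
    exact Or.inl ⟨by omega, h1.level ha.1 hb.1 h1' (by omega)⟩

namespace IsHeight

theorem opens_iff (h : IsHeight n G) {x : ℤ} (hx : 1 ≤ x) (hxn : x ≤ n) :
    Opens (SignedLevel n G) x ↔ G (2 * x) = G (2 * x - 1) + 1 := by
  have hst := h.step (2 * x - 1) (by omega) (by omega)
  rw [sub_add_cancel] at hst
  constructor
  · rintro ⟨y, hlt, rfl | ⟨-, -, ⟨hs, hl⟩ | ⟨hs, -⟩⟩⟩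
    · omega
    · rw [abs_of_pos (by omega), abs_of_pos (by omega)] at hl
      have := hl.2.1 (2 * x) (by omega) (by omega)
      omega
    · omega
  · intro hup
    obtain ⟨t, h1, h2, h3, h4⟩ := exists_first_hit (G := G) (a := 2 * x) (b := 2 * n)
      (v := G (2 * x - 1)) (by omega) (fun t h1 h2 => h.step t (by omega) h2) (by omega)
      (by rw [h.last]; exact h.nonneg _ (by omega) (by omega))
    have p1 := h.parity t (by omega) h2
    have p2 := h.parity (2 * x - 1) (by omega) (by omega)
    obtain ⟨y, rfl⟩ : ∃ y, t = 2 * y - 1 := ⟨(t + 1) / 2, by omega⟩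
    refine ⟨y, by omega, Or.inr ⟨inB_iff.2 (by omega), inB_iff.2 (by omega), Or.inl ⟨by omega, ?_⟩⟩⟩
    rw [abs_of_pos (by omega), abs_of_pos (by omega)]
    refine ⟨h3.symm, fun t k1 k2 => ?_, fun t k1 k2 => by omega⟩
    rcases eq_or_lt_of_le k1 with rfl | k1
    · rfl
    rcases eq_or_lt_of_le k2 with rfl | k2
    · exact h3.ge
    · exact (h4 t (by omega) k2).le

theorem closes_iff (h : IsHeight n G) {x : ℤ} (hx : 1 ≤ x) (hxn : x ≤ n) :
    Closes (SignedLevel n G) x ↔ G (2 * x - 2) = G (2 * x - 1) + 1 := by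
  have hst := h.step (2 * x - 2) (by omega) (by omega)
  rw [show 2 * x - 2 + 1 = 2 * x - 1 by ring] at hst
  constructor
  · rintro ⟨y, hlt, rfl | ⟨-, hy, ⟨hs, hl⟩ | ⟨hs, hr, -⟩⟩⟩
    · omega
    · rw [inB_iff] at hy
      rw [abs_of_pos (by omega), abs_of_pos (by omega)] at hl
      have := hl.2.2 (2 * x - 2) (by omega) (by omega)
      omega
    · rw [abs_of_pos (by omega)] at hr
      have := hr (2 * x - 2) (by omega) (by omega)
      omega
  · intro hup
    have p2 := h.parity (2 * x - 1) (by omega) (by omega)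
    by_cases hrec : ∀ t, 0 ≤ t → t ≤ 2 * x - 2 → G (2 * x - 1) < G t
    · have p0 := h.parity 0 le_rfl (by omega)
      have hnn := h.nonneg (2 * x - 1) (by omega) (by omega)
      obtain ⟨t, h1, h2, h3, h4⟩ := exists_first_hit (G := G) (a := 0) (b := 2 * n)
        (v := G 0 - G (2 * x - 1)) (by omega) h.step (by omega)
        (by rw [h.last]; have := hrec 0 le_rfl (by omega); omega)
      have p1 := h.parity t (by omega) h2
      obtain ⟨y, rfl⟩ : ∃ y, t = 2 * y - 1 := ⟨(t + 1) / 2, by omega⟩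
      refine ⟨-y, by omega,
        Or.inr ⟨inB_iff.2 (by omega), inB_iff.2 (by omega), Or.inr ⟨by omega, ?_⟩⟩⟩
      rw [abs_neg, abs_of_pos (by omega), abs_of_pos (by omega)]
      refine ⟨fun t k1 k2 => ?_, fun t k1 k2 => ?_, by omega⟩
      · rcases eq_or_lt_of_le k2 with rfl | k2
        · rfl
        · exact (hrec t k1 (by omega)).le
      · rcases eq_or_lt_of_le k2 with rfl | k2
        · rfl
        · exact h3 ▸ (h4 t k1 k2).le
    · push Not at hrec
      obtain ⟨s, hs0, hs, hle⟩ := hrec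
      obtain ⟨t, h1, h2, h3, h4⟩ := exists_last_hit (G := G) (a := s) (b := 2 * x - 2)
        (v := G (2 * x - 1)) (by omega) (fun t h1 h2 => h.step t (by omega) (by omega)) hle
        (by omega)
      have p1 := h.parity t (by omega) (by omega)
      obtain ⟨y, rfl⟩ : ∃ y, t = 2 * y - 1 := ⟨(t + 1) / 2, by omega⟩
      refine ⟨y, by omega,
        Or.inr ⟨inB_iff.2 (by omega), inB_iff.2 (by omega), Or.inl ⟨by omega, ?_⟩⟩⟩
      rw [abs_of_pos (by omega), abs_of_pos (by omega)]
      refine ⟨h3.symm, fun t k1 k2 => by omega, fun t k1 k2 => ?_⟩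
      rcases eq_or_lt_of_le k2 with rfl | k2
      · rfl
      rcases eq_or_lt_of_le k1 with rfl | k1
      · exact h3.ge
      · exact (h4 t k1 (by omega)).le

end IsHeight

end partition

theorem exists_isNCB_signedLevel (n : ℕ) (G : ℤ → ℤ) :
    ∃ σ : Equiv.Perm ℤ, IsNCB n σ ∧ ∀ x y, InB n x → (σ.SameCycle x y ↔ SignedLevel n G x y) := by
  obtain ⟨σ, h1, h2, h3⟩ := exists_signedPerm (n := n) (W := SignedLevel n G) (fun _ => Or.inl rfl)
    SignedLevel.symm SignedLevel.trans SignedLevel.neg SignedLevel.inB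
  refine ⟨σ, ⟨h1, h2, ?_, ?_⟩, h3⟩
  · rintro ⟨a, b, c, d, ha, hb, hc, hd, hab, hbc, hcd, hac, hbd, hn⟩
    rw [h3 _ _ ha] at hac hn
    rw [h3 _ _ hb] at hbd
    exact hn (hac.nc ha hb hc hd hab hbc hcd hbd)
  · intro x y hx hy hxx hyy
    rw [h3 _ _ hx] at hxx ⊢
    rw [h3 _ _ hy] at hyy
    exact hxx.sym hx hy hyy

/-- Height of the path `w`, read from its end, above the diagonal. -/
def pathHeight {n : ℕ} (w : Fin (2 * n) → Bool) (t : ℤ) : ℤ :=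
  2 * n - t - 2 * countE w (2 * n - t).toNat

theorem countE_succ {m : ℕ} (w : Fin m → Bool) (t : Fin m) :
    countE w (t + 1) = countE w t + if w t = false then 1 else 0 := by
  obtain ⟨e, he⟩ : ∃ e : ℕ → ℤ, ∀ s : Fin m, e s = if w s = false then 1 else 0 :=
    ⟨fun k => if h : k < m then if w ⟨k, h⟩ = false then 1 else 0 else 0, fun s => by simp⟩
  have h1 := countE_eq_sum w he (k := (t : ℕ) + 1) t.2
  rw [Finset.sum_range_succ, ← countE_eq_sum w he t.2.le, he] at h1
  by_cases h2 : w t = false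
  · rw [if_pos h2] at h1 ⊢
    omega
  · rw [if_neg h2] at h1 ⊢
    omega

theorem pathHeight_sub_one {n : ℕ} (w : Fin (2 * n) → Bool) (s : Fin (2 * n)) {t : ℤ}
    (ht : t = 2 * n - s) :
    pathHeight w (t - 1) = pathHeight w t + if w s = false then -1 else 1 := by
  rw [pathHeight, pathHeight, show (2 * n - (t - 1)).toNat = (s : ℕ) + 1 by omega,
    show (2 * n - t).toNat = s by omega, countE_succ]
  split_ifs <;> push_cast <;> ring

theorem IsDyckB.isHeight {n : ℕ} {w : Fin (2 * n) → Bool} (hw : IsDyckB n w) :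
    IsHeight n (pathHeight w) where
  step t h1 h2 := by
    have := pathHeight_sub_one w ⟨(2 * n - (t + 1)).toNat, by omega⟩ (t := t + 1) (by
      simp only; omega)
    rw [add_sub_cancel_right] at this
    split_ifs at this <;> omega
  nonneg t h1 h2 := by
    have := isDyckB_iff.1 hw (2 * n - t).toNat (by omega)
    rw [pathHeight]
    omega
  parity t h1 h2 := by
    rw [pathHeight]
    omega
  last := by simp [pathHeight, countE]

theorem IsDyckB.exists_isNCB {n : ℕ} {w : Fin (2 * n) → Bool} (hw : IsDyckB n w) :
    ∃ σ : Equiv.Perm ℤ, IsNCB n σ ∧ pathOf n σ.SameCycle = w := by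
  obtain ⟨σ, h, hσ⟩ := exists_isNCB_signedLevel n (pathHeight w)
  refine ⟨σ, h, funext fun t => ?_⟩
  have ht := t.2
  have hx : InB n ((n : ℤ) - (t / 2 : ℕ)) := inB_iff.2 (by omega)
  have hs := pathHeight_sub_one w t rfl
  rw [pathOf]
  split_ifs with h2
  · have : Opens σ.SameCycle ((n : ℤ) - (t / 2 : ℕ)) ↔ w t = false := by
      simp only [Opens, hσ _ _ hx]
      refine (hw.isHeight.opens_iff (by omega) (by omega)).trans ?_
      rw [show 2 * ((n : ℤ) - (t / 2 : ℕ)) = 2 * n - t by omega, hs]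
      split_ifs with h3
      · exact iff_of_true (by omega) h3
      · exact iff_of_false (by omega) h3
    rw [this]
    simp
  · have : Closes σ.SameCycle ((n : ℤ) - (t / 2 : ℕ)) ↔ w t = true := by
      simp only [Closes, hσ _ _ hx]
      refine (hw.isHeight.closes_iff (by omega) (by omega)).trans ?_
      rw [show 2 * ((n : ℤ) - (t / 2 : ℕ)) - 1 = 2 * n - t by omega,
        show 2 * ((n : ℤ) - (t / 2 : ℕ)) - 2 = 2 * n - t - 1 by omega, hs]
      split_ifs with h3
      · exact iff_of_false (by omega) (by simp [h3])
      · exact iff_of_true (by omega) (by simpa using h3)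
    rw [this]
    simp

theorem IsNCB.eq_of_pathOf_eq {n : ℕ} {σ τ : Equiv.Perm ℤ} (hσ : IsNCB n σ) (hτ : IsNCB n τ)
    (h : pathOf n σ.SameCycle = pathOf n τ.SameCycle) : σ = τ :=
  hσ.eq_of_revW_eq hτ (hσ.revData.eq_of_opens_closes hτ.revData
    (fun _ hx hxn => (pathOf_injective h hx hxn).1) fun _ hx hxn => (pathOf_injective h hx hxn).2)

/-- For every `n ≥ 1` there is a bijection `ψ` from type `B_n` Dyck paths onto
`NC(B_n)` such that `area(w) = l_S(rev(ψ(w)))` and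
`maj(w) + maj_B(rev(ψ(w))) + imaj_B(rev(ψ(w))) = 2n²`. -/
theorem exists_bijection_dyckB_NCB (n : ℕ) (hn : 1 ≤ n) :
    ∃ ψ : {w : Fin (2 * n) → Bool // IsDyckB n w} → {σ : Equiv.Perm ℤ // IsNCB n σ},
      Function.Bijective ψ ∧ ∀ w,
        (areaB n w.1 : ℤ) = lSW (revW (word n (ψ w).1)) ∧
        majB n w.1 + majBW (revW (word n (ψ w).1)) + imajBW (revW (word n (ψ w).1)) =
          2 * n ^ 2 := by
  let φ : {σ : Equiv.Perm ℤ // IsNCB n σ} → {w : Fin (2 * n) → Bool // IsDyckB n w} :=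
    fun σ => ⟨pathOf n σ.1.SameCycle, σ.2.revData.isDyckB⟩
  have hφ : Function.Bijective φ := by
    refine ⟨fun σ τ h => Subtype.ext (σ.2.eq_of_pathOf_eq τ.2 (congrArg Subtype.val h)), ?_⟩
    rintro ⟨w, hw⟩
    obtain ⟨σ, hσ, rfl⟩ := hw.exists_isNCB
    exact ⟨⟨σ, hσ⟩, rfl⟩
  refine ⟨(Equiv.ofBijective φ hφ).symm, Equiv.bijective _, fun w => ?_⟩
  obtain ⟨σ, rfl⟩ := hφ.surjective w
  rw [Equiv.ofBijective_symm_apply_apply]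
  exact ⟨(areaB_pathOf σ.2.revData.isDyckB).trans σ.2.revData.lSW_eq.symm,
    σ.2.revData.maj_identity hn⟩

end Stmt
end

section
/- For every n ≥ 1 and every integer k, the number of Dyck paths of length n with major index k equals the number of 231-avoiding permutations σ of {1,…,n} with maj(σ) + imaj(σ) = k; equivalently, Σ_{w ∈ D_n} q^{maj(w)} = Σ_{σ ∈ S_n(231)} q^{maj(σ) + imaj(σ)}. -/
open scoped Classical

namespace Stmt

/-- Number of inversions of a permutation of `{1,…,n}`. -/
def invP {n : ℕ} (σ : Equiv.Perm (Fin n)) : ℕ :=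
  (Finset.univ.filter (fun p : Fin n × Fin n => p.1 < p.2 ∧ σ p.2 < σ p.1)).card

/-- Descent set of a permutation, as 1-indexed positions in `{1,…,n-1}`. -/
def permDes {n : ℕ} (σ : Equiv.Perm (Fin n)) : Finset ℕ :=
  (Finset.Ico 1 n).filter (fun i =>
    ∃ h : i < n, σ ⟨i, h⟩ < σ ⟨i - 1, Nat.lt_of_le_of_lt (Nat.sub_le i 1) h⟩)

def desP {n : ℕ} (σ : Equiv.Perm (Fin n)) : ℕ := (permDes σ).card

def majP {n : ℕ} (σ : Equiv.Perm (Fin n)) : ℕ := ∑ i ∈ permDes σ, i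

def imajP {n : ℕ} (σ : Equiv.Perm (Fin n)) : ℕ := majP σ⁻¹

/-- `σ` is 231-avoiding: no `i < j < k` with `σ k < σ i < σ j`. -/
def Avoids231 {n : ℕ} (σ : Equiv.Perm (Fin n)) : Prop :=
  ¬ ∃ i j k : Fin n, i < j ∧ j < k ∧ σ k < σ i ∧ σ i < σ j

/-- The number of elements of `S` below `m`. -/
def countBelow (S : Finset ℕ) (m : ℕ) : ℕ := (S.filter (· < m)).card

lemma countBelow_zero (S : Finset ℕ) : countBelow S 0 = 0 := by simp [countBelow]

lemma countBelow_succ_of_mem {S : Finset ℕ} {m : ℕ} (h : m ∈ S) :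
    countBelow S (m + 1) = countBelow S m + 1 := by
  have : S.filter (· < m + 1) = insert m (S.filter (· < m)) := by
    ext x; simp only [Finset.mem_filter, Finset.mem_insert]; grind
  rw [countBelow, this, Finset.card_insert_of_notMem (by simp), countBelow]

lemma countBelow_succ_of_notMem {S : Finset ℕ} {m : ℕ} (h : m ∉ S) :
    countBelow S (m + 1) = countBelow S m := by
  have : S.filter (· < m + 1) = S.filter (· < m) := by
    ext x; simp only [Finset.mem_filter]; grind
  rw [countBelow, this, countBelow]

lemma countBelow_mono (S : Finset ℕ) : Monotone (countBelow S) := fun a b h =>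
  Finset.card_le_card fun x hx => by
    simp only [Finset.mem_filter] at hx ⊢
    exact ⟨hx.1, hx.2.trans_le h⟩

lemma countBelow_le_card (S : Finset ℕ) (m : ℕ) : countBelow S m ≤ S.card :=
  Finset.card_le_card (Finset.filter_subset _ _)

lemma countBelow_eq_card {S : Finset ℕ} {m : ℕ} (h : ∀ x ∈ S, x < m) :
    countBelow S m = S.card := by
  rw [countBelow, Finset.filter_true_of_mem h]

lemma countBelow_le_add (S : Finset ℕ) (a b : ℕ) :
    countBelow S (a + b) ≤ countBelow S a + b := by
  induction b with
  | zero => simp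
  | succ b ih =>
    by_cases h : a + b ∈ S
    · have := countBelow_succ_of_mem h
      rw [← add_assoc]; omega
    · have := countBelow_succ_of_notMem h
      rw [← add_assoc]; omega

lemma countBelow_le (S : Finset ℕ) (m : ℕ) : countBelow S m ≤ m := by
  simpa [countBelow_zero] using countBelow_le_add S 0 m

lemma countBelow_lt_of_mem {S : Finset ℕ} {a b : ℕ} (h : a ∈ S) (hab : a < b) :
    countBelow S a < countBelow S b := by
  have := countBelow_mono S (show a + 1 ≤ b from hab)
  have := countBelow_succ_of_mem h
  omega

lemma sub_countBelow_mono (S : Finset ℕ) : Monotone fun m => m - countBelow S m := by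
  intro a b h
  obtain ⟨c, rfl⟩ := Nat.exists_eq_add_of_le h
  have := countBelow_le_add S a c
  dsimp only
  omega

lemma sub_countBelow_lt_of_notMem {S : Finset ℕ} {a b : ℕ} (h : a ∉ S) (hab : a < b) :
    a - countBelow S a < b - countBelow S b := by
  have h1 := sub_countBelow_mono S (show a + 1 ≤ b from hab)
  have := countBelow_succ_of_notMem h
  have := countBelow_le S a
  dsimp only at h1
  omega

lemma countBelow_image {V : Finset ℕ} {f : ℕ → ℕ} (hf : Set.InjOn f V) (k : ℕ) :
    countBelow (V.image f) k = (V.filter fun q => f q < k).card := by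
  rw [countBelow, Finset.filter_image, Finset.card_image_of_injOn]
  exact hf.mono fun x hx => (Finset.mem_filter.1 hx).1

lemma countBelow_congr {S T : Finset ℕ} {p : ℕ} (h : ∀ q < p, (q ∈ S ↔ q ∈ T)) :
    ∀ q ≤ p, countBelow S q = countBelow T q := fun q hq => by
  have : S.filter (· < q) = T.filter (· < q) := by
    ext x; simp only [Finset.mem_filter]
    constructor
    · rintro ⟨h1, h2⟩; exact ⟨(h x (by omega)).1 h1, h2⟩
    · rintro ⟨h1, h2⟩; exact ⟨(h x (by omega)).2 h1, h2⟩
  rw [countBelow, this, countBelow]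

/-- Pairs of equinumerous subsets of `{1, …, n - 1}`, the increasing enumeration of the first being
bounded termwise by that of the second. -/
def IsDominatedPair (n : ℕ) (P : Finset ℕ × Finset ℕ) : Prop :=
  P.1 ⊆ Finset.Ico 1 n ∧ P.2 ⊆ Finset.Ico 1 n ∧ P.1.card = P.2.card ∧
    ∀ k, countBelow P.2 k ≤ countBelow P.1 k

/-- The set of north steps of a Dyck path, as a set of times. -/
def IsDyckSet (n : ℕ) (S : Finset ℕ) : Prop :=
  S ⊆ Finset.range (2 * n) ∧ S.card = n ∧ ∀ m ≤ 2 * n, m ≤ 2 * countBelow S m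

/-- The times of the valleys of a path with north steps `S`. -/
def valleys (S : Finset ℕ) : Finset ℕ := S.filter fun q => 1 ≤ q ∧ q - 1 ∉ S

/-- The `x`- and `y`-coordinates of the valleys of a path with north steps `S`. -/
def valleyPair (S : Finset ℕ) : Finset ℕ × Finset ℕ :=
  ((valleys S).image fun q => q - countBelow S q, (valleys S).image (countBelow S))

lemma mem_valleys {S : Finset ℕ} {q : ℕ} : q ∈ valleys S ↔ q ∈ S ∧ 1 ≤ q ∧ q - 1 ∉ S := by
  simp [valleys]

lemma injOn_countBelow_valleys (S : Finset ℕ) : Set.InjOn (countBelow S) (valleys S) := by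
  intro a ha b hb h
  rw [Finset.mem_coe, mem_valleys] at ha hb
  by_contra hne
  rcases lt_or_gt_of_ne hne with h1 | h1
  · exact (countBelow_lt_of_mem ha.1 h1).ne h
  · exact (countBelow_lt_of_mem hb.1 h1).ne' h

lemma sub_countBelow_lt_of_valley {S : Finset ℕ} {a b : ℕ} (hb : b ∈ valleys S) (h : a < b) :
    a - countBelow S a < b - countBelow S b := by
  rw [mem_valleys] at hb
  have h1 : a - countBelow S a ≤ (b - 1) - countBelow S (b - 1) :=
    sub_countBelow_mono S (show a ≤ b - 1 by omega)
  exact h1.trans_lt (sub_countBelow_lt_of_notMem hb.2.2 (by omega))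

lemma injOn_sub_countBelow_valleys (S : Finset ℕ) :
    Set.InjOn (fun q => q - countBelow S q) (valleys S) := by
  intro a ha b hb h
  by_contra hne
  rcases lt_or_gt_of_ne hne with h1 | h1
  · exact (sub_countBelow_lt_of_valley hb h1).ne h
  · exact (sub_countBelow_lt_of_valley ha h1).ne' h

lemma valleyPair_sum (S : Finset ℕ) :
    ∑ d ∈ (valleyPair S).1, d + ∑ x ∈ (valleyPair S).2, x = ∑ q ∈ valleys S, q := by
  rw [valleyPair, Finset.sum_image (injOn_sub_countBelow_valleys S),
    Finset.sum_image (injOn_countBelow_valleys S), ← Finset.sum_add_distrib]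
  exact Finset.sum_congr rfl fun q _ => Nat.sub_add_cancel (countBelow_le S q)

lemma IsDyckSet.isDominatedPair_valleyPair {n : ℕ} {S : Finset ℕ} (hS : IsDyckSet n S) :
    IsDominatedPair n (valleyPair S) := by
  obtain ⟨h1, h2, h3⟩ := hS
  have key : ∀ q ∈ valleys S, 1 ≤ q - countBelow S q ∧
      q - countBelow S q ≤ countBelow S q ∧ countBelow S q < n := by
    intro q hq
    have hq' := mem_valleys.1 hq
    have ha := sub_countBelow_lt_of_valley hq (show 0 < q by omega)
    have hb := Finset.mem_range.1 (h1 hq'.1)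
    have hc := h3 q hb.le
    have hd := countBelow_lt_of_mem hq'.1 (Nat.lt_succ_self q)
    have he := countBelow_le_card S (q + 1)
    refine ⟨by omega, by omega, by rw [Nat.succ_eq_add_one] at hd; omega⟩
  refine ⟨?_, ?_, ?_, ?_⟩
  · intro x hx
    obtain ⟨q, hq, rfl⟩ := Finset.mem_image.1 hx
    have := key q hq
    simp only [Finset.mem_Ico]; omega
  · intro x hx
    obtain ⟨q, hq, rfl⟩ := Finset.mem_image.1 hx
    have := key q hq
    simp only [Finset.mem_Ico]; omega
  · rw [valleyPair, Finset.card_image_of_injOn (injOn_sub_countBelow_valleys S),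
      Finset.card_image_of_injOn (injOn_countBelow_valleys S)]
  · intro k
    rw [valleyPair, countBelow_image (injOn_countBelow_valleys S),
      countBelow_image (injOn_sub_countBelow_valleys S)]
    refine Finset.card_le_card fun q hq => ?_
    simp only [Finset.mem_filter] at hq ⊢
    have := key q hq.1
    exact ⟨hq.1, by omega⟩

lemma IsDyckSet.mem_of_mem_of_valleyPair_eq {n : ℕ} {S T : Finset ℕ} (hS : IsDyckSet n S)
    (hT : IsDyckSet n T) (h : valleyPair S = valleyPair T) {p : ℕ}
    (hp : ∀ q < p, (q ∈ S ↔ q ∈ T)) (hpS : p ∈ S) : p ∈ T := by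
  by_contra hpT
  have hc := countBelow_congr hp
  rw [valleyPair, valleyPair, Prod.mk.injEq] at h
  by_cases hv : p ∈ valleys S
  · have h1 : p - countBelow S p ∈ (valleys T).image fun q => q - countBelow T q := by
      rw [← h.1]
      exact Finset.mem_image_of_mem _ hv
    obtain ⟨q, hq, hqe⟩ := Finset.mem_image.1 h1
    rw [hc p le_rfl] at hqe
    rcases lt_trichotomy q p with hlt | rfl | hlt
    · have hvq : q ∈ valleys S := by
        rw [mem_valleys] at hq ⊢
        rw [hp _ hlt, hp _ (by omega)]; exact hq
      have := sub_countBelow_lt_of_valley hv hlt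
      rw [hc q hlt.le, hc p le_rfl] at this
      omega
    · exact hpT (mem_valleys.1 hq).1
    · have := sub_countBelow_lt_of_notMem hpT hlt
      omega
  · have hp0 : 1 ≤ p := by
      by_contra h0
      obtain rfl : p = 0 := by omega
      have h1 := Finset.mem_range.1 (hS.1 hpS)
      have h2 := hT.2.2 1 (by omega)
      rw [countBelow_succ_of_notMem hpT, countBelow_zero] at h2
      omega
    have hp1 : p - 1 ∈ S := by
      by_contra h0
      exact hv (mem_valleys.2 ⟨hpS, hp0, h0⟩)
    have hex : ∃ q, p ≤ q ∧ q ∈ T := by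
      by_contra! hno
      have h1 : countBelow T p = T.card := countBelow_eq_card fun x hx => by
        by_contra hx'
        exact hno x (by omega) hx
      have h2 := countBelow_succ_of_mem hpS
      have h3 := countBelow_le_card S (p + 1)
      rw [hS.2.1] at h3
      rw [hT.2.1, ← hc p le_rfl] at h1
      omega
    have hmin := fun m (hm : m < Nat.find hex) => Nat.find_min hex hm
    obtain ⟨hq1, hq2⟩ := Nat.find_spec hex
    generalize Nat.find hex = q at hmin hq1 hq2
    have hqp : p < q := lt_of_le_of_ne hq1 fun h => hpT (h ▸ hq2)
    have hqv : q ∈ valleys T :=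
      mem_valleys.2 ⟨hq2, by omega, fun h => hmin (q - 1) (by omega) ⟨by omega, h⟩⟩
    have hcq : countBelow T q = countBelow T p := by
      unfold countBelow
      congr 1
      ext x
      simp only [Finset.mem_filter, and_congr_right_iff]
      intro hx
      refine ⟨fun hxq => ?_, fun hxp => by omega⟩
      by_contra hxp
      exact hmin x hxq ⟨by omega, hx⟩
    have h1 : countBelow T q ∈ (valleys S).image (countBelow S) := by
      rw [h.2]
      exact Finset.mem_image_of_mem _ hqv
    obtain ⟨r, hr, hre⟩ := Finset.mem_image.1 h1
    rw [hcq, ← hc p le_rfl] at hre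
    rcases lt_trichotomy r p with hlt | rfl | hlt
    · exact (countBelow_lt_of_mem (mem_valleys.1 hr).1 hlt).ne hre
    · exact hv hr
    · exact (countBelow_lt_of_mem hpS hlt).ne' hre

lemma injOn_valleyPair (n : ℕ) : Set.InjOn valleyPair {S | IsDyckSet n S} := by
  intro S hS T hT h
  have key : ∀ p, p ∈ S ↔ p ∈ T := fun p => by
    induction p using Nat.strong_induction_on with
    | _ p ih =>
      exact ⟨IsDyckSet.mem_of_mem_of_valleyPair_eq hS hT h ih,
        IsDyckSet.mem_of_mem_of_valleyPair_eq hT hS h.symm fun q hq => (ih q hq).symm⟩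
  exact Finset.ext key

lemma exists_gc_countBelow {n : ℕ} {D X : Finset ℕ} (hP : IsDominatedPair n (D, X)) :
    ∃ h : ℕ → ℕ, (∀ v, h v ≤ v) ∧ Monotone h ∧
      ∀ v, countBelow D (h v + 1) = countBelow X (v + 1) ∧
        countBelow D (h v) ≤ countBelow X (v + 1) - 1 ∧ (countBelow X (v + 1) = 0 → h v = 0) := by
  obtain ⟨hD, -, -, hle⟩ := hP
  have hex : ∀ v, ∃ k, countBelow X (v + 1) ≤ countBelow D (k + 1) := fun v => ⟨v, hle _⟩
  have hD0 : countBelow D 1 = 0 := by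
    rw [countBelow_succ_of_notMem, countBelow_zero]
    intro h0
    simpa using hD h0
  refine ⟨fun v => Nat.find (hex v), fun v => Nat.find_min' _ (hle _), fun a b hab => ?_,
    fun v => ?_⟩
  · exact Nat.find_min' _ ((countBelow_mono X (by omega)).trans (Nat.find_spec (hex b)))
  · have h1 := Nat.find_spec (hex v)
    have h2 := fun m (hm : m < Nat.find (hex v)) => Nat.find_min (hex v) hm
    have h3 : countBelow X (v + 1) = 0 → Nat.find (hex v) = 0 := fun h => by
      rw [Nat.find_eq_zero, h]; exact Nat.zero_le _
    dsimp only
    generalize Nat.find (hex v) = k at h1 h2 h3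
    rcases k with _ | k
    · rw [countBelow_zero]
      rw [zero_add] at h1 ⊢
      refine ⟨by omega, Nat.zero_le _, fun _ => rfl⟩
    · have h4 := h2 k (by omega)
      have := countBelow_le_add D (k + 1) 1
      omega

lemma IsDominatedPair.exists_isDyckSet {n : ℕ} {P : Finset ℕ × Finset ℕ}
    (hP : IsDominatedPair n P) : ∃ S, IsDyckSet n S ∧ valleyPair S = P := by
  obtain ⟨D, X⟩ := P
  obtain ⟨h, hle, hmono, hh⟩ := exists_gc_countBelow hP
  obtain ⟨-, hX, hcard, -⟩ := hP
  dsimp only at hX hcard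
  have hstrict : StrictMono fun v => v + h v := fun a b hab => by
    have := hmono hab.le
    show a + h a < b + h b
    omega
  set S := (Finset.range n).image fun v => v + h v with hSdef
  have hmemS : ∀ q, q ∈ S ↔ ∃ v < n, v + h v = q := by simp [hSdef]
  have hcount : ∀ v ≤ n, ∀ q ≤ v + h v, (v = 0 ∨ v - 1 + h (v - 1) < q) → countBelow S q = v := by
    intro v hv q hq hq'
    have : S.filter (· < q) = (Finset.range v).image fun v => v + h v := by
      ext x
      simp only [Finset.mem_filter, hmemS, Finset.mem_image, Finset.mem_range]
      constructor
      · rintro ⟨⟨u, hu, rfl⟩, hux⟩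
        exact ⟨u, hstrict.lt_iff_lt.1 (hux.trans_le hq), rfl⟩
      · rintro ⟨u, hu, rfl⟩
        refine ⟨⟨u, by omega, rfl⟩, ?_⟩
        have := hstrict.monotone (show u ≤ v - 1 by omega)
        omega
    rw [countBelow, this, Finset.card_image_of_injective _ hstrict.injective, Finset.card_range]
  have hcount' : ∀ v < n, countBelow S (v + h v) = v := fun v hv =>
    hcount v hv.le _ le_rfl <| by
      rcases Nat.eq_zero_or_pos v with h0 | h0
      · exact Or.inl h0
      · exact Or.inr (hstrict (show v - 1 < v by omega))
  have hScard : S.card = n := by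
    rw [hSdef, Finset.card_image_of_injective _ hstrict.injective, Finset.card_range]
  have hXjump : ∀ v ∈ X, h (v - 1) < h v := by
    intro v hv
    have hv1 : 1 ≤ v := (Finset.mem_Ico.1 (hX hv)).1
    by_contra hlt
    have h1 := (hh v).1
    have h2 := (hh (v - 1)).1
    have h3 := countBelow_succ_of_mem hv
    have h4 := countBelow_mono D (show h v + 1 ≤ h (v - 1) + 1 by omega)
    rw [Nat.sub_add_cancel hv1] at h2
    omega
  have hXflat : ∀ v, 1 ≤ v → v ∉ X → h (v - 1) = h v := by
    intro v hv1 hv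
    have h1 := hh v
    have h2 := hh (v - 1)
    have h3 := countBelow_succ_of_notMem hv
    rw [Nat.sub_add_cancel hv1] at h2
    refine le_antisymm (hmono (by omega)) ?_
    by_contra hlt
    have h4 := countBelow_mono D (show h (v - 1) + 1 ≤ h v by omega)
    by_cases h0 : countBelow X (v + 1) = 0
    · have := h1.2.2 h0; omega
    · omega
  have hval : valleys S = X.image fun v => v + h v := by
    ext q
    simp only [mem_valleys, hmemS, Finset.mem_image]
    constructor
    · rintro ⟨⟨v, hv, rfl⟩, hq1, hq2⟩
      refine ⟨v, ?_, rfl⟩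
      by_contra hvX
      rcases Nat.eq_zero_or_pos v with rfl | h0
      · have := hle 0; omega
      · have := hXflat v h0 hvX
        exact hq2 ⟨v - 1, by omega, by omega⟩
    · rintro ⟨v, hv, rfl⟩
      have hv1 := Finset.mem_Ico.1 (hX hv)
      refine ⟨⟨v, hv1.2, rfl⟩, by omega, ?_⟩
      rintro ⟨u, hu, hue⟩
      have h1 := hXjump v hv
      rcases lt_or_ge u v with huv | huv
      · have := hstrict.monotone (show u ≤ v - 1 by omega)
        omega
      · have := hstrict.monotone huv
        omega
  refine ⟨S, ⟨?_, hScard, ?_⟩, ?_⟩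
  · intro q hq
    obtain ⟨v, hv, rfl⟩ := (hmemS q).1 hq
    have := hle v
    simp only [Finset.mem_range]; omega
  · intro m hm
    by_contra hlt
    have hsn : countBelow S m < n := by omega
    generalize hs : countBelow S m = s at hlt hsn
    have h1 := hle s
    have h2 := hcount' s hsn
    have h3 := countBelow_lt_of_mem ((hmemS _).2 ⟨s, hsn, rfl⟩) (show s + h s < m by omega)
    omega
  · have hinj : Set.InjOn h X := by
      intro a ha b hb hab
      by_contra hne
      rcases lt_or_gt_of_ne hne with h1 | h1
      · have := hmono (show a ≤ b - 1 by omega)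
        have := hXjump b hb
        omega
      · have := hmono (show b ≤ a - 1 by omega)
        have := hXjump a ha
        omega
    have hXn : ∀ v ∈ X, v < n := fun v hv => (Finset.mem_Ico.1 (hX hv)).2
    rw [valleyPair, hval, Finset.image_image, Finset.image_image, Prod.mk.injEq]
    constructor
    · have h1 : X.image ((fun q => q - countBelow S q) ∘ fun v => v + h v) = X.image h :=
        Finset.image_congr fun v hv => by
          simp only [Function.comp_apply]
          rw [hcount' v (hXn v hv)]; omega
      rw [h1]
      refine Finset.eq_of_subset_of_card_le ?_ ?_
      · intro d hd
        obtain ⟨v, hv, rfl⟩ := Finset.mem_image.1 hd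
        by_contra hnot
        have h2 := hh v
        have h3 := countBelow_succ_of_notMem hnot
        have h4 := countBelow_succ_of_mem hv
        omega
      · rw [Finset.card_image_of_injOn hinj, hcard]
    · have h1 : X.image (countBelow S ∘ fun v => v + h v) = X.image id :=
        Finset.image_congr fun v hv => by
          simp only [Function.comp_apply, id]
          exact hcount' v (hXn v hv)
      rw [h1, Finset.image_id]

/-- Avoidance of the pattern `231` for self-maps of `ℕ`. -/
def NatAvoids231 (s : ℕ → ℕ) : Prop := ∀ i j k, i < j → j < k → s k < s i → ¬ s i < s j

/-- `D` is the (1-indexed) descent set of `s`, and `X` is that of its inverse. -/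
structure HasDescents (s : Equiv.Perm ℕ) (D X : Finset ℕ) : Prop where
  zero_notMem_fst : 0 ∉ D
  zero_notMem_snd : 0 ∉ X
  mem_fst : ∀ i, i + 1 ∈ D ↔ s (i + 1) < s i
  mem_snd : ∀ i j, s j = s i + 1 → (s j ∈ X ↔ j < i)

namespace HasDescents

variable {s : Equiv.Perm ℕ} {D X : Finset ℕ}

lemma lt_of_notMem (h : HasDescents s D X) (hs : NatAvoids231 s) {i j : ℕ} (hi : i + 1 ∉ D)
    (hij : i < j) : s i < s j := by
  have h1 : s i < s (i + 1) := by
    have h2 : s (i + 1) ≠ s i := fun h => by have := s.injective h; omega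
    have h3 := mt (h.mem_fst i).2 hi
    omega
  rcases (Nat.succ_le_of_lt hij).eq_or_lt with rfl | h2
  · exact h1
  · by_contra hlt
    have h3 : s j ≠ s i := fun h => by have := s.injective h; omega
    exact hs i (i + 1) j (by omega) h2 (by omega) h1

lemma apply_mem_iff (h : HasDescents s D X) (hs : NatAvoids231 s) (j : ℕ) :
    s j ∈ X ↔ j + 1 ∈ D := by
  rcases Nat.eq_zero_or_pos (s j) with h0 | h0
  · rw [h0, h.mem_fst, h0]
    simp [h.zero_notMem_snd]
  · obtain ⟨i, hi⟩ := s.surjective (s j - 1)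
    rw [h.mem_snd i j (by omega)]
    have hne : i ≠ j := by rintro rfl; omega
    constructor
    · intro hji
      by_contra hj
      have := h.lt_of_notMem hs hj hji
      omega
    · intro hj
      have h1 := (h.mem_fst j).1 hj
      by_contra hlt
      have h2 : i ≠ j + 1 := by omega
      have h3 : s (j + 1) ≠ s i := fun h => h2 (s.injective h).symm
      exact hs i j (j + 1) (by omega) (by omega) (by omega) (by omega)

lemma card_eq (h : HasDescents s D X) (hs : NatAvoids231 s) : D.card = X.card := by
  have hpos : ∀ d ∈ D, d - 1 + 1 = d := fun d hd =>
    Nat.sub_add_cancel (Nat.pos_of_ne_zero fun h0 => h.zero_notMem_fst (h0 ▸ hd))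
  refine Finset.card_bij (fun d _ => s (d - 1)) ?_ ?_ ?_
  · intro d hd
    rw [h.apply_mem_iff hs, hpos d hd]
    exact hd
  · intro a ha b hb hab
    have := s.injective hab
    have := hpos a ha
    have := hpos b hb
    omega
  · intro x hx
    obtain ⟨j, rfl⟩ := s.surjective x
    exact ⟨j + 1, (h.apply_mem_iff hs j).1 hx, by simp⟩

lemma countBelow_le (h : HasDescents s D X) (hs : NatAvoids231 s) (k : ℕ) :
    countBelow X (k + 1) ≤ countBelow D (k + 1) := by
  obtain ⟨j, hj, hmin⟩ : ∃ j, k ≤ j ∧ ∀ i, k ≤ i → s j ≤ s i := by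
    obtain ⟨j, hj, hmin⟩ := (wellFounded_lt (α := ℕ)).has_min (s '' Set.Ici k)
      ⟨s k, Set.mem_image_of_mem _ Set.self_mem_Ici⟩
    obtain ⟨i, hi, rfl⟩ := hj
    exact ⟨i, hi, fun l hl => not_lt.1 (hmin _ (Set.mem_image_of_mem _ hl))⟩
  have hjD : j + 1 ∉ D := fun hd => by
    have := (h.mem_fst j).1 hd
    have := hmin (j + 1) (by omega)
    omega
  have hjk : s j ≤ k := by
    by_contra hlt
    have h1 : (Finset.range (k + 1)).image s.symm ⊆ Finset.range k := by
      intro i hi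
      obtain ⟨x, hx, rfl⟩ := Finset.mem_image.1 hi
      rw [Finset.mem_range] at hx ⊢
      by_contra hk
      have := hmin (s.symm x) (by omega)
      rw [Equiv.apply_symm_apply] at this
      omega
    have h2 := Finset.card_le_card h1
    rw [Finset.card_image_of_injective _ s.symm.injective] at h2
    simp at h2
  have hDc : countBelow D (k + 1) = ((Finset.range k).filter fun i => i + 1 ∈ D).card := by
    have hpos : ∀ d ∈ D, d - 1 + 1 = d := fun d hd =>
      Nat.sub_add_cancel (Nat.pos_of_ne_zero fun h0 => h.zero_notMem_fst (h0 ▸ hd))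
    refine Finset.card_bij' (fun d _ => d - 1) (fun d _ => d + 1) ?_ ?_ ?_ ?_
    · intro d hd
      rw [Finset.mem_filter] at hd
      have hd1 := hpos d hd.1
      simp only [Finset.mem_filter, Finset.mem_range, hd1]
      exact ⟨by omega, hd.1⟩
    · intro d hd
      rw [Finset.mem_filter, Finset.mem_range] at hd
      exact Finset.mem_filter.2 ⟨hd.2, by omega⟩
    · exact fun d hd => hpos d (Finset.mem_filter.1 hd).1
    · exact fun d _ => Nat.add_sub_cancel d 1
  have hXc : countBelow X (k + 1) = ((Finset.range (k + 1)).filter (· ∈ X)).card := by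
    rw [countBelow]
    congr 1
    ext x
    simp [and_comm]
  have h1 := Finset.card_filter_add_card_filter_not (s := Finset.range k) fun i => i + 1 ∈ D
  have h2 := Finset.card_filter_add_card_filter_not (s := Finset.range (k + 1)) (· ∈ X)
  have h3 : (insert j ((Finset.range k).filter fun i => i + 1 ∉ D)).card ≤
      ((Finset.range (k + 1)).filter (· ∉ X)).card := by
    refine Finset.card_le_card_of_injOn s ?_ s.injective.injOn
    intro i hi
    simp only [Finset.coe_insert, Finset.coe_filter, Finset.mem_range, Set.mem_insert_iff,
      Set.mem_ofPred_eq] at hi ⊢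
    rw [h.apply_mem_iff hs]
    rcases hi with rfl | ⟨hi1, hi2⟩
    · exact ⟨by omega, hjD⟩
    · have := h.lt_of_notMem hs hi2 (show i < j by omega)
      exact ⟨by omega, hi2⟩
  rw [Finset.card_insert_of_notMem (by simp; omega)] at h3
  simp only [Finset.card_range] at h1 h2
  omega

lemma apply_le_of_notMem {t : Equiv.Perm ℕ} (h : HasDescents s D X) (hs : NatAvoids231 s)
    (h' : HasDescents t D X) (ht : NatAvoids231 t) {i : ℕ} (hi : i + 1 ∉ D)
    (ih : ∀ j < i, j + 1 ∉ D → s j = t j) : t i ≤ s i := by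
  have h1 := mt (h.apply_mem_iff hs i).1 hi
  obtain ⟨j, hj⟩ := t.surjective (s i)
  rw [← hj, h'.apply_mem_iff ht] at h1
  rcases lt_trichotomy j i with hlt | rfl | hlt
  · rw [← ih j hlt h1] at hj
    have := s.injective hj
    omega
  · exact hj.le
  · have := h'.lt_of_notMem ht hi hlt
    omega

lemma apply_le_of_mem {t : Equiv.Perm ℕ} (h : HasDescents s D X) (ht : NatAvoids231 t)
    {i : ℕ} (hi : i + 1 ∈ D)
    (ih : ∀ j > i, s j = t j) : t i ≤ s i := by
  obtain ⟨j, hj⟩ := t.surjective (s i)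
  rcases lt_trichotomy j i with hlt | rfl | hlt
  · by_contra hgt
    have h2 := (h.mem_fst i).1 hi
    rw [ih (i + 1) (by omega)] at h2
    exact ht j i (i + 1) hlt (by omega) (by omega) (by omega)
  · exact hj.le
  · rw [← ih j hlt] at hj
    have := s.injective hj
    omega

lemma unique {t : Equiv.Perm ℕ} (h : HasDescents s D X) (hs : NatAvoids231 s)
    (h' : HasDescents t D X) (ht : NatAvoids231 t) {n : ℕ} (hD : ∀ d ∈ D, d < n) : s = t := by
  have h1 : ∀ i, i + 1 ∉ D → s i = t i := fun i => by
    induction i using Nat.strong_induction_on with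
    | _ i ih =>
      exact fun hi => le_antisymm
        (h'.apply_le_of_notMem ht h hs hi fun j hj hjD => (ih j hj hjD).symm)
        (h.apply_le_of_notMem hs h' ht hi ih)
  have h2 : ∀ m i, n ≤ i + m → s i = t i := fun m => by
    induction m with
    | zero => exact fun i hi => h1 i fun hd => by have := hD _ hd; omega
    | succ m ih =>
      intro i hi
      by_cases hd : i + 1 ∈ D
      · exact le_antisymm
          (h'.apply_le_of_mem hs hd fun j hj => (ih j (by omega)).symm)
          (h.apply_le_of_mem ht hd fun j hj => ih j (by omega))
      · exact h1 i hd
  exact Equiv.ext fun i => h2 n i (by omega)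

end HasDescents

/-- Greedy noncrossing matching of `A` into `X` subject to lower bounds `t`. -/
lemma exists_noncrossing_matching {t : ℕ → ℕ} (ht : Monotone t) (A : Finset ℕ) :
    ∀ X : Finset ℕ,
      (∀ a ∈ A, (A.filter (a ≤ ·)).card ≤ (X.filter (t a < ·)).card) →
      ∃ f : ℕ → ℕ, (∀ a ∈ A, f a ∈ X ∧ t a < f a) ∧ Set.InjOn f A ∧
        ∀ a ∈ A, ∀ b ∈ A, b < a → t a < f b → ¬ f b < f a := by
  induction A using Finset.induction_on_max with
  | empty => exact fun X _ => ⟨id, by simp⟩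
  | insert d A hd ih =>
    intro X hX
    have hdA : d ∉ A := fun h => (hd d h).false
    have hne : (X.filter (t d < ·)).Nonempty := by
      rw [← Finset.card_pos]
      refine lt_of_lt_of_le ?_ (hX d (Finset.mem_insert_self _ _))
      exact Finset.card_pos.2 ⟨d, by simp⟩
    obtain ⟨x, hx, hmin⟩ : ∃ x ∈ X.filter (t d < ·), ∀ y ∈ X.filter (t d < ·), x ≤ y :=
      ⟨_, Finset.min'_mem _ hne, fun y => Finset.min'_le _ y⟩
    rw [Finset.mem_filter] at hx
    obtain ⟨f, hf1, hf2, hf3⟩ := ih (X.erase x) fun a ha => by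
      have h1 := hX a (Finset.mem_insert_of_mem ha)
      rw [Finset.filter_insert, if_pos (hd a ha).le, Finset.card_insert_of_notMem
        (fun h => hdA (Finset.mem_filter.1 h).1)] at h1
      rw [Finset.filter_erase, Finset.card_erase_of_mem]
      · omega
      · exact Finset.mem_filter.2 ⟨hx.1, (ht (hd a ha).le).trans_lt hx.2⟩
    have hfA : ∀ a ∈ A, Function.update f d x a = f a := fun a ha =>
      Function.update_of_ne (ne_of_mem_of_not_mem ha hdA) _ _
    refine ⟨Function.update f d x, ?_, ?_, ?_⟩
    · intro a ha
      rcases Finset.mem_insert.1 ha with rfl | ha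
      · simpa using hx
      · rw [hfA a ha]
        exact ⟨Finset.mem_of_mem_erase (hf1 a ha).1, (hf1 a ha).2⟩
    · rw [Finset.coe_insert, Set.injOn_insert (by simpa using hdA)]
      refine ⟨fun a ha b hb hab => hf2 ha hb ?_, ?_⟩
      · rwa [hfA a ha, hfA b hb] at hab
      · rintro ⟨a, ha, hax⟩
        rw [hfA a ha, Function.update_self] at hax
        exact Finset.ne_of_mem_erase (hf1 a ha).1 hax
    · intro a ha b hb hba
      rcases Finset.mem_insert.1 hb with rfl | hb
      · rcases Finset.mem_insert.1 ha with rfl | ha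
        · exact absurd hba (lt_irrefl _)
        · exact absurd hba (hd a ha).le.not_gt
      · rw [hfA b hb]
        rcases Finset.mem_insert.1 ha with had | ha
        · rw [had, Function.update_self]
          exact fun h => (hmin (f b) (Finset.mem_filter.2
            ⟨Finset.mem_of_mem_erase (hf1 b hb).1, h⟩)).not_gt
        · rw [hfA a ha]
          exact hf3 a ha b hb hba

lemma count_notMem (X : Finset ℕ) (m : ℕ) :
    Nat.count (· ∉ X) m = m - countBelow X m := by
  induction m with
  | zero => simp
  | succ m ih =>
    have := countBelow_le X m
    rw [Nat.count_succ, ih]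
    by_cases h : m ∈ X
    · rw [countBelow_succ_of_mem h]; simp [h]
    · rw [countBelow_succ_of_notMem h]; simp [h]; omega

/-- The lower envelope `t` of the permutation with descent sets `D` and `X`: a weakly increasing map
which enumerates the complement of `X` along the non-descents. -/
lemma IsDominatedPair.exists_envelope {n : ℕ} {D X : Finset ℕ} (hP : IsDominatedPair n (D, X)) :
    ∃ t : ℕ → ℕ, Monotone t ∧ (∀ i, i + 1 ∈ D → t (i + 1) = t i) ∧
      (∀ i j, i + 1 ∉ D → i < j → t i < t j) ∧ (∀ i, t i ∉ X) ∧
      (∀ i, n ≤ i → t i = i) ∧ ∀ i, countBelow X (t i) ≤ countBelow D (i + 1) := by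
  obtain ⟨hD, hX, hcard, hle⟩ := hP
  dsimp only at hD hX hcard hle
  have hinf : {x | x ∉ X}.Infinite := X.finite_toSet.infinite_compl
  have hDi : ∀ i, countBelow D (i + 1) ≤ i := fun i => by
    have h0 : 0 ∉ D := fun h0 => by simpa using hD h0
    have h1 := countBelow_le_add D 1 i
    have h2 := countBelow_succ_of_notMem h0
    rw [countBelow_zero, zero_add] at h2
    rw [add_comm i 1]
    omega
  have hmono : Monotone fun i => i - countBelow D (i + 1) := fun i j hij => by
    have h1 := sub_countBelow_mono D (show i + 1 ≤ j + 1 by omega)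
    have := hDi i
    have := hDi j
    dsimp only at h1 ⊢
    omega
  refine ⟨fun i => Nat.nth (· ∉ X) (i - countBelow D (i + 1)),
    (Nat.nth_strictMono hinf).monotone.comp hmono, fun i hi => ?_,
    fun i j hi hij => ?_,   fun i => Nat.nth_mem_of_infinite hinf _, fun i hi => ?_, fun i => ?_⟩
  · dsimp only
    rw [countBelow_succ_of_mem hi, Nat.add_sub_add_right]
  · refine Nat.nth_strictMono hinf ?_
    have h1 := sub_countBelow_lt_of_notMem hi (show i + 1 < j + 1 by omega)
    have := hDi i
    have := hDi j
    omega
  · have h1 : countBelow D (i + 1) = countBelow X i := by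
      rw [countBelow_eq_card, countBelow_eq_card, hcard]
      · intro x hx
        have := Finset.mem_Ico.1 (hX hx)
        omega
      · intro x hx
        have := Finset.mem_Ico.1 (hD hx)
        omega
    dsimp only
    rw [h1, ← count_notMem]
    refine Nat.nth_count fun hx => ?_
    have := Finset.mem_Ico.1 (hX hx)
    omega
  · dsimp only
    have h1 := Nat.count_nth_of_infinite hinf (i - countBelow D (i + 1))
    generalize Nat.nth (· ∉ X) (i - countBelow D (i + 1)) = c at h1
    rw [count_notMem] at h1
    by_contra hlt
    have := hDi i
    have := countBelow_le X c
    obtain ⟨b, rfl⟩ := Nat.exists_eq_add_of_le (show i + 1 ≤ c by omega)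
    have := countBelow_le_add X (i + 1) b
    have := hle (i + 1)
    omega

lemma bijective_of_injective_of_fixed {s : ℕ → ℕ} {n : ℕ} (hs : Function.Injective s)
    (hfix : ∀ i, n ≤ i → s i = i) : Function.Bijective s := by
  refine ⟨hs, fun y => ?_⟩
  rcases le_or_gt n y with hy | hy
  · exact ⟨y, hfix y hy⟩
  · have h1 : (Finset.range n).image s = Finset.range n := by
      refine Finset.eq_of_subset_of_card_le (fun x hx => ?_) ?_
      · obtain ⟨i, hi, rfl⟩ := Finset.mem_image.1 hx
        rw [Finset.mem_range] at hi ⊢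
        by_contra hlt
        have := hs (hfix (s i) (by omega))
        omega
      · rw [Finset.card_image_of_injective _ hs]
    have h2 := Finset.mem_range.2 hy
    rw [← h1] at h2
    obtain ⟨i, -, hi⟩ := Finset.mem_image.1 h2
    exact ⟨i, hi⟩

lemma IsDominatedPair.exists_perm {n : ℕ} {D X : Finset ℕ} (hP : IsDominatedPair n (D, X)) :
    ∃ s : Equiv.Perm ℕ, HasDescents s D X ∧ NatAvoids231 s ∧ ∀ i, n ≤ i → s i = i := by
  obtain ⟨t, ht, htflat, htlt, htX, htfix, htc⟩ := hP.exists_envelope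
  obtain ⟨hD, hX, hcard, -⟩ := hP
  dsimp only at hD hX hcard
  have hD0 : 0 ∉ D := fun h0 => by simpa using hD h0
  have hX0 : 0 ∉ X := fun h0 => by simpa using hX h0
  have hmemA : ∀ a, a ∈ (Finset.range n).filter (fun i => i + 1 ∈ D) ↔ a + 1 ∈ D := fun a => by
    rw [Finset.mem_filter, Finset.mem_range, and_iff_right_iff_imp]
    intro ha
    have := Finset.mem_Ico.1 (hD ha)
    omega
  obtain ⟨f, hf1, hf2, hf3⟩ := exists_noncrossing_matching ht
      ((Finset.range n).filter fun i => i + 1 ∈ D) X fun a _ => by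
    have h1 : (((Finset.range n).filter fun i => i + 1 ∈ D).filter (a ≤ ·)).card ≤
        (D.filter fun d => ¬ d < a + 1).card := by
      refine Finset.card_le_card_of_injOn (· + 1) ?_ (add_left_injective 1).injOn
      intro i hi
      simp only [Finset.coe_filter, Set.mem_ofPred_eq, Finset.mem_filter] at hi ⊢
      exact ⟨hi.1.2, by omega⟩
    have h2 : X.filter (fun x => ¬ x < t a) = X.filter (t a < ·) := by
      refine Finset.filter_congr fun x hx => ?_
      have : x ≠ t a := fun h => htX a (h ▸ hx)
      omega
    have h3 := Finset.card_filter_add_card_filter_not (s := D) (· < a + 1)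
    have h4 := Finset.card_filter_add_card_filter_not (s := X) (· < t a)
    have h5 := htc a
    rw [h2] at h4
    unfold countBelow at h5
    omega
  simp only [hmemA] at hf1 hf3
  set s : ℕ → ℕ := fun i => if i + 1 ∈ D then f i else t i with hsdef
  have hsD : ∀ i, i + 1 ∈ D → s i = f i := fun i hi => if_pos hi
  have hsN : ∀ i, i + 1 ∉ D → s i = t i := fun i hi => if_neg hi
  have hlt : ∀ i, i + 1 ∈ D → t i < s i := fun i hi => hsD i hi ▸ (hf1 i hi).2
  have hle : ∀ i, t i ≤ s i := fun i => by
    by_cases hi : i + 1 ∈ D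
    · exact (hlt i hi).le
    · exact (hsN i hi).ge
  have hmem : ∀ i, s i ∈ X ↔ i + 1 ∈ D := fun i => by
    by_cases hi : i + 1 ∈ D
    · rw [hsD i hi]; exact iff_of_true (hf1 i hi).1 hi
    · rw [hsN i hi]; exact iff_of_false (htX i) hi
  have hnc : ∀ i j, i + 1 ∈ D → j + 1 ∈ D → i < j → t j < s i → ¬ s i < s j := fun i j hi hj => by
    rw [hsD i hi, hsD j hj]
    exact hf3 j hj i hi
  have hinj : Function.Injective s := fun i j hij => by
    by_cases hi : i + 1 ∈ D
    · have hj : j + 1 ∈ D := by rwa [← hmem, ← hij, hmem]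
      rw [hsD i hi, hsD j hj] at hij
      exact hf2 ((hmemA i).2 hi) ((hmemA j).2 hj) hij
    · have hj : j + 1 ∉ D := by rwa [← hmem, ← hij, hmem]
      rw [hsN i hi, hsN j hj] at hij
      rcases lt_trichotomy i j with h | h | h
      · exact absurd hij (htlt i j hi h).ne
      · exact h
      · exact absurd hij (htlt j i hj h).ne'
  have hfix : ∀ i, n ≤ i → s i = i := fun i hi => by
    rw [hsN i fun h => by have := Finset.mem_Ico.1 (hD h); omega, htfix i hi]
  have hasc : ∀ i j, i + 1 ∉ D → i < j → s i < s j := fun i j hi hij => by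
    rw [hsN i hi]
    exact (htlt i j hi hij).trans_le (hle j)
  have hasc' : ∀ i j, i + 1 ∉ D → i < j → s i < t j := fun i j hi hij => by
    rw [hsN i hi]
    exact htlt i j hi hij
  have hne : ∀ i j, i < j → s i ≠ t j := fun i j hij h => by
    by_cases hi : i + 1 ∈ D
    · exact htX j (h ▸ (hmem i).2 hi)
    · exact (hasc' i j hi hij).ne h
  have hforbid : ∀ i j, i < j → t j ≤ s i → ¬ s i < s j := fun i j hij h1 h2 => by
    have hi : i + 1 ∈ D := by
      by_contra hi
      exact (hasc' i j hi hij).not_ge h1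
    have hj : j + 1 ∈ D := by
      by_contra hj
      rw [hsN j hj] at h2
      omega
    exact hnc i j hi hj hij (lt_of_le_of_ne h1 (hne i j hij).symm) h2
  have havoid : NatAvoids231 s := fun i j k hij hjk hki hij' =>
    hforbid i j hij (((ht hjk.le).trans (hle k)).trans hki.le) hij'
  refine ⟨Equiv.ofBijective s (bijective_of_injective_of_fixed hinj hfix),
    ⟨hD0, hX0, fun i => ?_, fun i j hij => ?_⟩, havoid, hfix⟩
  · simp only [Equiv.ofBijective_apply]
    constructor
    · intro hi
      by_contra hlt'
      have h1 : s (i + 1) ≠ s i := fun h => by have := hinj h; omega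
      exact hforbid i (i + 1) (by omega) ((htflat i hi).trans_le (hle i)) (by omega)
    · intro h
      by_contra hi
      exact (hasc i (i + 1) hi (by omega)).not_gt h
  · simp only [Equiv.ofBijective_apply] at hij ⊢
    rw [hmem]
    have hij' : i ≠ j := by rintro rfl; omega
    constructor
    · intro hj
      by_contra hlt'
      have := hlt j hj
      exact hforbid i j (by omega) (by omega) (by omega)
    · intro hji
      by_contra hj
      have := hasc j i hj hji
      omega

lemma HasDescents.eq_and_eq {s : Equiv.Perm ℕ} {D X D' X' : Finset ℕ} (h : HasDescents s D X)
    (h' : HasDescents s D' X') : D = D' ∧ X = X' := by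
  constructor
  · ext d
    rcases d with _ | i
    · exact iff_of_false h.zero_notMem_fst h'.zero_notMem_fst
    · rw [h.mem_fst, h'.mem_fst]
  · ext x
    rcases x with _ | x
    · exact iff_of_false h.zero_notMem_snd h'.zero_notMem_snd
    · obtain ⟨i, rfl⟩ := s.surjective x
      obtain ⟨j, hj⟩ := s.surjective (s i + 1)
      rw [← hj, h.mem_snd i j hj, h'.mem_snd i j hj]

/-- Extension of a permutation of `Fin n` to `ℕ` by the identity. -/
def extendNat {n : ℕ} (σ : Equiv.Perm (Fin n)) : Equiv.Perm ℕ :=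
  σ.extendDomain Fin.equivSubtype

lemma extendNat_coe {n : ℕ} (σ : Equiv.Perm (Fin n)) (i : Fin n) : extendNat σ i = σ i :=
  σ.extendDomain_apply_image Fin.equivSubtype i

lemma extendNat_of_le {n : ℕ} (σ : Equiv.Perm (Fin n)) {i : ℕ} (h : n ≤ i) : extendNat σ i = i :=
  σ.extendDomain_apply_not_subtype Fin.equivSubtype (by omega)

lemma extendNat_of_lt {n : ℕ} (σ : Equiv.Perm (Fin n)) {i : ℕ} (h : i < n) :
    extendNat σ i = σ ⟨i, h⟩ :=
  extendNat_coe σ ⟨i, h⟩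

lemma extendNat_inv_apply {n : ℕ} (σ : Equiv.Perm (Fin n)) (i : ℕ) :
    extendNat σ⁻¹ (extendNat σ i) = i := by
  rw [extendNat, extendNat, ← Equiv.Perm.extendDomain_inv]
  exact Equiv.symm_apply_apply _ _

lemma extendNat_injective (n : ℕ) : Function.Injective (extendNat (n := n)) := fun σ τ h => by
  ext i
  rw [← extendNat_coe, h, extendNat_coe]

lemma natAvoids231_extendNat {n : ℕ} {σ : Equiv.Perm (Fin n)} :
    NatAvoids231 (extendNat σ) ↔ Avoids231 σ := by
  constructor
  · rintro h ⟨i, j, k, hij, hjk, hki, hij'⟩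
    refine h i j k hij hjk ?_ ?_ <;> rw [extendNat_coe, extendNat_coe]
    exacts [hki, hij']
  · intro h i j k hij hjk hki hij'
    have hk : k < n := by
      by_contra hk
      rw [extendNat_of_le σ (not_lt.1 hk)] at hki
      rcases lt_or_ge i n with hi | hi
      · rw [extendNat_of_lt σ hi] at hki
        omega
      · rw [extendNat_of_le σ hi] at hki
        omega
    rw [extendNat_of_lt σ (show i < n by omega)] at hki hij'
    rw [extendNat_of_lt σ hk] at hki
    rw [extendNat_of_lt σ (show j < n by omega)] at hij'
    exact h ⟨⟨i, by omega⟩, ⟨j, by omega⟩, ⟨k, hk⟩, hij, hjk, hki, hij'⟩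

lemma succ_mem_permDes {n : ℕ} {σ : Equiv.Perm (Fin n)} {i : ℕ} :
    i + 1 ∈ permDes σ ↔ extendNat σ (i + 1) < extendNat σ i := by
  rw [permDes, Finset.mem_filter, Finset.mem_Ico]
  rcases lt_or_ge (i + 1) n with hi | hi
  · rw [extendNat_of_lt σ hi, extendNat_of_lt σ (show i < n by omega)]
    exact ⟨fun ⟨_, _, h⟩ => h, fun h => ⟨⟨by omega, hi⟩, hi, h⟩⟩
  · refine iff_of_false (by omega) ?_
    rw [extendNat_of_le σ hi]
    rcases lt_or_ge i n with h | h
    · rw [extendNat_of_lt σ h]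
      omega
    · rw [extendNat_of_le σ h]
      omega

lemma permDes_subset {n : ℕ} (σ : Equiv.Perm (Fin n)) : permDes σ ⊆ Finset.Ico 1 n :=
  Finset.filter_subset _ _

lemma hasDescents_extendNat {n : ℕ} (σ : Equiv.Perm (Fin n)) :
    HasDescents (extendNat σ) (permDes σ) (permDes σ⁻¹) where
  zero_notMem_fst h := by simpa using permDes_subset _ h
  zero_notMem_snd h := by simpa using permDes_subset _ h
  mem_fst _ := succ_mem_permDes
  mem_snd i j h := by
    rw [h, succ_mem_permDes, ← h, extendNat_inv_apply, extendNat_inv_apply]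

lemma exists_extendNat_eq {n : ℕ} {s : Equiv.Perm ℕ} (hs : ∀ i, n ≤ i → s i = i) :
    ∃ σ : Equiv.Perm (Fin n), extendNat σ = s := by
  have hlt : ∀ i < n, s i < n := fun i hi => by
    by_contra h
    have := s.injective (hs (s i) (by omega))
    omega
  have hinj : Function.Injective fun i : Fin n => (⟨s i, hlt i i.2⟩ : Fin n) := fun i j h =>
    Fin.ext (s.injective (Fin.ext_iff.1 h))
  refine ⟨Equiv.ofBijective _ (Finite.injective_iff_bijective.1 hinj), Equiv.ext fun i => ?_⟩
  rcases lt_or_ge i n with hi | hi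
  · rw [extendNat_of_lt _ hi, Equiv.ofBijective_apply]
  · rw [extendNat_of_le _ hi, hs i hi]

lemma bijOn_permDes (n : ℕ) :
    Set.BijOn (fun σ : Equiv.Perm (Fin n) => (permDes σ, permDes σ⁻¹)) {σ | Avoids231 σ}
      {P | IsDominatedPair n P} := by
  refine ⟨fun σ hσ => ?_, fun σ hσ τ hτ h => ?_, fun P hP => ?_⟩
  · have hs := natAvoids231_extendNat.2 hσ
    have h := hasDescents_extendNat σ
    refine ⟨permDes_subset _, permDes_subset _, h.card_eq hs, fun k => ?_⟩
    rcases k with _ | k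
    · rw [countBelow_zero]
      exact Nat.zero_le _
    · exact h.countBelow_le hs k
  · have hs := hasDescents_extendNat σ
    have ht := hasDescents_extendNat τ
    obtain ⟨h1, h2⟩ := Prod.mk.inj h
    rw [← h1, ← h2] at ht
    exact extendNat_injective n <| hs.unique (natAvoids231_extendNat.2 hσ) ht
      (natAvoids231_extendNat.2 hτ) fun d hd => (Finset.mem_Ico.1 (permDes_subset σ hd)).2
  · obtain ⟨D, X⟩ := P
    obtain ⟨s, hs, hav, hfix⟩ := IsDominatedPair.exists_perm hP
    obtain ⟨σ, rfl⟩ := exists_extendNat_eq hfix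
    obtain ⟨rfl, rfl⟩ := hs.eq_and_eq (hasDescents_extendNat σ)
    exact ⟨σ, natAvoids231_extendNat.1 hav, rfl⟩

lemma bijOn_valleyPair (n : ℕ) :
    Set.BijOn valleyPair {S | IsDyckSet n S} {P | IsDominatedPair n P} :=
  ⟨fun _ hS => hS.isDominatedPair_valleyPair, injOn_valleyPair n, fun _ hP => hP.exists_isDyckSet⟩

/-- The times of the north steps of the path obtained by reversing `w` and exchanging the two kinds
of steps. -/
def reversedSteps {n : ℕ} (w : Fin (2 * n) → Bool) : Finset ℕ :=
  (Finset.univ.filter fun t => w t = false).image fun t : Fin (2 * n) => 2 * n - 1 - (t : ℕ)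

lemma mem_reversedSteps {n : ℕ} {w : Fin (2 * n) → Bool} {q : ℕ} :
    q ∈ reversedSteps w ↔ ∃ h : q < 2 * n, w ⟨2 * n - 1 - q, by omega⟩ = false := by
  simp only [reversedSteps, Finset.mem_image, Finset.mem_filter, Finset.mem_univ, true_and]
  constructor
  · rintro ⟨t, ht, rfl⟩
    have h : (⟨2 * n - 1 - (2 * n - 1 - (t : ℕ)), by omega⟩ : Fin (2 * n)) = t :=
      Fin.ext (show 2 * n - 1 - (2 * n - 1 - (t : ℕ)) = t by omega)
    exact ⟨by omega, by rw [h]; exact ht⟩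
  · rintro ⟨h, hw⟩
    exact ⟨_, hw, show 2 * n - 1 - (2 * n - 1 - q) = q by omega⟩

lemma countE_add_countBelow {n : ℕ} (w : Fin (2 * n) → Bool) {k : ℕ} (hk : k ≤ 2 * n) :
    countE w k + countBelow (reversedSteps w) (2 * n - k) = (reversedSteps w).card := by
  have hinj : Function.Injective fun t : Fin (2 * n) => 2 * n - 1 - (t : ℕ) := fun a b h => by
    dsimp only at h
    exact Fin.ext (by omega)
  rw [countBelow, reversedSteps, Finset.filter_image, Finset.card_image_of_injective _ hinj,
    Finset.card_image_of_injective _ hinj,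
    ← Finset.card_filter_add_card_filter_not (s := Finset.univ.filter fun t => w t = false)
      fun t : Fin (2 * n) => (t : ℕ) < k, countE, Finset.filter_filter]
  refine congrArg₂ (· + ·) (congrArg Finset.card ?_) (congrArg Finset.card ?_)
  · ext t
    simp only [Finset.mem_filter]
    tauto
  · ext t
    simp only [Finset.mem_filter, and_assoc]
    refine and_congr_right fun _ => and_congr_right fun _ => ?_
    omega

lemma countN_add_countE {m : ℕ} (w : Fin m → Bool) {k : ℕ} (hk : k ≤ m) :
    countN w k + countE w k = k := by
  have h1 : (Finset.univ.filter fun t : Fin m => (t : ℕ) < k).card = k := by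
    rw [Fin.card_filter_val_lt, min_eq_right hk]
  have h2 := Finset.card_filter_add_card_filter_not
    (s := Finset.univ.filter fun t : Fin m => (t : ℕ) < k) fun t => w t = true
  rw [h1, Finset.filter_filter, Finset.filter_filter] at h2
  simpa only [countN, countE, Bool.not_eq_true] using h2

lemma isDyckSet_reversedSteps {n : ℕ} (w : Fin (2 * n) → Bool) :
    IsDyckSet n (reversedSteps w) ↔ IsDyckA n w := by
  have htot := countE_add_countBelow w le_rfl
  have htot' := countN_add_countE w le_rfl
  rw [Nat.sub_self, countBelow_zero] at htot
  have hsub : reversedSteps w ⊆ Finset.range (2 * n) := fun q hq =>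
    Finset.mem_range.2 (mem_reversedSteps.1 hq).1
  constructor
  · rintro ⟨-, h2, h3⟩
    have hle : ∀ k ≤ 2 * n, countE w k ≤ countN w k := fun k hk => by
      have := countE_add_countBelow w hk
      have := countN_add_countE w hk
      have := h3 (2 * n - k) (by omega)
      omega
    refine ⟨by omega, fun k => ?_⟩
    rcases le_or_gt k (2 * n) with hk | hk
    · exact hle k hk
    · have h : ∀ t : Fin (2 * n), (t : ℕ) < k ↔ (t : ℕ) < 2 * n := fun t => by omega
      simpa only [countE, countN, h] using hle _ le_rfl
  · rintro ⟨h1, h2⟩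
    refine ⟨hsub, by omega, fun m hm => ?_⟩
    have h3 := countE_add_countBelow w (Nat.sub_le (2 * n) m)
    have h4 := countN_add_countE w (Nat.sub_le (2 * n) m)
    have h5 := h2 (2 * n - m)
    rw [Nat.sub_sub_self hm] at h3
    omega

lemma bijOn_reversedSteps (n : ℕ) :
    Set.BijOn (reversedSteps (n := n)) {w | IsDyckA n w} {S | IsDyckSet n S} := by
  refine ⟨fun w hw => (isDyckSet_reversedSteps w).2 hw, fun w _ v _ h => ?_, fun S hS => ?_⟩
  · have key : ∀ t, w t = false ↔ v t = false := fun t => by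
      have h1 := Finset.ext_iff.1 h (2 * n - 1 - t)
      rw [mem_reversedSteps, mem_reversedSteps] at h1
      have h2 : (⟨2 * n - 1 - (2 * n - 1 - (t : ℕ)), by omega⟩ : Fin (2 * n)) = t :=
        Fin.ext (show 2 * n - 1 - (2 * n - 1 - (t : ℕ)) = t by omega)
      have h3 : 2 * n - 1 - (t : ℕ) < 2 * n := by omega
      simpa only [h2, h3, exists_true_left] using h1
    funext t
    have := key t
    cases hw : w t <;> cases hv : v t <;> simp_all
  · have hw : reversedSteps (n := n) (fun t => decide (2 * n - 1 - (t : ℕ) ∉ S)) = S := by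
      ext q
      rw [mem_reversedSteps]
      simp only [decide_eq_false_iff_not, not_not]
      constructor
      · rintro ⟨h, hq⟩
        rwa [Nat.sub_sub_self (by omega)] at hq
      · intro hq
        have h := Finset.mem_range.1 (hS.1 hq)
        exact ⟨h, by rwa [Nat.sub_sub_self (by omega)]⟩
    refine ⟨_, ?_, hw⟩
    rw [Set.mem_ofPred_eq, ← isDyckSet_reversedSteps, hw]
    exact hS

lemma mem_pathDes_iff {n : ℕ} {w : Fin (2 * n) → Bool} {i : ℕ} (hi : i ≤ 2 * n) :
    i ∈ pathDes w ↔ 2 * n - i ∈ valleys (reversedSteps w) := by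
  rw [mem_valleys, mem_reversedSteps, mem_reversedSteps, pathDes, Finset.mem_filter,
    Finset.mem_Ioo]
  have h1 : 2 * n - 1 - (2 * n - i) = i - 1 := by omega
  constructor
  · rintro ⟨⟨h0, h2⟩, h', h3, h4⟩
    refine ⟨⟨by omega, by simpa only [h1] using h3⟩, by omega, ?_⟩
    rintro ⟨h5, h6⟩
    have h7 : 2 * n - 1 - (2 * n - i - 1) = i := by omega
    simp [h7, h4] at h6
  · rintro ⟨⟨h0, h2⟩, h3, h4⟩
    have h7 : 2 * n - 1 - (2 * n - i - 1) = i := by omega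
    refine ⟨⟨by omega, by omega⟩, by omega, by simpa only [h1] using h2, ?_⟩
    by_contra h5
    exact h4 ⟨by omega, by simpa only [h7, Bool.not_eq_true] using h5⟩

lemma majA_eq_sum_valleys {n : ℕ} (w : Fin (2 * n) → Bool) :
    majA n w = ∑ q ∈ valleys (reversedSteps w), q := by
  have hlt : ∀ i ∈ pathDes w, i < 2 * n := fun i hi =>
    (Finset.mem_Ioo.1 (Finset.mem_filter.1 hi).1).2
  have hlt' : ∀ q ∈ valleys (reversedSteps w), q < 2 * n := fun q hq =>
    (mem_reversedSteps.1 (mem_valleys.1 hq).1).1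
  refine Finset.sum_bij' (fun i _ => 2 * n - i) (fun q _ => 2 * n - q)
    (fun i hi => (mem_pathDes_iff (hlt i hi).le).1 hi) (fun q hq => ?_)
    (fun i hi => Nat.sub_sub_self (hlt i hi).le) (fun q hq => Nat.sub_sub_self (hlt' q hq).le)
    fun _ _ => rfl
  rw [mem_pathDes_iff (Nat.sub_le _ _), Nat.sub_sub_self (hlt' q hq).le]
  exact hq

lemma ncard_fiber_eq_of_bijOn {α β : Type*} {f : α → β} {A : Set α} {B : Set β}
    (hf : Set.BijOn f A B) {a : α → ℕ} {b : β → ℕ} (hab : ∀ x, b (f x) = a x) (k : ℕ) :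
    {x | x ∈ A ∧ a x = k}.ncard = {y | y ∈ B ∧ b y = k}.ncard := by
  rw [← (hf.injOn.mono fun x (hx : x ∈ {x | x ∈ A ∧ a x = k}) => hx.1).ncard_image]
  congr 1
  ext y
  constructor
  · rintro ⟨x, ⟨hx, rfl⟩, rfl⟩
    exact ⟨hf.mapsTo hx, hab x⟩
  · rintro ⟨hy, rfl⟩
    obtain ⟨x, hx, rfl⟩ := hf.surjOn hy
    exact ⟨x, ⟨hx, (hab x).symm⟩, rfl⟩

/-- For every `n ≥ 1` and every `k`, Dyck paths of length `n` with major index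
`k` are equinumerous with 231-avoiding permutations `σ` of `{1,…,n}` with
`maj(σ) + imaj(σ) = k`. -/
theorem maj_eq_majimaj_231 (n : ℕ) (hn : 1 ≤ n) (k : ℕ) :
    {w : Fin (2 * n) → Bool | IsDyckA n w ∧ majA n w = k}.ncard =
      {σ : Equiv.Perm (Fin n) | Avoids231 σ ∧ majP σ + imajP σ = k}.ncard := by
  have h1 := ncard_fiber_eq_of_bijOn ((bijOn_valleyPair n).comp (bijOn_reversedSteps n))
    (a := majA n) (b := fun P => ∑ d ∈ P.1, d + ∑ x ∈ P.2, x)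
    (fun w => (valleyPair_sum _).trans (majA_eq_sum_valleys w).symm) k
  have h2 := ncard_fiber_eq_of_bijOn (bijOn_permDes n) (a := fun σ => majP σ + imajP σ)
    (b := fun P => ∑ d ∈ P.1, d + ∑ x ∈ P.2, x) (fun _ => rfl) k
  exact h1.trans h2.symm

end Stmt
end
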